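/- Let s ≥ 1 and d ≥ (2s+16)(15s+453) be integers and let δ > 0. There exist a threshold p_0, a real constant c > 0 and an integer K, all depending only on δ and d, such that for every prime p ≥ p_0 the following holds. Let M : 𝔽_p^d → 𝔽_p be a non-degenerate quadratic form, let H ⊆ 𝔽_p^d with |H| > δ·p^d, and let ξ_1, ξ_2, ξ_3, ξ_4 : H → HP_d(s) be maps. Suppose there is a set U ⊆ {(h_1,h_2,h_3,h_4) ∈ H^4 : h_1 + h_2 = h_3 + h_4} with |U| > δ·|H|^3 such that ξ_1(h_1) + ξ_2(h_2) − ξ_3(h_3) − ξ_4(h_4) ∈ J^M_{h_1,h_2,h_3} for every (h_1,h_2,h_3,h_4) ∈ U. Then there exist a subset H' ⊆ H with |H'| ≥ c·p^d, an element g ∈ HP_d(s), and an almost linear Freiman homomorphism T : H' → HP_d(s) of complexity at most K such that ξ_1(h) − T(h) − g ∈ J^M_h for all h ∈ H'. -/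

import Mathlib

noncomputable section

open MvPolynomial

/-- The quadratic polynomial `n ↦ (nA)·n`. -/
def quadPoly (p d : ℕ) (A : Matrix (Fin d) (Fin d) (ZMod p)) :
    MvPolynomial (Fin d) (ZMod p) :=
  ∑ i : Fin d, ∑ j : Fin d, MvPolynomial.C (A i j) * (MvPolynomial.X i * MvPolynomial.X j)

/-- The linear polynomial `n ↦ (hA)·n`. -/
def linPoly (p d : ℕ) (A : Matrix (Fin d) (Fin d) (ZMod p)) (h : Fin d → ZMod p) :
    MvPolynomial (Fin d) (ZMod p) :=
  ∑ j : Fin d, MvPolynomial.C (∑ i : Fin d, h i * A i j) * MvPolynomial.X j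

/-- The ideal `J^M_V` attached to the quadratic form with associated matrix `A` and the
set of vectors `V`: it is generated by `n ↦ (nA)·n` and `n ↦ (hA)·n` for `h ∈ V`. -/
def JM (p d : ℕ) (A : Matrix (Fin d) (Fin d) (ZMod p)) (V : Set (Fin d → ZMod p)) :
    Ideal (MvPolynomial (Fin d) (ZMod p)) :=
  Ideal.span ({quadPoly p d A} ∪ (linPoly p d A '' V))

/-- `M` is the quadratic form `n ↦ (nA)·n + n·u + v` with `A` symmetric. -/
def IsQuadFormWith (p d : ℕ) (M : (Fin d → ZMod p) → ZMod p)
    (A : Matrix (Fin d) (Fin d) (ZMod p)) (u : Fin d → ZMod p) (v : ZMod p) : Prop :=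
  A.IsSymm ∧ ∀ n : Fin d → ZMod p,
    M n = (∑ j : Fin d, (∑ i : Fin d, n i * A i j) * n j) + (∑ i : Fin d, n i * u i) + v

/-- The real-valued auxiliary function `h ↦ ∑ i {α_i · τ(h)}·β_i`, where the `α_i` are the
vectors `(α' i)/p ∈ ((1/p)ℤ)^d` and the `β_i` are `(β' i)/p ∈ (1/p)ℤ`. -/
def alfAux (p d K : ℕ) (α : Fin K → Fin d → ℤ) (β : Fin K → ℤ) (h : Fin d → ZMod p) : ℝ :=
  ∑ i : Fin K,
    Int.fract (∑ j : Fin d, ((α i j : ℝ) / (p : ℝ)) * (((h j).val : ℕ) : ℝ)) *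
      ((β i : ℝ) / (p : ℝ))

/-- `ξ : H → 𝔽_p` is an almost linear Freiman homomorphism of complexity at most `K`. -/
def IsALFHom (p d K : ℕ) (H : Set (Fin d → ZMod p)) (ξ : (Fin d → ZMod p) → ZMod p) : Prop :=
  ∃ (α : Fin K → Fin d → ℤ) (β : Fin K → ℤ),
    (∀ h ∈ H, ∃ m : ℤ, (p : ℝ) * alfAux p d K α β h = (m : ℝ) ∧ ξ h = (m : ZMod p)) ∧
    (∀ h₁ ∈ H, ∀ h₂ ∈ H, ∀ h₃ ∈ H, ∀ h₄ ∈ H, h₁ + h₂ = h₃ + h₄ →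
      ∃ z : ℤ, alfAux p d K α β h₁ + alfAux p d K α β h₂
        - alfAux p d K α β h₃ - alfAux p d K α β h₄ = (z : ℝ))

/-- `T : H → HP_d(s)` is an almost linear Freiman homomorphism of complexity at most `K`:
for every monomial of degree `s`, the corresponding coefficient map is an almost linear
Freiman homomorphism of complexity at most `K`. -/
def IsALFHomPoly (p d s K : ℕ) (H : Set (Fin d → ZMod p))
    (T : (Fin d → ZMod p) → MvPolynomial (Fin d) (ZMod p)) : Prop :=
  ∀ m : Fin d →₀ ℕ, (m.sum fun _ e => e) = s →
    IsALFHom p d K H (fun h => MvPolynomial.coeff m (T h))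

set_option linter.all false

section DENS
variable {α β γ : Type*} [Fintype α] [Fintype β] [Fintype γ]

def ave (f : α → ℝ) : ℝ := (∑ x, f x) / Fintype.card α

open Classical in
def ind (P : Prop) : ℝ := if P then 1 else 0

def dens (P : α → Prop) : ℝ := ave fun x => ind (P x)

lemma ind_nonneg (P : Prop) : 0 ≤ ind P := by unfold ind; split_ifs <;> norm_num
lemma ind_le_one (P : Prop) : ind P ≤ 1 := by unfold ind; split_ifs <;> norm_num
lemma ind_true {P : Prop} (h : P) : ind P = 1 := by simp [ind, h]
lemma ind_false {P : Prop} (h : ¬ P) : ind P = 0 := by simp [ind, h]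
lemma ind_mono {P Q : Prop} (h : P → Q) : ind P ≤ ind Q := by
  by_cases hP : P
  · rw [ind_true hP, ind_true (h hP)]
  · rw [ind_false hP]; exact ind_nonneg _
lemma ind_and (P Q : Prop) : ind (P ∧ Q) = ind P * ind Q := by
  by_cases hP : P <;> by_cases hQ : Q <;> simp [ind, hP, hQ]
lemma ind_or_le (P Q : Prop) : ind (P ∨ Q) ≤ ind P + ind Q := by
  by_cases hP : P <;> by_cases hQ : Q <;> simp [ind, hP, hQ]
lemma ind_forall {ι : Type*} [Fintype ι] (P : ι → Prop) : ind (∀ i, P i) = ∏ i, ind (P i) := by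
  classical
  by_cases h : ∀ i, P i
  · rw [ind_true h]; symm; exact Finset.prod_eq_one fun i _ => ind_true (h i)
  · rw [ind_false h]; push Not at h; obtain ⟨i, hi⟩ := h
    symm; exact Finset.prod_eq_zero (Finset.mem_univ i) (ind_false hi)
lemma ind_exists_le {ι : Type*} [Fintype ι] (P : ι → Prop) : ind (∃ i, P i) ≤ ∑ i, ind (P i) := by
  by_cases h : ∃ i, P i
  · rw [ind_true h]; obtain ⟨i, hi⟩ := h
    rw [← ind_true hi]
    exact Finset.single_le_sum (f := fun i => ind (P i)) (fun j _ => ind_nonneg _) (Finset.mem_univ i)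
  · rw [ind_false h]; exact Finset.sum_nonneg fun i _ => ind_nonneg _
lemma ind_sq (P : Prop) : ind P * ind P = ind P := by
  by_cases hP : P <;> simp [ind, hP]

lemma ave_mono {f g : α → ℝ} (h : ∀ x, f x ≤ g x) : ave f ≤ ave g :=
  div_le_div_of_nonneg_right (Finset.sum_le_sum fun x _ => h x) (Nat.cast_nonneg _)
lemma ave_nonneg {f : α → ℝ} (h : ∀ x, 0 ≤ f x) : 0 ≤ ave f :=
  div_nonneg (Finset.sum_nonneg fun x _ => h x) (Nat.cast_nonneg _)
lemma ave_const [Nonempty α] (c : ℝ) : ave (fun _ : α => c) = c := by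
  have : (Fintype.card α : ℝ) ≠ 0 := by exact_mod_cast Fintype.card_ne_zero
  simp [ave]
lemma ave_le [Nonempty α] {f : α → ℝ} {c : ℝ} (h : ∀ x, f x ≤ c) : ave f ≤ c :=
  (ave_mono h).trans_eq (ave_const c)
lemma le_ave [Nonempty α] {f : α → ℝ} {c : ℝ} (h : ∀ x, c ≤ f x) : c ≤ ave f :=
  (ave_const (α := α) c).symm.le.trans (ave_mono h)
lemma ave_add (f g : α → ℝ) : ave (fun x => f x + g x) = ave f + ave g := by
  simp [ave, Finset.sum_add_distrib, add_div]
lemma ave_sub (f g : α → ℝ) : ave (fun x => f x - g x) = ave f - ave g := by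
  simp [ave, Finset.sum_sub_distrib, sub_div]
lemma ave_mul_left (c : ℝ) (f : α → ℝ) : ave (fun x => c * f x) = c * ave f := by
  simp [ave, ← Finset.mul_sum, mul_div_assoc]
lemma ave_mul_right (c : ℝ) (f : α → ℝ) : ave (fun x => f x * c) = ave f * c := by
  simp [ave, ← Finset.sum_mul]; ring
lemma ave_sum {ι : Type*} (t : Finset ι) (f : ι → α → ℝ) :
    ave (fun x => ∑ i ∈ t, f i x) = ∑ i ∈ t, ave (f i) := by
  simp only [ave]; rw [Finset.sum_comm, Finset.sum_div]
lemma ave_prod (f : α × β → ℝ) : ave f = ave fun x => ave fun y => f (x, y) := by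
  simp only [ave, Fintype.card_prod, Fintype.sum_prod_type, ← Finset.sum_div]
  push_cast; rw [div_div, mul_comm]
lemma ave_comm (f : α → β → ℝ) : ave (fun x => ave fun y => f x y) = ave fun y => ave fun x => f x y := by
  simp only [ave, ← Finset.sum_div]
  rw [Finset.sum_comm, div_div, div_div, mul_comm]
lemma ave_equiv (e : α ≃ β) (f : β → ℝ) : ave (fun x => f (e x)) = ave f := by
  simp only [ave]; rw [Equiv.sum_comp e f, Fintype.card_congr e]
lemma exists_le_ave [Nonempty α] (f : α → ℝ) : ∃ x, ave f ≤ f x := by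
  by_contra h; push Not at h
  have h1 : ∑ x, f x < ∑ _x : α, ave f := Finset.sum_lt_sum_of_nonempty Finset.univ_nonempty fun x _ => h x
  have : (Fintype.card α : ℝ) ≠ 0 := by exact_mod_cast Fintype.card_ne_zero
  simp [ave] at h1
  field_simp at h1
  exact lt_irrefl _ h1
lemma ave_pow_le [Nonempty α] {f : α → ℝ} (h : ∀ x, 0 ≤ f x) (n : ℕ) :
    (ave f) ^ n ≤ ave fun x => f x ^ n := by
  have : (Fintype.card α : ℝ) ≠ 0 := by exact_mod_cast Fintype.card_ne_zero
  have := Real.pow_arith_mean_le_arith_mean_pow Finset.univ (fun _ : α => (Fintype.card α : ℝ)⁻¹) f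
    (fun _ _ => by positivity) (by simp) (fun x _ => h x) n
  simp only [← Finset.mul_sum] at this
  simpa [ave, div_eq_inv_mul] using this
lemma ave_pi (n : ℕ) (f : α → ℝ) : ave (fun y : Fin n → α => ∏ i, f (y i)) = (ave f) ^ n := by
  classical
  have h := Finset.prod_univ_sum (fun _ : Fin n => (Finset.univ : Finset α)) (fun _ x => f x)
  simp only [Finset.prod_const, Finset.card_univ, Fintype.card_fin, Fintype.piFinset_univ] at h
  simp only [ave, div_pow]
  rw [← h]; simp

lemma dens_nonneg (P : α → Prop) : 0 ≤ dens P := ave_nonneg fun _ => ind_nonneg _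
lemma dens_le_one [Nonempty α] (P : α → Prop) : dens P ≤ 1 := ave_le fun _ => ind_le_one _
lemma dens_mono {P Q : α → Prop} (h : ∀ x, P x → Q x) : dens P ≤ dens Q :=
  ave_mono fun x => ind_mono (h x)
lemma dens_or_le (P Q : α → Prop) : dens (fun x => P x ∨ Q x) ≤ dens P + dens Q := by
  rw [dens, dens, dens, ← ave_add]; exact ave_mono fun x => ind_or_le _ _
lemma dens_exists_le {ι : Type*} [Fintype ι] (P : ι → α → Prop) :
    dens (fun x => ∃ i, P i x) ≤ ∑ i, dens (P i) := by
  unfold dens; rw [← ave_sum]; exact ave_mono fun x => ind_exists_le _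
lemma dens_diff (P Q : α → Prop) : dens P - dens Q ≤ dens (fun x => P x ∧ ¬ Q x) := by
  have : dens P ≤ dens (fun x => Q x ∨ (P x ∧ ¬ Q x)) := dens_mono fun x h => by tauto
  linarith [dens_or_le Q (fun x => P x ∧ ¬ Q x)]
lemma dens_pos {P : α → Prop} (h : 0 < dens P) : ∃ x, P x := by
  by_contra hn; push Not at hn
  have : dens P = 0 := by simp [dens, ave, ind_false (hn _)]
  linarith
lemma dens_prod (P : α × β → Prop) : dens P = ave fun x => dens fun y => P (x, y) := ave_prod _
lemma dens_prod' (P : α × β → Prop) : dens P = ave fun y => dens fun x => P (x, y) := by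
  rw [dens_prod]; exact ave_comm _
lemma dens_equiv (e : α ≃ β) (P : β → Prop) : dens (fun x => P (e x)) = dens P := ave_equiv e (fun x => ind (P x))
lemma dens_fibre_le [Nonempty α] {P : α × β → Prop} {c : ℝ} (h : ∀ x, dens (fun y => P (x, y)) ≤ c) :
    dens P ≤ c := by rw [dens_prod]; exact ave_le h
lemma dens_fibre_le' [Nonempty β] {P : α × β → Prop} {c : ℝ} (h : ∀ y, dens (fun x => P (x, y)) ≤ c) :
    dens P ≤ c := by rw [dens_prod']; exact ave_le h
lemma dens_pi (n : ℕ) (P : α → Prop) : dens (fun y : Fin n → α => ∀ i, P (y i)) = dens P ^ n := by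
  unfold dens; rw [← ave_pi]; simp only [ind_forall]
lemma dens_and_left (P : Prop) (Q : α → Prop) : dens (fun x => P ∧ Q x) = ind P * dens Q := by
  unfold dens; rw [← ave_mul_left]; simp only [ind_and]
lemma dens_eq [DecidableEq α] (P : α → Prop) [DecidablePred P] :
    dens P = ((Finset.univ.filter P).card : ℝ) / Fintype.card α := by
  unfold dens ave
  congr 1
  rw [Finset.card_filter]; push_cast
  exact Finset.sum_congr rfl fun x _ => by unfold ind; congr
lemma dens_le_fst [Nonempty β] {P : α × β → Prop} {Q : α → Prop} (h : ∀ x, P x → Q x.1) : dens P ≤ dens Q := by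
  rw [dens_prod]
  refine ave_mono fun x => ?_
  by_cases hx : Q x
  · rw [ind_true hx]; exact dens_le_one _
  · rw [ind_false hx]
    refine ave_le (α := β) fun y => ?_
    rw [ind_false fun h' => hx (h (x, y) h')]
lemma dens_fst [Nonempty β] (Q : α → Prop) : dens (fun x : α × β => Q x.1) = dens Q := by
  rw [dens_prod]; simp only [dens]; congr 1; ext x; exact ave_const _
end DENS

abbrev VV (p d : ℕ) := Fin d → ZMod p
abbrev Pol (p d : ℕ) := MvPolynomial (Fin d) (ZMod p)

/-- standing assumptions -/
structure Std (p d s : ℕ) (A : Matrix (Fin d) (Fin d) (ZMod p)) : Prop where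
  prime : p.Prime
  symm : A.IsSymm
  det : A.det ≠ 0
  odd : (2 : ZMod p) ≠ 0
  dim : 10 * s + 1000 ≤ d

section ALG
variable {p d s : ℕ} [Fact p.Prime] (A : Matrix (Fin d) (Fin d) (ZMod p))

def Lf (p d : ℕ) : VV p d →ₗ[ZMod p] Pol p d where
  toFun c := ∑ j, C (c j) * X j
  map_add' a b := by simp [add_mul, Finset.sum_add_distrib]
  map_smul' r a := by simp [Finset.smul_sum, MvPolynomial.smul_eq_C_mul, mul_assoc]

lemma Lf_apply (c : VV p d) : Lf p d c = ∑ j, C (c j) * X j := rfl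

lemma Lf_single (j : Fin d) : Lf p d (Pi.single j 1) = X j := by
  rw [Lf_apply, Finset.sum_eq_single j]
  · simp
  · intro b _ hb; simp [hb]
  · simp

lemma Lf_hom (c : VV p d) : (Lf p d c).IsHomogeneous 1 := by
  rw [Lf_apply]
  exact IsHomogeneous.sum _ _ _ (fun j _ => by simpa using (isHomogeneous_C _ (c j)).mul (isHomogeneous_X _ j))

lemma coeff_Lf (c : VV p d) (j : Fin d) : coeff (Finsupp.single j 1) (Lf p d c) = c j := by
  classical
  rw [Lf_apply, coeff_sum, Finset.sum_eq_single j]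
  · simp [coeff_C_mul]
  · intro b _ hb; simp [coeff_C_mul, coeff_X, Finsupp.single_left_inj, hb]
  · simp

lemma Lf_inj {c : VV p d} (h : Lf p d c = 0) : c = 0 := by
  ext j; rw [← coeff_Lf c j, h]; simp

lemma Lf_prime {c : VV p d} (h : c ≠ 0) : Prime (Lf p d c) := by
  have hne : Lf p d c ≠ 0 := fun h' => h (Lf_inj h')
  refine Irreducible.prime (irreducible_of_totalDegree_eq_one ((Lf_hom c).totalDegree hne) ?_)
  intro x hx
  obtain ⟨i, hi⟩ := MvPolynomial.ne_zero_iff.1 hne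
  rcases eq_or_ne x 0 with rfl | hx0
  · exact absurd (zero_dvd_iff.1 (hx i)) hi
  · exact isUnit_iff_ne_zero.2 hx0

def lin : VV p d →ₗ[ZMod p] Pol p d := (Lf p d).comp (Matrix.vecMulLinear A)

lemma lin_apply (h : VV p d) : lin A h = linPoly p d A h := by
  simp [lin, linPoly, Lf_apply, Matrix.vecMul, dotProduct]

lemma lin_hom (h : VV p d) : (lin A h).IsHomogeneous 1 := Lf_hom _

def JJ (W : Submodule (ZMod p) (VV p d)) : Ideal (Pol p d) := JM p d A (W : Set (VV p d))

def Il (W : Submodule (ZMod p) (VV p d)) : Ideal (Pol p d) := Ideal.span (lin A '' W)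

lemma JJ_eq (W : Submodule (ZMod p) (VV p d)) : JJ A W = Ideal.span {quadPoly p d A} ⊔ Il A W := by
  rw [JJ, JM, Ideal.span_union, Il]
  congr 2

lemma Q_mem (W : Submodule (ZMod p) (VV p d)) : quadPoly p d A ∈ JJ A W := by
  rw [JJ_eq]; exact Ideal.mem_sup_left (Ideal.mem_span_singleton_self _)

lemma Il_le (W : Submodule (ZMod p) (VV p d)) : Il A W ≤ JJ A W := by
  rw [JJ_eq]; exact le_sup_right

lemma lin_mem {W : Submodule (ZMod p) (VV p d)} {w : VV p d} (h : w ∈ W) : lin A w ∈ JJ A W :=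
  Il_le A W (Ideal.subset_span ⟨w, h, rfl⟩)

lemma JJ_mono {W W' : Submodule (ZMod p) (VV p d)} (h : W ≤ W') : JJ A W ≤ JJ A W' :=
  Ideal.span_mono (Set.union_subset_union_right _ (Set.image_mono h))

lemma quad_hom : (quadPoly p d A).IsHomogeneous 2 := by
  refine IsHomogeneous.sum _ _ _ fun i _ => IsHomogeneous.sum _ _ _ fun j _ => ?_
  simpa using (isHomogeneous_C _ (A i j)).mul ((isHomogeneous_X _ i).mul (isHomogeneous_X _ j))

attribute [local instance] MvPolynomial.gradedAlgebra in
lemma J2 {W : Submodule (ZMod p) (VV p d)} {f : Pol p d} (n : ℕ) (hf : f ∈ JJ A W) :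
    homogeneousComponent n f ∈ JJ A W := by
  have h : (JJ A W).IsHomogeneous (homogeneousSubmodule (Fin d) (ZMod p)) := by
    refine Ideal.homogeneous_span _ _ ?_
    rintro x (rfl | ⟨w, hw, rfl⟩)
    · exact ⟨2, quad_hom A⟩
    · exact ⟨1, by rw [← lin_apply]; exact lin_hom A w⟩
  exact homogeneousComponent_mem_of_mem h hf n

lemma hc_mul_zero {n k : ℕ} (hk : n < k) {P g : Pol p d} (hP : P.IsHomogeneous k) :
    homogeneousComponent n (P * g) = 0 := by
  rw [← sum_homogeneousComponent g, Finset.mul_sum, map_sum]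
  refine Finset.sum_eq_zero fun i _ => ?_
  rw [homogeneousComponent_of_mem (hP.mul (homogeneousComponent_isHomogeneous i g)), if_neg (by omega)]

lemma exists_phi (W : Submodule (ZMod p) (VV p d)) : ∃ φ : Pol p d →ₐ[ZMod p] Pol p d,
    (∀ f, f - φ f ∈ Il A W) ∧ (∀ f ∈ Il A W, φ f = 0) ∧
    (∀ v, ∃ c, φ (lin A v) = Lf p d c) := by
  obtain ⟨q, hq⟩ := Submodule.exists_isCompl (W.map (Matrix.vecMulLinear A))
  set W' := W.map (Matrix.vecMulLinear A) with hW'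
  let π : VV p d →ₗ[ZMod p] VV p d := q.subtype.comp (Submodule.projectionOnto q W' hq.symm)
  have hπ1 : ∀ w ∈ W', π w = 0 := by
    intro w hw
    have := (Submodule.projectionOnto_apply_eq_zero_iff hq.symm (x := w)).2 hw
    simp [π, this]
  have hπ2 : ∀ c, c - π c ∈ W' := by
    intro c
    have : Submodule.projectionOnto q W' hq.symm (c - π c) = 0 := by
      rw [map_sub, sub_eq_zero]
      exact (Submodule.projectionOnto_apply_left hq.symm _).symm
    exact (Submodule.projectionOnto_apply_eq_zero_iff hq.symm).1 this
  let φ : Pol p d →ₐ[ZMod p] Pol p d := aeval (fun j => Lf p d (π (Pi.single j 1)))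
  have hL : ∀ w' ∈ W', Lf p d w' ∈ Il A W := by
    rintro _ ⟨w, hw, rfl⟩
    exact Ideal.subset_span ⟨w, hw, rfl⟩
  have hφL : ∀ c, φ (Lf p d c) = Lf p d (π c) := by
    intro c
    have : φ.toLinearMap ∘ₗ Lf p d = Lf p d ∘ₗ π := by
      refine LinearMap.pi_ext' fun j => LinearMap.ext_ring ?_
      simp [Lf_single, φ]
    exact LinearMap.congr_fun this c
  refine ⟨φ, ?_, ?_, ?_⟩
  · intro f
    have : (Ideal.Quotient.mkₐ (ZMod p) (Il A W)).comp φ = Ideal.Quotient.mkₐ (ZMod p) (Il A W) := by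
      refine MvPolynomial.algHom_ext fun j => ?_
      simp only [AlgHom.comp_apply, Ideal.Quotient.mkₐ_eq_mk]
      symm
      rw [Ideal.Quotient.eq, ← Lf_single, hφL, ← map_sub]
      exact hL _ (hπ2 _)
    have h2 := congrArg (fun g => g f) this
    simp only [AlgHom.comp_apply, Ideal.Quotient.mkₐ_eq_mk] at h2
    exact Ideal.Quotient.eq.1 h2.symm
  · have : Il A W ≤ RingHom.ker φ := by
      refine Ideal.span_le.2 ?_
      rintro _ ⟨w, hw, rfl⟩
      show φ (lin A w) = 0
      simp only [lin, LinearMap.comp_apply]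
      rw [hφL, hπ1 _ (Submodule.mem_map_of_mem hw), map_zero]
    exact fun f hf => this hf
  · intro v
    exact ⟨_, hφL _⟩

lemma mem_JJ_iff {W : Submodule (ZMod p) (VV p d)} {φ : Pol p d →ₐ[ZMod p] Pol p d}
    (h1 : ∀ f, f - φ f ∈ Il A W) (h2 : ∀ f ∈ Il A W, φ f = 0) (f : Pol p d) :
    f ∈ JJ A W ↔ φ (quadPoly p d A) ∣ φ f := by
  constructor
  · intro hf
    rw [JJ_eq] at hf
    obtain ⟨a, ha, b, hb, rfl⟩ := Submodule.mem_sup.1 hf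
    obtain ⟨c, rfl⟩ := Ideal.mem_span_singleton.1 ha
    rw [map_add, h2 b hb, add_zero, map_mul]
    exact dvd_mul_right _ _
  · rintro ⟨g, hg⟩
    have e : f = (f - φ f) - (quadPoly p d A - φ (quadPoly p d A)) * g + quadPoly p d A * g := by
      rw [hg]; ring
    rw [e]
    exact add_mem (sub_mem (Il_le A W (h1 f)) (Ideal.mul_mem_right _ _ (Il_le A W (h1 _))))
      (Ideal.mul_mem_right _ _ (Q_mem A W))

lemma eval_quad (n : VV p d) : eval n (quadPoly p d A) = Matrix.toBilin' A n n := by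
  simp only [quadPoly, map_sum, map_mul, eval_C, eval_X, Matrix.toBilin'_apply]
  refine Finset.sum_congr rfl fun i _ => Finset.sum_congr rfl fun j _ => by ring

lemma eval_lin (h n : VV p d) : eval n (lin A h) = Matrix.toBilin' A h n := by
  simp only [lin_apply, linPoly, map_sum, map_mul, eval_C, eval_X, Matrix.toBilin'_apply, Finset.sum_mul]
  rw [Finset.sum_comm]

variable {A}

lemma no_vanish (hA : Std p d s A) (W : Submodule (ZMod p) (VV p d)) (hW : Module.finrank (ZMod p) W ≤ 30)
    (h : ∀ n : VV p d, (∀ w ∈ W, Matrix.toBilin' A w n = 0) → Matrix.toBilin' A n n = 0) : False := by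
  set B := Matrix.toBilin' A with hB
  have hnd : B.Nondegenerate := LinearMap.BilinForm.nondegenerate_toBilin'_of_det_ne_zero' A hA.det
  have hsym : ∀ x y, B x y = B y x := by
    intro x y
    simp only [hB, Matrix.toBilin'_apply]
    rw [Finset.sum_comm]
    refine Finset.sum_congr rfl fun i _ => Finset.sum_congr rfl fun j _ => ?_
    rw [hA.symm.apply i j]; ring
  set N := LinearMap.BilinForm.orthogonal B W with hN
  have hNz : ∀ x ∈ N, B x x = 0 := fun x hx => h x hx
  have hNN : N ≤ LinearMap.BilinForm.orthogonal B N := by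
    intro x hx y hy
    have h1 := hNz _ (N.add_mem hx hy)
    simp only [map_add, LinearMap.add_apply, hNz x hx, hNz y hy, hsym x y] at h1
    have : 2 * B y x = 0 := by linear_combination h1
    exact (mul_eq_zero.1 this).resolve_left hA.odd
  have e1 := LinearMap.BilinForm.finrank_orthogonal hnd W
  have e2 := LinearMap.BilinForm.finrank_orthogonal hnd N
  have e3 := Submodule.finrank_mono hNN
  rw [← hN] at e1
  have e4 : Module.finrank (ZMod p) (Fin d → ZMod p) = d := by simp
  have e5 := Submodule.finrank_le W
  simp only [VV] at e1 e2 e3 e5 hW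
  have := hA.dim
  omega

lemma J1 (hA : Std p d s A) {W : Submodule (ZMod p) (VV p d)} (hW : Module.finrank (ZMod p) W ≤ 20)
    {v : VV p d} (hv : v ∉ W) {f : Pol p d} (hf : lin A v * f ∈ JJ A W) : f ∈ JJ A W := by
  obtain ⟨φ, h1, h2, h3⟩ := exists_phi A W
  rw [mem_JJ_iff A h1 h2] at hf ⊢
  obtain ⟨c, hc⟩ := h3 v
  have hker : ∀ n : VV p d, (∀ w ∈ W, Matrix.toBilin' A w n = 0) → ∀ g ∈ Il A W, eval n g = 0 := by
    intro n hn
    have : Il A W ≤ RingHom.ker (eval n) := by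
      refine Ideal.span_le.2 ?_
      rintro _ ⟨w, hw, rfl⟩
      show eval n (lin A w) = 0
      rw [eval_lin, hn w hw]
    exact fun g hg => this hg
  by_cases hdv : φ (lin A v) ∣ φ (quadPoly p d A)
  · exfalso
    obtain ⟨r, hr⟩ := hdv
    refine no_vanish hA (W ⊔ Submodule.span (ZMod p) {v}) ?_ ?_
    · have := Submodule.finrank_add_le_finrank_add_finrank W (Submodule.span (ZMod p) {v})
      have h5 := finrank_span_le_card (R := ZMod p) ({v} : Set (VV p d))
      simp at h5
      omega
    · intro n hn
      have hn' := hker n (fun w hw => hn w (Submodule.mem_sup_left hw))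
      have a1 := hn' _ (h1 (quadPoly p d A))
      have a2 := hn' _ (h1 (lin A v))
      have a3 := hn v (Submodule.mem_sup_right (Submodule.mem_span_singleton_self v))
      rw [map_sub, eval_lin, a3] at a2
      rw [map_sub, hr, map_mul, eval_quad] at a1
      have : eval n (φ (lin A v)) = 0 := by linear_combination -a2
      rw [this] at a1
      linear_combination a1
  · have hc0 : c ≠ 0 := by
      rintro rfl
      rw [map_zero] at hc
      have := h1 (lin A v)
      rw [hc, sub_zero] at this
      -- lin v ∈ Il W, so v ∈ W by nondegeneracy
      apply hv
      set B := Matrix.toBilin' A with hB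
      have hnd : B.Nondegenerate := LinearMap.BilinForm.nondegenerate_toBilin'_of_det_ne_zero' A hA.det
      have hrefl : B.IsRefl := by
        have hsym : ∀ x y, B x y = B y x := by
          intro x y
          simp only [hB, Matrix.toBilin'_apply]
          rw [Finset.sum_comm]
          refine Finset.sum_congr rfl fun i _ => Finset.sum_congr rfl fun j _ => ?_
          rw [hA.symm.apply i j]; ring
        intro x y h; rw [hsym, h]
      have := LinearMap.BilinForm.orthogonal_orthogonal hnd hrefl W
      rw [← this]
      intro n hn
      have hn0 : B v n = 0 := by
        rw [← eval_lin]; exact hker n (fun w hw => hn w hw) _ ‹_›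
      exact hrefl _ _ hn0
    have hpr := Lf_prime hc0
    rw [map_mul] at hf
    rw [hc] at hf hdv
    obtain ⟨g, hg⟩ := hf
    rcases hpr.dvd_or_dvd (Dvd.intro _ hg) with h | ⟨g', rfl⟩
    · exact absurd h hdv
    · refine ⟨g', mul_left_cancel₀ hpr.ne_zero ?_⟩
      rw [hg]; ring

lemma J4 {W : Submodule (ZMod p) (VV p d)} {u : VV p d} {f : Pol p d}
    (hf : f ∈ JJ A (W ⊔ Submodule.span (ZMod p) {u})) : ∃ g, f - lin A u * g ∈ JJ A W := by
  have : JJ A (W ⊔ Submodule.span (ZMod p) {u}) ≤ JJ A W ⊔ Ideal.span {lin A u} := by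
    rw [JJ_eq, sup_le_iff]
    refine ⟨?_, Ideal.span_le.2 ?_⟩
    · rw [JJ_eq]; exact le_sup_left.trans le_sup_left
    · rintro _ ⟨x, hx, rfl⟩
      obtain ⟨y, hy, z, hz, rfl⟩ := Submodule.mem_sup.1 hx
      obtain ⟨r, rfl⟩ := Submodule.mem_span_singleton.1 hz
      rw [map_add]
      refine add_mem (Ideal.mem_sup_left (lin_mem A hy)) (Ideal.mem_sup_right ?_)
      rw [map_smul, MvPolynomial.smul_eq_C_mul]
      exact Ideal.mul_mem_left _ _ (Ideal.mem_span_singleton_self _)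
  obtain ⟨a, ha, b, hb, rfl⟩ := Submodule.mem_sup.1 (this hf)
  obtain ⟨g, rfl⟩ := Ideal.mem_span_singleton.1 hb
  exact ⟨g, by simpa using ha⟩

end ALG

section ALG2
variable {p d s : ℕ} [Fact p.Prime] {A : Matrix (Fin d) (Fin d) (ZMod p)}

abbrev sp {p d : ℕ} (S : Set (VV p d)) : Submodule (ZMod p) (VV p d) := Submodule.span (ZMod p) S

lemma frk_sup (W : Submodule (ZMod p) (VV p d)) (u : VV p d) {n : ℕ} (h : Module.finrank (ZMod p) W ≤ n) :
    Module.finrank (ZMod p) ↥(W ⊔ sp {u}) ≤ n + 1 := by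
  have := Submodule.finrank_add_le_finrank_add_finrank W (sp {u})
  have h5 : Module.finrank (ZMod p) (sp {u}) ≤ 1 := by
    simpa using finrank_span_le_card (R := ZMod p) ({u} : Set (VV p d))
  omega

def Ind {ι : Type*} (W : Submodule (ZMod p) (VV p d)) (u : ι → VV p d) : Prop :=
  ∃ φ : ι → (VV p d →ₗ[ZMod p] ZMod p), (∀ i, ∀ w ∈ W, φ i w = 0) ∧ (∀ i, φ i (u i) = 1) ∧
    ∀ i j, i ≠ j → φ i (u j) = 0

lemma Ind.notMem {ι : Type*} {W : Submodule (ZMod p) (VV p d)} {u : ι → VV p d} (h : Ind W u) (i : ι)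
    {S : Set (VV p d)} (hS : ∀ x ∈ S, ∃ j, j ≠ i ∧ x = u j) : u i ∉ W ⊔ sp S := by
  obtain ⟨φ, h1, h2, h3⟩ := h
  intro hm
  have : W ⊔ sp S ≤ LinearMap.ker (φ i) := by
    refine sup_le (fun w hw => h1 i w hw) (Submodule.span_le.2 fun x hx => ?_)
    obtain ⟨j, hj, rfl⟩ := hS x hx
    exact h3 i j hj.symm
  have := this hm
  rw [LinearMap.mem_ker, h2] at this
  exact one_ne_zero this

lemma Ind.comp {ι κ : Type*} {W : Submodule (ZMod p) (VV p d)} {u : ι → VV p d} (h : Ind W u) (e : κ → ι)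
    (he : Function.Injective e) : Ind W (u ∘ e) := by
  obtain ⟨φ, h1, h2, h3⟩ := h
  exact ⟨φ ∘ e, fun i => h1 _, fun i => h2 _, fun i j hij => h3 _ _ (he.ne hij)⟩

lemma Ind.mono {ι : Type*} {W W' : Submodule (ZMod p) (VV p d)} {u : ι → VV p d} (h : Ind W u) (hW : W' ≤ W) :
    Ind W' u := by
  obtain ⟨φ, h1, h2, h3⟩ := h
  exact ⟨φ, fun i w hw => h1 i w (hW hw), h2, h3⟩

lemma Ind.cons {n : ℕ} {W : Submodule (ZMod p) (VV p d)} {u : Fin n → VV p d} (h : Ind W u) {x : VV p d}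
    (hx : x ∉ W ⊔ sp (Set.range u)) : Ind W (Fin.cons x u : Fin (n+1) → VV p d) := by
  obtain ⟨φ, h1, h2, h3⟩ := h
  obtain ⟨ψ0, hψ, hle⟩ := Submodule.exists_le_ker_of_notMem hx
  have hW : ∀ w ∈ W, ψ0 w = 0 := fun w hw => hle (Submodule.mem_sup_left hw)
  have hu : ∀ i, ψ0 (u i) = 0 := fun i => hle (Submodule.mem_sup_right (Submodule.subset_span ⟨i, rfl⟩))
  set ψ := (ψ0 x)⁻¹ • ψ0 with hψd
  have p1 : ψ x = 1 := by simp [hψd, hψ]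
  have p2 : ∀ w ∈ W, ψ w = 0 := fun w hw => by simp [hψd, hW w hw]
  have p3 : ∀ i, ψ (u i) = 0 := fun i => by simp [hψd, hu]
  refine ⟨Fin.cons ψ (fun i => φ i - (φ i x) • ψ), ?_, ?_, ?_⟩
  · intro i w hw
    refine Fin.cases ?_ (fun i => ?_) i
    · simpa using p2 w hw
    · simp [h1 i w hw, p2 w hw]
  · intro i
    refine Fin.cases ?_ (fun i => ?_) i
    · simpa using p1
    · simp [h2, p3]
  · intro i j
    refine Fin.cases ?_ (fun i => ?_) i <;> refine Fin.cases ?_ (fun j => ?_) j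
    · simp
    · simp [p3]
    · simp [p1]
    · intro hij
      simp [h3 i j (fun h => hij (by rw [h])), p3]

lemma J1prod (hA : Std p d s A) {W : Submodule (ZMod p) (VV p d)} (hW : Module.finrank (ZMod p) W ≤ 20)
    {ι : Type*} (t : Finset ι) (v : ι → VV p d) (hv : ∀ i ∈ t, v i ∉ W) {f : Pol p d}
    (hf : (∏ i ∈ t, lin A (v i)) * f ∈ JJ A W) : f ∈ JJ A W := by
  classical
  induction t using Finset.induction_on with
  | empty => simpa using hf
  | insert a t ha ih =>
    rw [Finset.prod_insert ha, mul_assoc] at hf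
    exact ih (fun i hi => hv i (Finset.mem_insert_of_mem hi)) (J1 hA hW (hv a (Finset.mem_insert_self _ _)) hf)

lemma J5 (hA : Std p d s A) {W : Submodule (ZMod p) (VV p d)} (hW : Module.finrank (ZMod p) W ≤ 19)
    {ι : Type*} (t : Finset ι) (v : ι → VV p d) (hv : ∀ i ∈ t, ∀ j ∈ t, i ≠ j → v i ∉ W ⊔ sp {v j})
    {f : Pol p d} (hf : ∀ i ∈ t, f ∈ JJ A (W ⊔ sp {v i})) :
    ∃ g, f - (∏ i ∈ t, lin A (v i)) * g ∈ JJ A W := by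
  classical
  induction t using Finset.induction_on with
  | empty => exact ⟨f, by simp⟩
  | insert a t ha ih =>
    obtain ⟨g, hg⟩ := ih (fun i hi j hj => hv i (Finset.mem_insert_of_mem hi) j (Finset.mem_insert_of_mem hj))
      (fun i hi => hf i (Finset.mem_insert_of_mem hi))
    have h1 : (∏ i ∈ t, lin A (v i)) * g ∈ JJ A (W ⊔ sp {v a}) := by
      have := sub_mem (hf a (Finset.mem_insert_self _ _)) (JJ_mono A (le_sup_left : W ≤ W ⊔ sp {v a}) hg)
      simpa using this
    have h2 := J1prod hA (frk_sup W (v a) hW) t v (fun i hi => hv i (Finset.mem_insert_of_mem hi) a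
      (Finset.mem_insert_self _ _) (by rintro rfl; exact ha hi)) h1
    obtain ⟨g', hg'⟩ := J4 h2
    refine ⟨g', ?_⟩
    rw [Finset.prod_insert ha]
    have := add_mem hg (Ideal.mul_mem_left _ (∏ i ∈ t, lin A (v i)) hg')
    convert this using 1
    ring

lemma prod_lin_hom {ι : Type*} (t : Finset ι) (v : ι → VV p d) :
    (∏ i ∈ t, lin A (v i)).IsHomogeneous t.card := by
  have := IsHomogeneous.prod t (fun i => lin A (v i)) (fun _ => 1) (fun i _ => lin_hom A (v i))
  simpa using this

lemma J3 (hA : Std p d s A) {W : Submodule (ZMod p) (VV p d)} (hW : Module.finrank (ZMod p) W ≤ 19)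
    {ι : Type*} [Fintype ι] (hι : s < Fintype.card ι) {v : ι → VV p d} (hv : Ind W v)
    {f : Pol p d} (hfs : f.IsHomogeneous s) (hf : ∀ i, f ∈ JJ A (W ⊔ sp {v i})) : f ∈ JJ A W := by
  obtain ⟨g, hg⟩ := J5 hA hW Finset.univ v (fun i _ j _ hij => hv.notMem i (by
    rintro x rfl; exact ⟨j, hij.symm, rfl⟩)) (fun i _ => hf i)
  have := J2 A s hg
  rwa [map_sub, homogeneousComponent_eq_self hfs, hc_mul_zero hι (prod_lin_hom _ _), sub_zero] at this

lemma glue (hA : Std p d s A) {W : Submodule (ZMod p) (VV p d)} (hW : Module.finrank (ZMod p) W ≤ 18)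
    {ι : Type*} [Fintype ι] {v : ι → VV p d} (hv : Ind W v)
    (f : ι → Pol p d) (hfs : ∀ i, (f i).IsHomogeneous s)
    (hf : ∀ i j, i ≠ j → f i - f j ∈ JJ A (W ⊔ sp {v i} ⊔ sp {v j})) :
    ∃ F : Pol p d, F.IsHomogeneous s ∧ ∀ i, F - f i ∈ JJ A (W ⊔ sp {v i}) := by
  classical
  suffices H : ∀ t : Finset ι, ∃ F : Pol p d, F.IsHomogeneous s ∧ ∀ i ∈ t, F - f i ∈ JJ A (W ⊔ sp {v i}) by
    obtain ⟨F, h1, h2⟩ := H Finset.univ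
    exact ⟨F, h1, fun i => h2 i (Finset.mem_univ _)⟩
  intro t
  induction t using Finset.induction_on with
  | empty => exact ⟨0, isHomogeneous_zero _ _ _, by simp⟩
  | insert a t ha ih =>
    obtain ⟨F, h1, h2⟩ := ih
    have hna : ∀ i ∈ t, i ≠ a := fun i hi h => ha (h ▸ hi)
    obtain ⟨g, hg⟩ := J5 hA (frk_sup W (v a) hW) t v (fun i hi j hj hij => by
        rw [sup_assoc, ← Submodule.span_union]
        refine hv.notMem i ?_
        rintro x (rfl | rfl)
        · exact ⟨a, (hna i hi).symm, rfl⟩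
        · exact ⟨j, hij.symm, rfl⟩) (f := F - f a) (fun i hi => by
        have e1 := JJ_mono A (le_sup_left : _ ≤ W ⊔ sp {v i} ⊔ sp {v a}) (h2 i hi)
        have e2 := add_mem e1 (hf i a (hna i hi))
        rw [sup_right_comm]
        simpa using e2)
    refine ⟨F - homogeneousComponent s ((∏ i ∈ t, lin A (v i)) * g),
      h1.sub (homogeneousComponent_isHomogeneous _ _), ?_⟩
    intro i hi
    rcases Finset.mem_insert.1 hi with rfl | hi
    · have := J2 A s hg
      rw [map_sub, homogeneousComponent_eq_self (h1.sub (hfs i))] at this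
      convert this using 1; ring
    · have e3 : (∏ i ∈ t, lin A (v i)) * g ∈ JJ A (W ⊔ sp {v i}) :=
        Ideal.mul_mem_right _ _ (Ideal.mem_of_dvd _ (Finset.dvd_prod_of_mem _ hi)
          (lin_mem A (Submodule.mem_sup_right (Submodule.mem_span_singleton_self _))))
      have := sub_mem (h2 i hi) (J2 A s e3)
      convert this using 1; ring

lemma card_sub (W : Submodule (ZMod p) (VV p d)) [Fintype W] : Fintype.card W = p ^ Module.finrank (ZMod p) W := by
  have := Module.card_eq_pow_finrank (K := ZMod p) (V := W)
  rwa [ZMod.card] at this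

instance : Nonempty (VV p d) := ⟨0⟩

lemma dens_sub (W : Submodule (ZMod p) (VV p d)) (h : Module.finrank (ZMod p) W < d) :
    dens (fun u => u ∈ W) ≤ 1 / p := by
  classical
  have hp : (0:ℝ) < p := by exact_mod_cast (Fact.out : p.Prime).pos
  have hp1 : (1:ℝ) ≤ p := by exact_mod_cast (Fact.out : p.Prime).one_le
  rw [dens_eq, ← Fintype.card_subtype]
  have e1 : Fintype.card {x // x ∈ W} = p ^ Module.finrank (ZMod p) W := card_sub W
  rw [e1]
  have e2 : Fintype.card (VV p d) = p ^ d := by simp [ZMod.card]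
  rw [e2]
  push_cast
  rw [div_le_div_iff₀ (by positivity) hp]
  rw [← pow_succ, one_mul]
  exact pow_le_pow_right₀ hp1 h

lemma frk_range (W : Submodule (ZMod p) (VV p d)) {n : ℕ} (u : Fin n → VV p d) :
    Module.finrank (ZMod p) ↥(W ⊔ sp (Set.range u)) ≤ Module.finrank (ZMod p) W + n := by
  have := Submodule.finrank_add_le_finrank_add_finrank W (sp (Set.range u))
  have h5 := finrank_range_le_card (R := ZMod p) u
  rw [Fintype.card_fin] at h5
  have h6 : Set.finrank (ZMod p) (Set.range u) = Module.finrank (ZMod p) ↥(sp (Set.range u)) := rfl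
  omega

lemma Gen (hA : Std p d s A) {W : Submodule (ZMod p) (VV p d)} (hW : Module.finrank (ZMod p) W ≤ 19)
    {f : Pol p d} (hfs : f.IsHomogeneous s) (hf : f ∉ JJ A W) :
    dens (fun u => f ∈ JJ A (W ⊔ sp {u})) ≤ 1 / p := by
  by_contra hcon
  push Not at hcon
  have H : ∀ n ≤ s + 1, ∃ v : Fin n → VV p d, Ind W v ∧ ∀ i, f ∈ JJ A (W ⊔ sp {v i}) := by
    intro n
    induction n with
    | zero => exact fun _ => ⟨fun i => i.elim0, ⟨fun i => i.elim0, fun i => i.elim0, fun i => i.elim0, fun i => i.elim0⟩, fun i => i.elim0⟩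
    | succ n ih =>
      intro hn
      obtain ⟨v, hv, hvf⟩ := ih (by omega)
      have hd := hA.dim
      have := dens_sub (W ⊔ sp (Set.range v)) (by have := frk_range W v; omega)
      have h2 := dens_diff (fun u => f ∈ JJ A (W ⊔ sp {u})) (fun u => u ∈ W ⊔ sp (Set.range v))
      obtain ⟨x, hx1, hx2⟩ := dens_pos (by linarith : 0 < dens (fun u => f ∈ JJ A (W ⊔ sp {u}) ∧ ¬ u ∈ W ⊔ sp (Set.range v)))
      refine ⟨Fin.cons x v, hv.cons hx2, fun i => ?_⟩
      refine Fin.cases ?_ (fun i => ?_) i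
      · simpa using hx1
      · simpa using hvf i
  obtain ⟨v, hv, hvf⟩ := H (s+1) le_rfl
  exact hf (J3 hA hW (by simp) hv hfs hvf)

lemma GenInd (W : Submodule (ZMod p) (VV p d)) (M : ℕ) (h : Module.finrank (ZMod p) W + M ≤ d) :
    dens (fun v : Fin M → VV p d => ¬ Ind W v) ≤ M / p := by
  induction M with
  | zero =>
    have : ∀ v : Fin 0 → VV p d, Ind W v := fun v => ⟨fun i => i.elim0, fun i => i.elim0, fun i => i.elim0, fun i => i.elim0⟩
    simp [dens, this, ave, ind]
  | succ M ih =>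
    rw [← dens_equiv (Fin.consEquiv (fun _ : Fin (M+1) => VV p d))]
    have hd := ih (by omega)
    have h1 : dens (fun x : VV p d × (Fin M → VV p d) => ¬ Ind W (Fin.cons x.1 x.2 : Fin (M+1) → VV p d)) ≤
        dens (fun x : VV p d × (Fin M → VV p d) => ¬ Ind W x.2) + dens (fun x : VV p d × (Fin M → VV p d) => x.1 ∈ W ⊔ sp (Set.range x.2)) := by
      refine (dens_mono fun x hx => ?_).trans (dens_or_le _ _)
      by_contra hc
      push Not at hc
      exact hx (hc.1.cons hc.2)
    have h2 : dens (fun x : VV p d × (Fin M → VV p d) => ¬ Ind W x.2) ≤ M / p :=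
      dens_fibre_le fun x => hd
    have h3 : dens (fun x : VV p d × (Fin M → VV p d) => x.1 ∈ W ⊔ sp (Set.range x.2)) ≤ 1 / p := by
      refine dens_fibre_le' fun y => ?_
      exact dens_sub (W ⊔ sp (Set.range y)) (by have := frk_range W y; omega)
    push_cast
    rw [add_div]
    exact h1.trans (add_le_add h2 h3)

end ALG2

section CNs
variable {p d s : ℕ} [Fact p.Prime] {A : Matrix (Fin d) (Fin d) (ZMod p)}

lemma vl_ring {R : Type*} [CommRing R] (n : ℕ) : ∀ (Φ : Polynomial R) (_ : Φ.natDegree ≤ n) (ζ : Fin (n+1) → R)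
    (_ : ∀ i j, i ≠ j → ∀ r, (ζ i - ζ j) * r = 0 → r = 0) (_ : ∀ i, Φ.eval (ζ i) = 0), Φ = 0 := by
  induction n with
  | zero =>
    intro Φ h ζ _ hr
    rw [Polynomial.eq_C_of_natDegree_le_zero h] at hr ⊢
    have := hr 0
    simp at this
    simp [this]
  | succ n ih =>
    intro Φ h ζ hζ hr
    nontriviality R
    obtain ⟨Ψ, hΨ⟩ := Polynomial.dvd_iff_isRoot.2 (hr 0 : Φ.IsRoot (ζ 0))
    rcases eq_or_ne Ψ 0 with h0 | h0
    · rw [hΨ, h0, mul_zero]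
    have hdeg : Φ.natDegree = 1 + Ψ.natDegree := by
      rw [hΨ, (Polynomial.monic_X_sub_C (ζ 0)).natDegree_mul' h0, Polynomial.natDegree_X_sub_C]
    have : Ψ = 0 := by
      refine ih Ψ (by omega) (fun i => ζ i.succ) (fun i j hij => hζ _ _ (by simpa using hij)) fun i => ?_
      refine hζ i.succ 0 (Fin.succ_ne_zero i) _ ?_
      have := hr i.succ
      rw [hΨ, Polynomial.eval_mul] at this
      simpa using this
    exact absurd this h0

lemma VL (hA : Std p d s A) {W : Submodule (ZMod p) (VV p d)} (hW : Module.finrank (ZMod p) W ≤ 20)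
    {n : ℕ} (Φ : Polynomial (Pol p d)) (hΦ : Φ.natDegree ≤ n) (z : Fin (n+1) → VV p d)
    (hz : ∀ i j, i ≠ j → z i - z j ∉ W) (h : ∀ i, Φ.eval (lin A (z i)) ∈ JJ A W) (k : ℕ) :
    Φ.coeff k ∈ JJ A W := by
  have : Φ.map (Ideal.Quotient.mk (JJ A W)) = 0 := by
    refine vl_ring n _ ((Polynomial.natDegree_map_le).trans hΦ) (fun i => Ideal.Quotient.mk _ (lin A (z i))) ?_ ?_
    · intro i j hij r hr
      obtain ⟨r, rfl⟩ := Ideal.Quotient.mk_surjective r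
      rw [← map_sub, ← map_mul, Ideal.Quotient.eq_zero_iff_mem, ← map_sub] at hr
      rw [Ideal.Quotient.eq_zero_iff_mem]
      exact J1 hA hW (hz i j hij) hr
    · intro i
      rw [Polynomial.eval_map_apply, Ideal.Quotient.eq_zero_iff_mem]
      exact h i
  rw [← Ideal.Quotient.eq_zero_iff_mem, ← Polynomial.coeff_map, this, Polynomial.coeff_zero]

lemma hc_mul {n k : ℕ} {P g : Pol p d} (hP : P.IsHomogeneous k) :
    homogeneousComponent (n + k) (g * P) = homogeneousComponent n g * P := by
  have e : homogeneousComponent (n+k) (g * P) = ∑ i ∈ Finset.range (g.totalDegree + 1), homogeneousComponent (n+k) (homogeneousComponent i g * P) := by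
    conv_lhs => rw [← sum_homogeneousComponent g, Finset.sum_mul, map_sum]
  have e2 : homogeneousComponent n g = ∑ i ∈ Finset.range (g.totalDegree + 1), homogeneousComponent n (homogeneousComponent i g) := by
    conv_lhs => rw [← sum_homogeneousComponent g, map_sum]
  rw [e, e2, Finset.sum_mul]
  refine Finset.sum_congr rfl fun i _ => ?_
  rw [homogeneousComponent_of_mem ((homogeneousComponent_isHomogeneous i g).mul hP),
    homogeneousComponent_of_mem (homogeneousComponent_isHomogeneous i g)]
  by_cases h : n = i
  · subst h; simp
  · rw [if_neg (by omega), if_neg h, zero_mul]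

/-- weighted projection -/
def wproj (s : ℕ) (Γ : Polynomial (Pol p d)) : Polynomial (Pol p d) :=
  ∑ j ∈ Finset.range (s+1), Polynomial.monomial j (homogeneousComponent (s - j) (Γ.coeff j))

lemma wproj_deg (Γ : Polynomial (Pol p d)) : (wproj s Γ).natDegree ≤ s := by
  refine Polynomial.natDegree_sum_le_of_forall_le _ _ fun j hj => ?_
  refine (Polynomial.natDegree_monomial_le _).trans ?_
  have := Finset.mem_range.1 hj; omega

lemma wproj_eval {Γ : Polynomial (Pol p d)} (h : Γ.natDegree ≤ s) (a : VV p d) :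
    (wproj s Γ).eval (lin A a) = homogeneousComponent s (Γ.eval (lin A a)) := by
  rw [Polynomial.eval_eq_sum_range' (Nat.lt_succ_of_le h), map_sum, wproj, Polynomial.eval_finsetSum]
  refine Finset.sum_congr rfl fun j hj => ?_
  have hj := Finset.mem_range.1 hj
  rw [Polynomial.eval_monomial]
  have e : (lin A a ^ j).IsHomogeneous j := by simpa using (lin_hom A a).pow j
  conv_rhs => rw [show s = (s - j) + j by omega]
  rw [hc_mul e]

lemma eval_sub_mem (Γ : Polynomial (Pol p d)) (a b : VV p d) :
    Γ.eval (lin A a) - Γ.eval (lin A b) ∈ JJ A (sp {a - b}) := by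
  refine Ideal.mem_of_dvd _ (Polynomial.sub_dvd_eval_sub _ _ Γ) ?_
  rw [← map_sub]
  exact lin_mem A (Submodule.mem_span_singleton_self _)

lemma newton (hA : Std p d s A) (n : ℕ) (z : Fin n → VV p d) (g : VV p d → Pol p d)
    (hz : ∀ k i j, i ≠ j → k ≠ i → k ≠ j → z k - z i ∉ sp {z k - z j})
    (hg : ∀ i j, g (z i) - g (z j) ∈ JJ A (sp {z i - z j})) :
    ∃ Γ : Polynomial (Pol p d), Γ.natDegree ≤ n - 1 ∧ ∀ i, g (z i) - Γ.eval (lin A (z i)) ∈ JJ A ⊥ := by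
  suffices H : ∀ k ≤ n, ∃ Γ : Polynomial (Pol p d), Γ.natDegree ≤ k - 1 ∧ ∀ i : Fin n, i.1 < k →
      g (z i) - Γ.eval (lin A (z i)) ∈ JJ A ⊥ by
    obtain ⟨Γ, h1, h2⟩ := H n le_rfl
    exact ⟨Γ, h1, fun i => h2 i i.2⟩
  intro k
  induction k with
  | zero => exact fun _ => ⟨0, by simp, fun i h => absurd h (by omega)⟩
  | succ k ih =>
    intro hk
    obtain ⟨Γ, h1, h2⟩ := ih (by omega)
    let κ : Fin n := ⟨k, hk⟩
    let t : Finset (Fin n) := Finset.univ.filter (fun i => i.1 < k)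
    have ht : ∀ i ∈ t, i.1 < k := fun i hi => (Finset.mem_filter.1 hi).2
    have htk : ∀ i ∈ t, κ ≠ i := fun i hi h => by have := ht i hi; rw [← h] at this; simp [κ] at this
    obtain ⟨h, hh⟩ := J5 hA (W := ⊥) (by simp) t (fun i => z κ - z i) (fun i hi j hj hij => by
        rw [bot_sup_eq]; exact hz κ i j hij (htk i hi) (htk j hj)) (f := g (z κ) - Γ.eval (lin A (z κ))) (fun i hi => by
        rw [bot_sup_eq]
        have e1 := hg κ i
        have e2 := JJ_mono A (bot_le : ⊥ ≤ sp {z κ - z i}) (h2 i (ht i hi))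
        have e3 := eval_sub_mem (A := A) Γ (z κ) (z i)
        have := sub_mem (add_mem e1 e2) e3
        convert this using 1; ring)
    refine ⟨Γ + Polynomial.C h * ∏ i ∈ t, (Polynomial.X - Polynomial.C (lin A (z i))), ?_, ?_⟩
    · have hc : t.card = k := by
        have : t = (Finset.univ : Finset (Fin k)).map (Fin.castLEEmb (by omega : k ≤ n)) := by
          ext i; simp only [t, Finset.mem_filter, Finset.mem_univ, true_and, Finset.mem_map]
          constructor
          · intro hi; exact ⟨⟨i, hi⟩, rfl⟩
          · rintro ⟨j, rfl⟩; exact j.2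
        rw [this, Finset.card_map, Finset.card_univ, Fintype.card_fin]
      refine (Polynomial.natDegree_add_le _ _).trans (max_le (by omega) ?_)
      refine (Polynomial.natDegree_C_mul_le _ _).trans ?_
      rw [Polynomial.natDegree_finsetProd_X_sub_C_eq_card]
      omega
    · intro i hi
      rw [Polynomial.eval_add, Polynomial.eval_mul, Polynomial.eval_C, Polynomial.eval_prod]
      simp only [Polynomial.eval_sub, Polynomial.eval_X, Polynomial.eval_C]
      by_cases hik : i.1 < k
      · have hit : i ∈ t := by simp [t, hik]
        rw [Finset.prod_eq_zero hit (sub_self _)]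
        simpa using h2 i hik
      · have : i = κ := Fin.ext (by simp [κ]; omega)
        subst this
        simp only [map_sub] at hh
        convert hh using 1; ring

lemma sp_le {x : VV p d} {W : Submodule (ZMod p) (VV p d)} (h : x ∈ W) : sp {x} ≤ W :=
  (Submodule.span_singleton_le_iff_mem x W).2 h

lemma mem_sp (x : VV p d) : x ∈ sp {x} := Submodule.mem_span_singleton_self x

lemma frk_sp (x : VV p d) : Module.finrank (ZMod p) (sp {x}) ≤ 1 := by
  simpa using finrank_span_le_card (R := ZMod p) ({x} : Set (VV p d))

lemma Ind.diff {ι κ : Type*} {W : Submodule (ZMod p) (VV p d)} {u : ι → VV p d} (h : Ind W u) (i0 : ι) (e : κ → ι)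
    (he : Function.Injective e) (h0 : ∀ k, e k ≠ i0) : Ind W (fun k => u i0 - u (e k)) := by
  obtain ⟨φ, h1, h2, h3⟩ := h
  refine ⟨fun k => - φ (e k), fun k w hw => by simp [h1 _ w hw], fun k => ?_, fun k l hkl => ?_⟩
  · simp [h2, h3 _ _ (h0 k)]
  · simp [h3 _ _ (h0 k), h3 _ _ (he.ne hkl)]

lemma Ind.sub_notMem {ι : Type*} {W : Submodule (ZMod p) (VV p d)} {u : ι → VV p d} (h : Ind W u) {i j : ι}
    (hij : i ≠ j) : u i - u j ∉ W := by
  obtain ⟨φ, h1, h2, h3⟩ := h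
  intro hm
  have := h1 i _ hm
  rw [map_sub, h2, h3 i j hij] at this
  simp at this

lemma dens_star (n : ℕ) (E : VV p d → VV p d → Prop) :
    dens (fun x : VV p d × VV p d => E x.1 x.2) ^ n ≤
      dens (fun x : VV p d × (Fin n → VV p d) => ∀ i, E x.1 (x.2 i)) := by
  rw [dens_prod, dens_prod]
  refine (ave_pow_le (fun x => dens_nonneg _) n).trans_eq ?_
  congr 1; ext a
  exact (dens_pi n (E a)).symm

lemma dens_trans (c : VV p d) (P : VV p d → Prop) : dens (fun a => P (a - c)) = dens P :=
  dens_equiv (Equiv.subRight c) P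

lemma CN (hA : Std p d s A) (g : VV p d → Pol p d) (hgs : ∀ a, (g a).IsHomogeneous s) (r : VV p d)
    (E : VV p d → VV p d → Prop)
    (hE : ∀ a a', E a a' → g a - g a' ∈ JJ A (sp {a - a'}) ∧ g a - g a' ∈ JJ A (sp {r})) :
    ∃ Γ : Polynomial (Pol p d), Γ.natDegree ≤ s ∧ (∀ a, (Γ.eval (lin A a)).IsHomogeneous s) ∧
      (∀ j, 1 ≤ j → Γ.coeff j ∈ JJ A (sp {r})) ∧
      dens (fun x : VV p d × VV p d => E x.1 x.2) ^ (s+2) - ((s:ℝ)+3+(s+2)^2)/p ≤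
      dens (fun x : VV p d × VV p d => E x.1 x.2 ∧ g x.1 - Γ.eval (lin A x.1) ∈ JJ A ⊥ ∧
        g x.2 - Γ.eval (lin A x.2) ∈ JJ A ⊥) := by
  set D := dens (fun x : VV p d × VV p d => E x.1 x.2) ^ (s+2) - ((s:ℝ)+3+(s+2)^2)/p with hD
  rcases le_or_gt D 0 with hD0 | hD0
  · exact ⟨0, by simp, fun a => by simpa using isHomogeneous_zero _ _ _, by simp, hD0.trans (dens_nonneg _)⟩
  have hd := hA.dim
  let Pg : VV p d × (Fin (s+2) → VV p d) → Prop := fun x => (∀ i, E x.1 (x.2 i)) ∧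
    Ind (sp {r}) (Fin.cons x.1 x.2 : Fin (s+3) → VV p d) ∧
    ∀ i j, g (x.2 i) - g (x.2 j) ∈ JJ A (sp {x.2 i - x.2 j})
  have hPg : D ≤ dens Pg := by
    have b1 : dens (fun x : VV p d × (Fin (s+2) → VV p d) => ¬ Ind (sp {r}) (Fin.cons x.1 x.2 : Fin (s+3) → VV p d)) ≤ ((s:ℝ)+3)/p := by
      have := GenInd (sp {r}) (s+3) (by have := frk_sp r; omega)
      rw [← dens_equiv (Fin.consEquiv (fun _ : Fin (s+2+1) => VV p d))] at this
      push_cast at this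
      exact this
    let R : Fin (s+2) × Fin (s+2) → VV p d × (Fin (s+2) → VV p d) → Prop := fun ij x =>
      g (x.2 ij.1) - g (x.2 ij.2) ∉ JJ A (sp {x.2 ij.1 - x.2 ij.2}) ∧
      g (x.2 ij.1) - g (x.2 ij.2) ∈ JJ A (sp {x.2 ij.1 - x.2 ij.2} ⊔ sp {x.1 - x.2 ij.1})
    have b2 : ∀ ij, dens (R ij) ≤ 1 / p := by
      intro ij
      refine dens_fibre_le' fun y => ?_
      by_cases hy : g (y ij.1) - g (y ij.2) ∈ JJ A (sp {y ij.1 - y ij.2})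
      · refine (ave_le (c := 0) fun a => (ind_false (fun h => h.1 hy)).le).trans (by positivity)
      · refine (dens_mono (fun a h => h.2)).trans ?_
        rw [dens_trans (y ij.1) (fun u => g (y ij.1) - g (y ij.2) ∈ JJ A (sp {y ij.1 - y ij.2} ⊔ sp {u}))]
        exact Gen hA ((frk_sp _).trans (by norm_num)) ((hgs _).sub (hgs _)) hy
    have b3 : dens (fun x => ∃ ij, R ij x) ≤ ((s:ℝ)+2)^2/p := by
      refine (dens_exists_le R).trans ((Finset.sum_le_sum fun ij _ => b2 ij).trans_eq ?_)
      simp; ring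
    have b4 := dens_star (s+2) E
    have b5 := dens_diff (fun x : VV p d × (Fin (s+2) → VV p d) => ∀ i, E x.1 (x.2 i))
      (fun x => (¬ Ind (sp {r}) (Fin.cons x.1 x.2 : Fin (s+3) → VV p d)) ∨ ∃ ij, R ij x)
    have b6 := dens_or_le (fun x : VV p d × (Fin (s+2) → VV p d) => ¬ Ind (sp {r}) (Fin.cons x.1 x.2 : Fin (s+3) → VV p d)) (fun x => ∃ ij, R ij x)
    have b7 : dens (fun x : VV p d × (Fin (s+2) → VV p d) => (∀ i, E x.1 (x.2 i)) ∧ ¬ ((¬ Ind (sp {r}) (Fin.cons x.1 x.2 : Fin (s+3) → VV p d)) ∨ ∃ ij, R ij x)) ≤ dens Pg := by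
      refine dens_mono ?_
      rintro ⟨a, y⟩ ⟨h1, h2⟩
      push Not at h2
      refine ⟨h1, h2.1, fun i j => ?_⟩
      by_contra hc
      refine h2.2 (i, j) ⟨hc, ?_⟩
      have e1 := (hE _ _ (h1 i)).1
      have e2 := (hE _ _ (h1 j)).1
      have e3 := sub_mem (JJ_mono A (sp_le (by
          have : a - y j = (y i - y j) + (a - y i) := by abel
          rw [this]
          exact add_mem (Submodule.mem_sup_left (mem_sp _)) (Submodule.mem_sup_right (mem_sp _))) :
          sp {a - y j} ≤ sp {y i - y j} ⊔ sp {a - y i}) e2) (JJ_mono A le_sup_right e1)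
      convert e3 using 1
      simp
    rw [hD, add_div]
    linarith
  let e : (VV p d × VV p d) × (Fin (s+1) → VV p d) ≃ VV p d × (Fin (s+2) → VV p d) :=
    (Equiv.prodAssoc _ _ _).trans (Equiv.prodCongr (Equiv.refl _) (Fin.consEquiv (fun _ : Fin (s+2) => VV p d)))
  rw [← dens_equiv e, dens_prod'] at hPg
  obtain ⟨z, hz⟩ := exists_le_ave (fun z => dens fun x => Pg (e (x, z)))
  replace hz := hPg.trans hz
  obtain ⟨⟨a0, a0'⟩, h1, h2, h3⟩ := dens_pos (hD0.trans_le hz)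
  have he : ∀ a a' z, e ((a, a'), z) = (a, Fin.cons a' z) := fun _ _ _ => rfl
  simp only [he] at h1 h2 h3
  have hcs : ∀ (a a' : VV p d) (i : Fin (s+1)), (Fin.cons a (Fin.cons a' z : Fin (s+2) → VV p d) : Fin (s+3) → VV p d) i.succ.succ = z i := fun a a' i => by simp
  have hzz : Ind (sp {r}) z := by
    have := h2.comp (fun i : Fin (s+1) => i.succ.succ) (fun i j h => by simpa using h)
    exact this
  obtain ⟨Γ0, hΓ1, hΓ2⟩ := newton hA (s+1) z g (fun k i j hij hki hkj => by
      have := (hzz.mono bot_le).diff k (fun l : {l // l ≠ k} => l.1) Subtype.val_injective (fun l => l.2)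
      have := this.notMem ⟨i, hki.symm⟩ (S := {z k - z j}) (by rintro x rfl; exact ⟨⟨j, hkj.symm⟩, by simpa using hij.symm, rfl⟩)
      simpa using this) (fun i j => by simpa using h3 i.succ j.succ)
  have hΓ1' : Γ0.natDegree ≤ s := by simpa using hΓ1
  have hΓ3 : ∀ i, g (z i) - (wproj s Γ0).eval (lin A (z i)) ∈ JJ A ⊥ := by
    intro i
    have := J2 A s (hΓ2 i)
    rwa [map_sub, homogeneousComponent_eq_self (hgs _), ← wproj_eval hΓ1'] at this
  have hΓh : ∀ a, ((wproj s Γ0).eval (lin A a)).IsHomogeneous s := fun a => by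
    rw [wproj_eval hΓ1']; exact homogeneousComponent_isHomogeneous _ _
  have key : ∀ b : VV p d, Ind ⊥ (fun i => b - z i) → (∀ i, g b - g (z i) ∈ JJ A (sp {b - z i})) →
      g b - (wproj s Γ0).eval (lin A b) ∈ JJ A ⊥ := by
    intro b hb hbz
    refine J3 hA (by simp) (by simp) hb ((hgs b).sub (hΓh b)) fun i => ?_
    rw [bot_sup_eq]
    have := sub_mem (add_mem (hbz i) (JJ_mono A bot_le (hΓ3 i))) (eval_sub_mem (A := A) (wproj s Γ0) b (z i))
    convert this using 1; ring
  refine ⟨wproj s Γ0, wproj_deg _, hΓh, ?_, hz.trans (dens_mono ?_)⟩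
  · intro j hj
    have := VL hA (W := sp {r}) ((frk_sp r).trans (by norm_num)) (n := s) (wproj s Γ0 - Polynomial.C (g a0))
      ((Polynomial.natDegree_sub_le _ _).trans (by simpa using wproj_deg Γ0)) z (fun i j hij => hzz.sub_notMem hij) (fun i => by
        rw [Polynomial.eval_sub, Polynomial.eval_C]
        have e1 := (hE _ _ (h1 i.succ)).2
        rw [Fin.cons_succ] at e1
        have e2 := JJ_mono A (bot_le : ⊥ ≤ sp {r}) (hΓ3 i)
        have := neg_mem (add_mem e1 e2)
        convert this using 1; ring) j
    rwa [Polynomial.coeff_sub, Polynomial.coeff_C, if_neg (by omega), sub_zero] at this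
  · rintro ⟨a, a'⟩ ⟨q1, q2, q3⟩
    simp only [he] at q1 q2 q3
    refine ⟨by simpa using q1 0, key a ?_ fun i => ?_, key a' ?_ fun i => ?_⟩
    · have := (q2.mono bot_le).diff 0 (fun i : Fin (s+1) => i.succ.succ) (fun i j h => by simpa using h) (fun k => Fin.succ_ne_zero _)
      exact this
    · simpa using (hE _ _ (q1 i.succ)).1
    · have := (q2.mono bot_le).diff 1 (fun i : Fin (s+1) => i.succ.succ) (fun i j h => by simpa using h) (fun k => by
        intro h; rw [← Fin.succ_zero_eq_one] at h; exact Fin.succ_ne_zero _ (Fin.succ_injective _ h))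
      exact this
    · simpa using q3 0 i.succ

end CNs

section ST1
variable {p d s : ℕ} [Fact p.Prime] {A : Matrix (Fin d) (Fin d) (ZMod p)}

lemma Ind.off {ι κ : Type*} {U : ι → VV p d} (h : Ind ⊥ U) (e : κ → ι) (he : Function.Injective e)
    {W : Submodule (ZMod p) (VV p d)} {b : VV p d} (hW : W ≤ sp (U '' (Set.range e)ᶜ)) (hb : b ∈ sp (U '' (Set.range e)ᶜ)) :
    Ind W (fun k => U (e k) - b) := by
  obtain ⟨φ, h1, h2, h3⟩ := h
  have hk : ∀ k, ∀ w ∈ sp (U '' (Set.range e)ᶜ), φ (e k) w = 0 := by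
    intro k
    have : sp (U '' (Set.range e)ᶜ) ≤ LinearMap.ker (φ (e k)) := by
      refine Submodule.span_le.2 ?_
      rintro _ ⟨i, hi, rfl⟩
      exact h3 _ _ (fun h => hi ⟨k, h⟩)
    exact fun w hw => this hw
  refine ⟨fun k => φ (e k), fun k w hw => hk k w (hW hw), fun k => ?_, fun k l hkl => ?_⟩
  · rw [map_sub, hk k b hb, h2, sub_zero]
  · rw [map_sub, hk k b hb, h3 _ _ (he.ne hkl), sub_zero]

lemma Ind.neg {ι : Type*} {W : Submodule (ZMod p) (VV p d)} {u : ι → VV p d} (h : Ind W u) : Ind W (fun i => - u i) := by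
  obtain ⟨φ, h1, h2, h3⟩ := h
  exact ⟨fun i => - φ i, fun i w hw => by simp [h1 i w hw], fun i => by simp [h2], fun i j hij => by simp [h3 i j hij]⟩

lemma Ind.off' {ι κ : Type*} {U : ι → VV p d} (h : Ind ⊥ U) (e : κ → ι) (he : Function.Injective e)
    {W : Submodule (ZMod p) (VV p d)} {b : VV p d} (hW : W ≤ sp (U '' (Set.range e)ᶜ)) (hb : b ∈ sp (U '' (Set.range e)ᶜ)) :
    Ind W (fun k => b - U (e k)) := by
  have := (h.off e he hW hb).neg
  simpa using this

lemma Ind.opt {κ : Type*} [Fintype κ] {U : Option κ → VV p d} (h : Ind ⊥ U) :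
    Ind ⊥ (fun o : Option κ => o.elim (U none) (fun k => U (some k) - U none)) := by
  classical
  obtain ⟨φ, h1, h2, h3⟩ := h
  refine ⟨fun o => o.elim (∑ k, φ k) (fun k => φ (some k)), ?_, ?_, ?_⟩
  · intro i w hw
    rw [(Submodule.mem_bot _).1 hw, map_zero]
  · have key : ∀ j, ∑ o, φ o (U j) = 1 := fun j => by
      rw [Finset.sum_eq_single j, h2]
      · intro b _ hb; exact h3 _ _ hb
      · simp
    rintro (_ | k)
    · simpa using key none
    · simp [h2, h3 (some k) none (by simp)]
  · have key : ∀ j, ∑ o, φ o (U j) = 1 := fun j => by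
      rw [Finset.sum_eq_single j, h2]
      · intro b _ hb; exact h3 _ _ hb
      · simp
    rintro (_ | k) (_ | l) hkl
    · exact absurd rfl hkl
    · have a1 := key (some l); have a2 := key none
      simp only [Option.elim_none, Option.elim_some, map_sub, LinearMap.sum_apply]
      rw [a1, a2, sub_self]
    · simp [h3 (some k) none (by simp)]
    · simp [h3 (some k) none (by simp), h3 _ _ hkl]

lemma GenInd' {ι : Type*} [Fintype ι] [DecidableEq ι] (W : Submodule (ZMod p) (VV p d)) (h : Module.finrank (ZMod p) W + Fintype.card ι ≤ d) :
    dens (fun v : ι → VV p d => ¬ Ind W v) ≤ (Fintype.card ι : ℝ) / p := by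
  classical
  have e := Fintype.equivFin ι
  rw [← dens_equiv (Equiv.arrowCongr e.symm (Equiv.refl (VV p d)))]
  refine (dens_mono fun v hv => ?_).trans (GenInd W (Fintype.card ι) h)
  intro hI
  apply hv
  have := hI.comp e e.injective
  convert this using 1
  funext i
  simp [Equiv.arrowCongr]

lemma frk_mono_le {W : Submodule (ZMod p) (VV p d)} {u : VV p d} {n m : ℕ} (h : Module.finrank (ZMod p) W ≤ n) (hm : n + 1 ≤ m) :
    Module.finrank (ZMod p) ↥(W ⊔ sp {u}) ≤ m := (frk_sup W u h).trans hm

lemma dens_bad (hA : Std p d s A) (f : Pol p d) (hf : f.IsHomogeneous s) (W : Submodule (ZMod p) (VV p d))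
    (hW : Module.finrank (ZMod p) W ≤ 19) : dens (fun u => f ∉ JJ A W ∧ f ∈ JJ A (W ⊔ sp {u})) ≤ 1 / p := by
  by_cases h : f ∈ JJ A W
  · exact (ave_le (c := 0) fun a => (ind_false (fun h' => h'.1 h)).le).trans (by positivity)
  · exact (dens_mono fun a h' => h'.2).trans (Gen hA hW hf h)

lemma S1k (hA : Std p d s A) (D : VV p d → Pol p d) (hD : ∀ a, (D a).IsHomogeneous s) (k : VV p d)
    (E : VV p d → VV p d → Prop)
    (hE : ∀ c a a', E c a → E c a' → D a - D a' ∈ JJ A (sp {k} ⊔ sp {a} ⊔ sp {a'} ⊔ sp {c})) :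
    ∃ P : Pol p d, P.IsHomogeneous s ∧
      dens (fun x : VV p d × VV p d => E x.1 x.2) ^ (s+2) - ((s:ℝ)+2+(s+2)^2)/p ≤
        dens (fun a => (∃ c, E c a) ∧ D a - P ∈ JJ A (sp {k} ⊔ sp {a})) := by
  set Δ := dens (fun x : VV p d × VV p d => E x.1 x.2) ^ (s+2) - ((s:ℝ)+2+(s+2)^2)/p with hΔ
  rcases le_or_gt Δ 0 with hD0 | hD0
  · exact ⟨0, isHomogeneous_zero _ _ _, hD0.trans (dens_nonneg _)⟩
  have hd := hA.dim
  let Pg : VV p d × (Fin (s+2) → VV p d) → Prop := fun x => (∀ i, E x.1 (x.2 i)) ∧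
    Ind (sp {k}) x.2 ∧ ∀ i j, D (x.2 i) - D (x.2 j) ∈ JJ A (sp {k} ⊔ sp {x.2 i} ⊔ sp {x.2 j})
  have hPg : Δ ≤ dens Pg := by
    have b1 : dens (fun x : VV p d × (Fin (s+2) → VV p d) => ¬ Ind (sp {k}) x.2) ≤ ((s:ℝ)+2)/p := by
      refine dens_fibre_le fun c => ?_
      have := GenInd (sp {k}) (s+2) (by have := frk_sp k; omega)
      push_cast at this
      exact this
    let R : Fin (s+2) × Fin (s+2) → VV p d × (Fin (s+2) → VV p d) → Prop := fun ij x =>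
      D (x.2 ij.1) - D (x.2 ij.2) ∉ JJ A (sp {k} ⊔ sp {x.2 ij.1} ⊔ sp {x.2 ij.2}) ∧
      D (x.2 ij.1) - D (x.2 ij.2) ∈ JJ A (sp {k} ⊔ sp {x.2 ij.1} ⊔ sp {x.2 ij.2} ⊔ sp {x.1})
    have b2 : ∀ ij, dens (R ij) ≤ 1 / p := by
      intro ij
      refine dens_fibre_le' fun y => ?_
      exact dens_bad hA (D (y ij.1) - D (y ij.2)) ((hD _).sub (hD _)) (sp {k} ⊔ sp {y ij.1} ⊔ sp {y ij.2})
        (frk_mono_le (frk_sup (sp {k}) (y ij.1) (frk_sp k)) (by norm_num))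
    have b3 : dens (fun x => ∃ ij, R ij x) ≤ ((s:ℝ)+2)^2/p := by
      refine (dens_exists_le R).trans ((Finset.sum_le_sum fun ij _ => b2 ij).trans_eq ?_)
      simp; ring
    have b4 := dens_star (s+2) E
    have b5 := dens_diff (fun x : VV p d × (Fin (s+2) → VV p d) => ∀ i, E x.1 (x.2 i))
      (fun x => (¬ Ind (sp {k}) x.2) ∨ ∃ ij, R ij x)
    have b6 := dens_or_le (fun x : VV p d × (Fin (s+2) → VV p d) => ¬ Ind (sp {k}) x.2) (fun x => ∃ ij, R ij x)
    have b7 : dens (fun x : VV p d × (Fin (s+2) → VV p d) => (∀ i, E x.1 (x.2 i)) ∧ ¬ ((¬ Ind (sp {k}) x.2) ∨ ∃ ij, R ij x)) ≤ dens Pg := by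
      refine dens_mono ?_
      rintro ⟨a, y⟩ ⟨h1, h2⟩
      push Not at h2
      refine ⟨h1, h2.1, fun i j => ?_⟩
      by_contra hc
      exact h2.2 (i, j) ⟨hc, hE _ _ _ (h1 i) (h1 j)⟩
    rw [hΔ, add_div]
    linarith
  let e : VV p d × (VV p d × (Fin (s+1) → VV p d)) ≃ VV p d × (Fin (s+2) → VV p d) :=
    (Equiv.prodCongr (Equiv.refl _) (Fin.consEquiv (fun _ : Fin (s+2) => VV p d)))
  rw [← dens_equiv e, dens_prod] at hPg
  obtain ⟨c, hc⟩ := exists_le_ave (fun c => dens fun y => Pg (e (c, y)))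
  rw [dens_prod'] at hc
  obtain ⟨z, hz⟩ := exists_le_ave (fun z => dens fun x => Pg (e (c, (x, z))))
  replace hz := (hPg.trans hc).trans hz
  have he : ∀ a z, e (c, (a, z)) = (c, Fin.cons a z) := fun _ _ => rfl
  obtain ⟨a0, h1, h2, h3⟩ := dens_pos (hD0.trans_le hz)
  simp only [he] at h1 h2 h3
  have hzz : Ind (sp {k}) z := h2.comp (fun i : Fin (s+1) => i.succ) (fun i j h => by simpa using h)
  obtain ⟨P, hP1, hP2⟩ := glue hA ((frk_sp k).trans (by norm_num)) hzz (fun i => D (z i)) (fun i => hD _)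
    (fun i j _ => by simpa using h3 i.succ j.succ)
  refine ⟨P, hP1, hz.trans (dens_mono ?_)⟩
  rintro a ⟨q1, q2, q3⟩
  simp only [he] at q1 q2 q3
  refine ⟨⟨c, by simpa using q1 0⟩, ?_⟩
  have hI : Ind (sp {k} ⊔ sp {a}) z := by
    obtain ⟨φ, f1, f2, f3⟩ := q2
    refine ⟨fun i => φ i.succ, fun i w hw => ?_, fun i => by simpa using f2 i.succ, fun i j hij => by
      simpa using f3 i.succ j.succ (by simpa using hij)⟩
    have : sp {k} ⊔ sp {a} ≤ LinearMap.ker (φ i.succ) :=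
      sup_le (fun w hw => f1 _ w hw) (sp_le (by simpa using f3 i.succ 0 (Fin.succ_ne_zero i)))
    exact this hw
  refine J3 hA (frk_mono_le (frk_sp k) (by norm_num)) (by simp) hI ((hD a).sub hP1) fun i => ?_
  have e1 := q3 0 i.succ
  simp only [Fin.cons_zero, Fin.cons_succ] at e1
  have e2 := JJ_mono A (sup_le_sup_right le_sup_left _ : sp {k} ⊔ sp {z i} ≤ sp {k} ⊔ sp {a} ⊔ sp {z i}) (hP2 i)
  have := sub_mem e1 e2
  convert this using 1; ring

lemma step1 (hA : Std p d s A) (ξ₁ ξ₂ ξ₃ ξ₄ : VV p d → Pol p d)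
    (h1 : ∀ a, (ξ₁ a).IsHomogeneous s) (h3 : ∀ a, (ξ₃ a).IsHomogeneous s)
    (UU : VV p d → VV p d → VV p d → Prop)
    (hU : ∀ k c a, UU k c a → ξ₁ a + ξ₂ c - ξ₃ (a + k) - ξ₄ (c - k) ∈ JJ A (sp {k} ⊔ sp {a} ⊔ sp {c}))
    {ε : ℝ} (hε0 : 0 ≤ ε) (hε : ε ≤ dens (fun x : VV p d × (VV p d × VV p d) => UU x.1 x.2.1 x.2.2)) :
    ∃ P : VV p d → Pol p d, (∀ k, (P k).IsHomogeneous s) ∧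
      ε ^ (s+2) - ((s:ℝ)+2+(s+2)^2)/p ≤ dens (fun x : VV p d × VV p d => (∃ c, UU (x.2 - x.1) c x.1) ∧
        ξ₃ x.2 - ξ₁ x.1 - P (x.2 - x.1) ∈ JJ A (sp {x.2 - x.1} ⊔ sp {x.1})) := by
  have H := fun k => S1k hA (fun a => ξ₃ (a + k) - ξ₁ a) (fun a => (h3 _).sub (h1 _)) k (fun c a => UU k c a) (by
    intro c a a' q1 q2
    have e1 := hU k c a q1
    have e2 := hU k c a' q2
    have l1 : sp {k} ⊔ sp {a} ⊔ sp {c} ≤ sp {k} ⊔ sp {a} ⊔ sp {a'} ⊔ sp {c} := sup_le_sup_right le_sup_left _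
    have l2 : sp {k} ⊔ sp {a'} ⊔ sp {c} ≤ sp {k} ⊔ sp {a} ⊔ sp {a'} ⊔ sp {c} :=
      sup_le_sup_right (sup_le_sup_right le_sup_left _) _
    have := sub_mem (JJ_mono A l2 e2) (JJ_mono A l1 e1)
    convert this using 1; ring)
  choose P hP1 hP2 using H
  refine ⟨P, hP1, ?_⟩
  let e : VV p d × VV p d ≃ VV p d × VV p d :=
    { toFun := fun x => (x.2, x.2 + x.1), invFun := fun x => (x.2 - x.1, x.1), left_inv := fun x => by simp, right_inv := fun x => by simp }
  rw [← dens_equiv e, dens_prod]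
  have e0 : ∀ k a, e (k, a) = (a, a + k) := fun _ _ => rfl
  simp only [e0, add_sub_cancel_left]
  refine le_trans ?_ (ave_mono hP2)
  rw [ave_sub, ave_const]
  rw [dens_prod] at hε
  have := (pow_le_pow_left₀ hε0 hε (s+2)).trans (ave_pow_le (fun k => dens_nonneg _) (s+2))
  linarith

end ST1

section ST2
variable {p d s : ℕ} [Fact p.Prime] {A : Matrix (Fin d) (Fin d) (ZMod p)}

lemma mem2 {x u v : VV p d} (a b : ZMod p) (h : x = a • u + b • v) : x ∈ sp {u} ⊔ sp {v} := by
  rw [h]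
  exact add_mem (Submodule.smul_mem _ a (Submodule.mem_sup_left (mem_sp u))) (Submodule.smul_mem _ b (Submodule.mem_sup_right (mem_sp v)))
lemma mem3 {x u v w : VV p d} (a b c : ZMod p) (h : x = a • u + b • v + c • w) : x ∈ sp {u} ⊔ sp {v} ⊔ sp {w} := by
  rw [h]
  exact add_mem (Submodule.mem_sup_left (mem2 a b rfl)) (Submodule.smul_mem _ c (Submodule.mem_sup_right (mem_sp w)))
lemma mem4 {x u v w t : VV p d} (a b c e : ZMod p) (h : x = a • u + b • v + c • w + e • t) : x ∈ sp {u} ⊔ sp {v} ⊔ sp {w} ⊔ sp {t} := by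
  rw [h]
  exact add_mem (Submodule.mem_sup_left (mem3 a b c rfl)) (Submodule.smul_mem _ e (Submodule.mem_sup_right (mem_sp t)))

lemma mv1 {x : VV p d} {W : Submodule (ZMod p) (VV p d)} {f : Pol p d} (h : f ∈ JJ A (sp {x})) (hx : x ∈ W) : f ∈ JJ A W :=
  JJ_mono A (sp_le hx) h
lemma mv2 {x y : VV p d} {W : Submodule (ZMod p) (VV p d)} {f : Pol p d} (h : f ∈ JJ A (sp {x} ⊔ sp {y})) (hx : x ∈ W) (hy : y ∈ W) : f ∈ JJ A W :=
  JJ_mono A (sup_le (sp_le hx) (sp_le hy)) h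
lemma mv3 {x y z : VV p d} {W : Submodule (ZMod p) (VV p d)} {f : Pol p d} (h : f ∈ JJ A (sp {x} ⊔ sp {y} ⊔ sp {z})) (hx : x ∈ W) (hy : y ∈ W) (hz : z ∈ W) : f ∈ JJ A W :=
  JJ_mono A (sup_le (sup_le (sp_le hx) (sp_le hy)) (sp_le hz)) h

lemma frk2 (x y : VV p d) : Module.finrank (ZMod p) ↥(sp {x} ⊔ sp {y}) ≤ 2 := frk_sup _ _ (frk_sp x)

def Zc (P : VV p d → Pol p d) (x x' y y' : VV p d) : Pol p d := P (y - x) - P (y' - x) + P (y' - x') - P (y - x')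

lemma lift_q (hA : Std p d s A) (ξ₁ ξ₃ P : VV p d → Pol p d)
    (h3 : ∀ a, (ξ₃ a).IsHomogeneous s) (hP : ∀ a, (P a).IsHomogeneous s)
    (α β : Fin (s+1) → VV p d)
    (hB : ∀ i j, ξ₃ (β j) - ξ₁ (α i) - P (β j - α i) ∈ JJ A (sp {β j - α i} ⊔ sp {α i}))
    (hZ : ∀ i i' j j', Zc P (α i) (α i') (β j) (β j') ∈ JJ A (sp {β j - α i} ⊔ sp {β j' - α i} ⊔ sp {β j - α i'}))
    (hI : Ind ⊥ (Sum.elim α β)) :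
    ∃ q : Fin (s+1) → Pol p d, (∀ j, (q j).IsHomogeneous s) ∧ (∀ j, q j - ξ₃ (β j) ∈ JJ A (sp {β j})) ∧
      ∀ j j' i, j ≠ j' → q j - q j' - P (β j - α i) + P (β j' - α i) ∈ JJ A (sp {β j - α i} ⊔ sp {β j' - α i}) := by
  classical
  have hb : ∀ j, β j ∈ sp (Sum.elim α β '' (Set.range (Sum.inl : Fin (s+1) → Fin (s+1) ⊕ Fin (s+1)))ᶜ) := fun j =>
    Submodule.subset_span ⟨Sum.inr j, by simp, rfl⟩
  have hoff : ∀ (W : Submodule (ZMod p) (VV p d)) j, W ≤ sp (Sum.elim α β '' (Set.range (Sum.inl : Fin (s+1) → Fin (s+1) ⊕ Fin (s+1)))ᶜ) →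
      Ind W (fun i => β j - α i) := fun W j hW => hI.off' Sum.inl Sum.inl_injective hW (hb j)
  -- π
  have hπ : ∀ j j', ∃ π : Pol p d, π.IsHomogeneous s ∧ ∀ i, π - (P (β j - α i) - P (β j' - α i)) ∈ JJ A (sp {β j - β j'} ⊔ sp {β j - α i}) := by
    intro j j'
    refine glue hA ((frk_sp _).trans (by norm_num)) (hoff _ j (sp_le (sub_mem (hb j) (hb j')))) _ (fun i => (hP _).sub (hP _)) fun i i' _ => ?_
    have := mv3 (hZ i i' j j') (W := sp {β j - β j'} ⊔ sp {β j - α i} ⊔ sp {β j - α i'}) (mem3 0 1 0 (by module)) (mem3 (-1) 1 0 (by module)) (mem3 0 0 1 (by module))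
    convert this using 1; unfold Zc; ring
  choose π hπ1 hπ2 using hπ
  suffices H : ∀ t : Finset (Fin (s+1)), ∃ q : Fin (s+1) → Pol p d, (∀ j, (q j).IsHomogeneous s) ∧ (∀ j ∈ t, q j - ξ₃ (β j) ∈ JJ A (sp {β j})) ∧
      ∀ j ∈ t, ∀ j' ∈ t, j ≠ j' → ∀ i, q j - q j' - P (β j - α i) + P (β j' - α i) ∈ JJ A (sp {β j - α i} ⊔ sp {β j' - α i}) by
    obtain ⟨q, q1, q2, q3⟩ := H Finset.univ
    exact ⟨q, q1, fun j => q2 j (Finset.mem_univ _), fun j j' i h => q3 j (Finset.mem_univ _) j' (Finset.mem_univ _) h i⟩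
  intro t
  induction t using Finset.induction_on with
  | empty => exact ⟨fun _ => 0, fun _ => isHomogeneous_zero _ _ _, by simp, by simp⟩
  | insert j0 t hj0 ih =>
    obtain ⟨q, q1, q2, q3⟩ := ih
    have hne : ∀ j : {j // j ∈ t}, j.1 ≠ j0 := fun j h => hj0 (h ▸ j.2)
    have hIo : Ind ⊥ (fun o : Option {j // j ∈ t} => o.elim (β j0) (fun k => β k.1)) := by
      have := hI.comp (fun o : Option {j // j ∈ t} => o.elim (Sum.inr j0) (fun k => Sum.inr k.1)) (by
        rintro (_ | k) (_ | l) h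
        · rfl
        · exact absurd (Sum.inr_injective h).symm (hne l)
        · exact absurd (Sum.inr_injective h) (hne k)
        · exact congrArg some (Subtype.ext (Sum.inr_injective h)))
      convert this using 1
      funext o; cases o <;> rfl
    -- compat
    have c1 : ∀ j' : {j // j ∈ t}, ξ₃ (β j0) - (q j' + π j0 j') ∈ JJ A (sp {β j0} ⊔ sp {β j' - β j0}) := by
      intro j'
      refine J3 hA ((frk2 _ _).trans (by norm_num)) (ι := Fin (s+1)) (by simp) (hoff _ j0 (sup_le (sp_le (hb j0)) (sp_le (sub_mem (hb _) (hb _)))))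
        ((h3 _).sub ((q1 _).add (hπ1 _ _))) fun i => ?_
      have e1 := mv2 (hB i j0) (W := sp {β j0} ⊔ sp {β j' - β j0} ⊔ sp {β j0 - α i}) (mem3 0 0 1 (by module)) (mem3 1 0 (-1) (by module))
      have e2 := mv2 (hB i j') (W := sp {β j0} ⊔ sp {β j' - β j0} ⊔ sp {β j0 - α i}) (mem3 0 1 1 (by module)) (mem3 1 0 (-1) (by module))
      have e3 := mv1 (q2 j' j'.2) (W := sp {β j0} ⊔ sp {β j' - β j0} ⊔ sp {β j0 - α i}) (mem3 1 1 0 (by module))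
      have e4 := mv2 (hπ2 j0 j' i) (W := sp {β j0} ⊔ sp {β j' - β j0} ⊔ sp {β j0 - α i}) (mem3 0 (-1) 0 (by module)) (mem3 0 0 1 (by module))
      have := sub_mem (sub_mem (sub_mem e1 e2) e3) e4
      convert this using 1; ring
    have c2 : ∀ j' j'' : {j // j ∈ t}, j' ≠ j'' → (q j' + π j0 j') - (q j'' + π j0 j'') ∈ JJ A (sp {β j' - β j0} ⊔ sp {β j'' - β j0}) := by
      intro j' j'' hj
      refine J3 hA ((frk2 _ _).trans (by norm_num)) (ι := Fin (s+1)) (by simp) (hoff _ j0 (sup_le (sp_le (sub_mem (hb _) (hb _))) (sp_le (sub_mem (hb _) (hb _)))))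
        (((q1 _).add (hπ1 _ _)).sub ((q1 _).add (hπ1 _ _))) fun i => ?_
      have e1 := mv2 (q3 j' j'.2 j'' j''.2 (fun h => hj (Subtype.ext h)) i) (W := sp {β j' - β j0} ⊔ sp {β j'' - β j0} ⊔ sp {β j0 - α i}) (mem3 1 0 1 (by module)) (mem3 0 1 1 (by module))
      have e2 := mv2 (hπ2 j0 j' i) (W := sp {β j' - β j0} ⊔ sp {β j'' - β j0} ⊔ sp {β j0 - α i}) (mem3 (-1) 0 0 (by module)) (mem3 0 0 1 (by module))
      have e3 := mv2 (hπ2 j0 j'' i) (W := sp {β j' - β j0} ⊔ sp {β j'' - β j0} ⊔ sp {β j0 - α i}) (mem3 0 (-1) 0 (by module)) (mem3 0 0 1 (by module))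
      have := sub_mem (add_mem e1 e2) e3
      convert this using 1; ring
    obtain ⟨F, hF1, hF2⟩ := glue hA (W := ⊥) (by simp) hIo.opt
      (fun o => o.elim (ξ₃ (β j0)) (fun k => q k.1 + π j0 k.1)) (by
        rintro (_ | k)
        · exact h3 _
        · exact (q1 _).add (hπ1 _ _)) (by
        rintro (_ | k) (_ | l) h
        · exact absurd rfl h
        · simpa only [bot_sup_eq, Option.elim_none, Option.elim_some] using c1 l
        · have := neg_mem (c1 k)
          simp only [bot_sup_eq, Option.elim_none, Option.elim_some]
          rw [sup_comm]
          convert this using 1; ring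
        · simpa only [bot_sup_eq, Option.elim_none, Option.elim_some] using c2 k l (fun h' => h (congrArg some h')))
    have hn := hF2 none
    simp only [bot_sup_eq, Option.elim_some, Option.elim_none] at hn
    have key : ∀ j' ∈ t, ∀ i, F - q j' - P (β j0 - α i) + P (β j' - α i) ∈ JJ A (sp {β j0 - α i} ⊔ sp {β j' - α i}) := by
      intro j' hj' i
      have e1 := hF2 (some ⟨j', hj'⟩)
      simp only [bot_sup_eq, Option.elim_some, Option.elim_none] at e1
      have e2 := mv1 e1 (W := sp {β j0 - α i} ⊔ sp {β j' - α i}) (mem2 (-1) 1 (by module))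
      have e3 := mv2 (hπ2 j0 j' i) (W := sp {β j0 - α i} ⊔ sp {β j' - α i}) (mem2 1 (-1) (by module)) (mem2 1 0 (by module))
      have := add_mem e2 e3
      convert this using 1; ring
    refine ⟨Function.update q j0 F, ?_, ?_, ?_⟩
    · intro j
      by_cases h : j = j0
      · subst h; simpa using hF1
      · simpa [h] using q1 j
    · intro j hj
      by_cases h : j = j0
      · subst h; simpa using hn
      · simpa [h] using q2 j ((Finset.mem_insert.1 hj).resolve_left h)
    · intro j hj j' hj' hjj i
      by_cases h : j = j0
      · subst h
        have hh : j' ≠ j := hjj.symm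
        simpa [hh] using key j' ((Finset.mem_insert.1 hj').resolve_left hh) i
      · by_cases h' : j' = j0
        · subst h'
          have := neg_mem (key j ((Finset.mem_insert.1 hj).resolve_left h) i)
          rw [sup_comm] at this
          simp only [Function.update_self, Function.update_of_ne h]
          convert this using 1; ring
        · simpa [h, h'] using q3 j ((Finset.mem_insert.1 hj).resolve_left h) j' ((Finset.mem_insert.1 hj').resolve_left h') hjj i

lemma lift_X (hA : Std p d s A) (ξ₁ ξ₃ P : VV p d → Pol p d)
    (h1 : ∀ a, (ξ₁ a).IsHomogeneous s) (hP : ∀ a, (P a).IsHomogeneous s)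
    (α β : Fin (s+1) → VV p d) (q : Fin (s+1) → Pol p d) (q1 : ∀ j, (q j).IsHomogeneous s) (q2 : ∀ j, q j - ξ₃ (β j) ∈ JJ A (sp {β j}))
    (q3 : ∀ j j' i, j ≠ j' → q j - q j' - P (β j - α i) + P (β j' - α i) ∈ JJ A (sp {β j - α i} ⊔ sp {β j' - α i}))
    (a : VV p d)
    (hB : ∀ j, ξ₃ (β j) - ξ₁ a - P (β j - a) ∈ JJ A (sp {β j - a} ⊔ sp {a}))
    (hZ : ∀ i j j', Zc P (α i) a (β j) (β j') ∈ JJ A (sp {β j - α i} ⊔ sp {β j' - α i} ⊔ sp {β j - a}))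
    (hI : Ind ⊥ (Sum.elim (Fin.cons a α : Fin (s+2) → VV p d) β)) :
    ∃ X : Pol p d, X.IsHomogeneous s ∧ X - ξ₁ a ∈ JJ A (sp {a}) ∧ ∀ j, X - q j + P (β j - a) ∈ JJ A (sp {β j - a}) := by
  set U : Fin (s+2) ⊕ Fin (s+1) → VV p d := Sum.elim (Fin.cons a α : Fin (s+2) → VV p d) β with hU
  have hIo : Ind ⊥ (fun o : Option (Fin (s+1)) => o.elim a β) := by
    have := hI.comp (fun o : Option (Fin (s+1)) => o.elim (Sum.inl 0) Sum.inr) (by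
      rintro (_ | k) (_ | l) h
      · rfl
      · simp at h
      · simp at h
      · exact congrArg some (Sum.inr_injective h))
    convert this using 1
    funext o; cases o <;> simp [hU]
  let e : Fin (s+1) → Fin (s+2) ⊕ Fin (s+1) := fun i => Sum.inl i.succ
  have he : Function.Injective e := fun i j h => by simpa [e] using h
  have hb : ∀ j, β j ∈ sp (U '' (Set.range e)ᶜ) := fun j => Submodule.subset_span ⟨Sum.inr j, by simp [e], rfl⟩
  have ha : a ∈ sp (U '' (Set.range e)ᶜ) := Submodule.subset_span ⟨Sum.inl 0, by simp [e, Fin.succ_ne_zero], by simp [hU]⟩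
  have c1 : ∀ j, ξ₁ a - (q j - P (β j - a)) ∈ JJ A (sp {a} ⊔ sp {β j - a}) := by
    intro j
    have e1 := mv2 (hB j) (W := sp {a} ⊔ sp {β j - a}) (mem2 0 1 (by module)) (mem2 1 0 (by module))
    have e2 := mv1 (q2 j) (W := sp {a} ⊔ sp {β j - a}) (mem2 1 1 (by module))
    have := neg_mem (add_mem e1 e2)
    convert this using 1; ring
  have c2 : ∀ j j', j ≠ j' → (q j - P (β j - a)) - (q j' - P (β j' - a)) ∈ JJ A (sp {β j - a} ⊔ sp {β j' - a}) := by
    intro j j' hj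
    have hoff := hI.off' e he (W := sp {β j - a} ⊔ sp {β j' - a}) (sup_le (sp_le (sub_mem (hb _) ha)) (sp_le (sub_mem (hb _) ha))) (hb j)
    refine J3 hA ((frk2 _ _).trans (by norm_num)) (ι := Fin (s+1)) (by simp) hoff (((q1 _).sub (hP _)).sub ((q1 _).sub (hP _))) fun i => ?_
    have hUe : U (e i) = α i := by simp [hU, e]
    rw [hUe]
    have e1 := mv2 (q3 j j' i hj) (W := sp {β j - a} ⊔ sp {β j' - a} ⊔ sp {β j - α i}) (mem3 0 0 1 (by module)) (mem3 (-1) 1 1 (by module))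
    have e2 := mv3 (hZ i j j') (W := sp {β j - a} ⊔ sp {β j' - a} ⊔ sp {β j - α i}) (mem3 0 0 1 (by module)) (mem3 (-1) 1 1 (by module)) (mem3 1 0 0 (by module))
    have := add_mem e1 e2
    convert this using 1; unfold Zc; ring
  obtain ⟨F, hF1, hF2⟩ := glue hA (W := ⊥) (by simp) hIo.opt
    (fun o => o.elim (ξ₁ a) (fun j => q j - P (β j - a))) (by
      rintro (_ | k)
      · exact h1 _
      · exact (q1 _).sub (hP _)) (by
      rintro (_ | k) (_ | l) h
      · exact absurd rfl h
      · simpa only [bot_sup_eq, Option.elim_none, Option.elim_some] using c1 l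
      · have := neg_mem (c1 k)
        simp only [bot_sup_eq, Option.elim_none, Option.elim_some]
        rw [sup_comm]
        convert this using 1; ring
      · simpa only [bot_sup_eq, Option.elim_none, Option.elim_some] using c2 k l (fun h' => h (congrArg some h')))
  refine ⟨F, hF1, by simpa only [bot_sup_eq, Option.elim_none, Option.elim_some] using hF2 none, fun j => ?_⟩
  have := hF2 (some j)
  simp only [bot_sup_eq, Option.elim_some, Option.elim_none] at this
  convert this using 1; ring

lemma lift_pair (hA : Std p d s A) (P : VV p d → Pol p d) (hP : ∀ a, (P a).IsHomogeneous s)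
    (β : Fin (s+1) → VV p d) (q : Fin (s+1) → Pol p d) (a a' u : VV p d) (X X' : Pol p d) (hX : X.IsHomogeneous s) (hX' : X'.IsHomogeneous s)
    (h : ∀ j, X - q j + P (β j - a) ∈ JJ A (sp {β j - a})) (h' : ∀ j, X' - q j + P (β j - a') ∈ JJ A (sp {β j - a'}))
    (hZ : ∀ j, Zc P a a' u (β j) ∈ JJ A (sp {u - a} ⊔ sp {β j - a} ⊔ sp {u - a'}))
    (hI : Ind ⊥ (Sum.elim (![a, a', u] : Fin 3 → VV p d) β)) :
    X - X' + P (u - a) - P (u - a') ∈ JJ A (sp {u - a} ⊔ sp {u - a'}) := by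
  set U : Fin 3 ⊕ Fin (s+1) → VV p d := Sum.elim (![a, a', u] : Fin 3 → VV p d) β with hU
  have hm : ∀ k : Fin 3, U (Sum.inl k) ∈ sp (U '' (Set.range Sum.inr)ᶜ) := fun k => Submodule.subset_span ⟨Sum.inl k, by simp, rfl⟩
  have ha : a ∈ sp (U '' (Set.range Sum.inr)ᶜ) := hm 0
  have ha' : a' ∈ sp (U '' (Set.range Sum.inr)ᶜ) := hm 1
  have hu : u ∈ sp (U '' (Set.range Sum.inr)ᶜ) := hm 2
  have hoff := hI.off Sum.inr Sum.inr_injective (W := sp {u - a} ⊔ sp {u - a'}) (sup_le (sp_le (sub_mem hu ha)) (sp_le (sub_mem hu ha'))) ha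
  refine J3 hA ((frk2 _ _).trans (by norm_num)) (ι := Fin (s+1)) (by simp) hoff (((hX.sub hX').add (hP _)).sub (hP _)) fun j => ?_
  have hUe : U (Sum.inr j) = β j := by simp [hU]
  rw [hUe]
  have e1 := mv1 (h j) (W := sp {u - a} ⊔ sp {u - a'} ⊔ sp {β j - a}) (mem3 0 0 1 (by module))
  have e2 := mv1 (h' j) (W := sp {u - a} ⊔ sp {u - a'} ⊔ sp {β j - a}) (mem3 (-1) 1 1 (by module))
  have e3 := mv3 (hZ j) (W := sp {u - a} ⊔ sp {u - a'} ⊔ sp {β j - a}) (mem3 1 0 0 (by module)) (mem3 0 0 1 (by module)) (mem3 0 1 0 (by module))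
  have := add_mem (sub_mem e1 e2) e3
  convert this using 1; unfold Zc; ring
end ST2

section ST2
set_option synthInstance.maxHeartbeats 400000
set_option synthInstance.maxSize 1000
variable {p d s : ℕ} [Fact p.Prime] {A : Matrix (Fin d) (Fin d) (ZMod p)}

lemma dens_shift {τ β : Type*} [Fintype τ] [Nonempty τ] [Fintype β] [Nonempty β] (S : τ → β ≃ β) (P : β → Prop) {c : ℝ}
    (h : ∀ b, dens (fun t => P (S t b)) ≤ c) : dens P ≤ c := by
  have e : dens (fun x : τ × β => P (S x.1 x.2)) = dens P := by
    rw [dens_prod]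
    simp only [dens_equiv]
    exact ave_const _
  rw [← e]
  exact dens_fibre_le' h

def Bad (A : Matrix (Fin d) (Fin d) (ZMod p)) (P : VV p d → Pol p d) (x x' y y' : VV p d) : Prop :=
  Zc P x x' y y' ∉ JJ A (sp {y - x} ⊔ sp {y' - x} ⊔ sp {y - x'}) ∧
  Zc P x x' y y' ∈ JJ A (sp {y - x} ⊔ sp {y' - x} ⊔ sp {y - x'} ⊔ sp {x})

lemma Bad_shift (hA : Std p d s A) (P : VV p d → Pol p d) (hP : ∀ a, (P a).IsHomogeneous s) (x x' y y' : VV p d) :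
    dens (fun t => Bad A P (x + t) (x' + t) (y + t) (y' + t)) ≤ 1 / p := by
  simp only [Bad, Zc, add_sub_add_right_eq_sub]
  have := dens_bad hA (P (y - x) - P (y' - x) + P (y' - x') - P (y - x')) ((((hP _).sub (hP _)).add (hP _)).sub (hP _))
    (sp {y - x} ⊔ sp {y' - x} ⊔ sp {y - x'}) ((frk_sup _ _ (frk2 _ _)).trans (by norm_num))
  rw [← dens_equiv (Equiv.addLeft x)] at this
  exact this

lemma notBad {P : VV p d → Pol p d} {ξ₁ ξ₃ : VV p d → Pol p d} {G : VV p d → VV p d → Prop}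
    (hG : ∀ a b, G a b → ξ₃ b - ξ₁ a - P (b - a) ∈ JJ A (sp {b - a} ⊔ sp {a})) {x x' y y' : VV p d}
    (h1 : G x y) (h2 : G x y') (h3 : G x' y) (h4 : G x' y') (hb : ¬ Bad A P x x' y y') :
    Zc P x x' y y' ∈ JJ A (sp {y - x} ⊔ sp {y' - x} ⊔ sp {y - x'}) := by
  by_contra hc
  refine hb ⟨hc, ?_⟩
  have e1 := mv2 (hG _ _ h1) (W := sp {y - x} ⊔ sp {y' - x} ⊔ sp {y - x'} ⊔ sp {x}) (mem4 1 0 0 0 (by module)) (mem4 0 0 0 1 (by module))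
  have e2 := mv2 (hG _ _ h2) (W := sp {y - x} ⊔ sp {y' - x} ⊔ sp {y - x'} ⊔ sp {x}) (mem4 0 1 0 0 (by module)) (mem4 0 0 0 1 (by module))
  have e3 := mv2 (hG _ _ h3) (W := sp {y - x} ⊔ sp {y' - x} ⊔ sp {y - x'} ⊔ sp {x}) (mem4 0 0 1 0 (by module)) (mem4 1 0 (-1) 1 (by module))
  have e4 := mv2 (hG _ _ h4) (W := sp {y - x} ⊔ sp {y' - x} ⊔ sp {y - x'} ⊔ sp {x}) (mem4 (-1) 1 1 0 (by module)) (mem4 1 0 (-1) 1 (by module))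
  have := sub_mem (sub_mem (add_mem e2 e3) e1) e4
  convert this using 1; unfold Zc; ring

lemma dens_star' {α β : Type*} [Fintype α] [Fintype β] [Nonempty α] (n : ℕ) (E : α → β → Prop) :
    dens (fun x : α × β => E x.1 x.2) ^ n ≤ dens (fun x : α × (Fin n → β) => ∀ i, E x.1 (x.2 i)) := by
  rw [dens_prod, dens_prod]
  refine (ave_pow_le (fun x => dens_nonneg _) n).trans_eq ?_
  congr 1; ext a
  rw [← dens_pi]

def FullT (A : Matrix (Fin d) (Fin d) (ZMod p)) (P : VV p d → Pol p d) (G : VV p d → VV p d → Prop) {n : ℕ} (x y : Fin n → VV p d) : Prop :=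
  (∀ i j, G (x i) (y j)) ∧ (∀ k : (Fin n × Fin n) × (Fin n × Fin n), ¬ Bad A P (x k.1.1) (x k.1.2) (y k.2.1) (y k.2.2)) ∧ Ind ⊥ (Sum.elim x y)

lemma FullT_dens (hA : Std p d s A) (P : VV p d → Pol p d) (hP : ∀ a, (P a).IsHomogeneous s) (G : VV p d → VV p d → Prop)
    {n : ℕ} (hn : n + n ≤ d) :
    dens (fun x : VV p d × VV p d => G x.1 x.2) ^ (n * n) - ((n:ℝ)^4 + 2 * n) / p ≤
      dens (fun z : (Fin n → VV p d) × (Fin n → VV p d) => FullT A P G z.1 z.2) := by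
  have b1 : dens (fun z : (Fin n → VV p d) × (Fin n → VV p d) => ¬ Ind ⊥ (Sum.elim z.1 z.2)) ≤ (2 * n) / p := by
    have := GenInd' (p := p) (d := d) (ι := Fin n ⊕ Fin n) ⊥ (by simpa using hn)
    rw [← dens_equiv (Equiv.sumArrowEquivProdArrow (Fin n) (Fin n) (VV p d)).symm] at this
    refine le_trans (le_of_eq ?_) (this.trans_eq ?_)
    · rfl
    · simp; ring
  let R : (Fin n × Fin n) × (Fin n × Fin n) → (Fin n → VV p d) × (Fin n → VV p d) → Prop := fun k z =>
    Bad A P (z.1 k.1.1) (z.1 k.1.2) (z.2 k.2.1) (z.2 k.2.2)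
  have b2 : ∀ k, dens (R k) ≤ 1 / p := by
    intro k
    refine dens_shift (τ := VV p d) (fun t => Equiv.addRight ((fun _ => t, fun _ => t) : (Fin n → VV p d) × (Fin n → VV p d))) (R k) ?_
    intro b
    exact Bad_shift hA P hP (b.1 k.1.1) (b.1 k.1.2) (b.2 k.2.1) (b.2 k.2.2)
  have b3 : dens (fun x => ∃ ij, R ij x) ≤ (n:ℝ)^4/p := by
    refine (dens_exists_le R).trans ((Finset.sum_le_sum fun ij _ => b2 ij).trans_eq ?_)
    simp; ring
  have b4 := dens_star' n G
  have b4' : dens (fun x : (Fin n → VV p d) × VV p d => ∀ i, G x.2 (x.1 i)) = dens (fun x : VV p d × (Fin n → VV p d) => ∀ i, G x.1 (x.2 i)) :=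
    dens_equiv (Equiv.prodComm _ _) (fun x : VV p d × (Fin n → VV p d) => ∀ i, G x.1 (x.2 i))
  have b5 := dens_star' n (fun (y : Fin n → VV p d) (a : VV p d) => ∀ j, G a (y j))
  rw [b4'] at b5
  have b6 := pow_le_pow_left₀ (pow_nonneg (dens_nonneg _) n) b4 n
  rw [← pow_mul] at b6
  replace b6 := b6.trans b5
  have b7 : dens (fun x : (Fin n → VV p d) × (Fin n → VV p d) => ∀ i j, G (x.2 i) (x.1 j)) = dens (fun x : (Fin n → VV p d) × (Fin n → VV p d) => ∀ i j, G (x.1 i) (x.2 j)) :=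
    dens_equiv (Equiv.prodComm _ _) (fun x : (Fin n → VV p d) × (Fin n → VV p d) => ∀ i j, G (x.1 i) (x.2 j))
  rw [b7] at b6
  have b8 := dens_diff (fun x : (Fin n → VV p d) × (Fin n → VV p d) => ∀ i j, G (x.1 i) (x.2 j))
      (fun x => (¬ Ind ⊥ (Sum.elim x.1 x.2)) ∨ ∃ ij, R ij x)
  have b9 := dens_or_le (fun x : (Fin n → VV p d) × (Fin n → VV p d) => ¬ Ind ⊥ (Sum.elim x.1 x.2)) (fun x => ∃ ij, R ij x)
  have b10 : dens (fun x : (Fin n → VV p d) × (Fin n → VV p d) => (∀ i j, G (x.1 i) (x.2 j)) ∧ ¬ ((¬ Ind ⊥ (Sum.elim x.1 x.2)) ∨ ∃ ij, R ij x)) ≤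
      dens (fun z : (Fin n → VV p d) × (Fin n → VV p d) => FullT A P G z.1 z.2) := by
    refine dens_mono ?_
    rintro z ⟨g1, g2⟩
    push Not at g2
    exact ⟨g1, g2.2, g2.1⟩
  rw [add_div]
  linarith

def TT (A : Matrix (Fin d) (Fin d) (ZMod p)) (P : VV p d → Pol p d) {n : ℕ} (β : Fin n → VV p d) (a a' u : VV p d) : Prop :=
  (∃ j, Bad A P a a' u (β j)) ∨ ¬ Ind ⊥ (Sum.elim (![a, a', u] : Fin 3 → VV p d) β)

lemma TT_dens (hA : Std p d s A) (P : VV p d → Pol p d) (hP : ∀ a, (P a).IsHomogeneous s) {n : ℕ} (hn : 3 + n ≤ d) :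
    dens (fun z : ((Fin n → VV p d) × (Fin n → VV p d)) × (VV p d × (VV p d × VV p d)) => TT A P z.1.2 z.2.1 z.2.2.1 z.2.2.2) ≤ (2 * n + 3) / p := by
  refine (dens_or_le _ _).trans ?_
  have b1 : dens (fun z : ((Fin n → VV p d) × (Fin n → VV p d)) × (VV p d × (VV p d × VV p d)) => ∃ j, Bad A P z.2.1 z.2.2.1 z.2.2.2 (z.1.2 j)) ≤ n / p := by
    refine (dens_exists_le _).trans ((Finset.sum_le_sum fun j _ => ?_).trans_eq (?_ : ∑ j : Fin n, (1 / p : ℝ) = _))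
    · refine dens_shift (τ := VV p d) (fun t => Equiv.addRight (((0, fun _ => t), (t, (t, t))) : ((Fin n → VV p d) × (Fin n → VV p d)) × (VV p d × (VV p d × VV p d)))) _ ?_
      intro b
      exact Bad_shift hA P hP b.2.1 b.2.2.1 b.2.2.2 (b.1.2 j)
    · simp; ring
  have b2 : dens (fun z : ((Fin n → VV p d) × (Fin n → VV p d)) × (VV p d × (VV p d × VV p d)) => ¬ Ind ⊥ (Sum.elim (![z.2.1, z.2.2.1, z.2.2.2] : Fin 3 → VV p d) z.1.2)) ≤ (3 + n) / p := by
    let e : (Fin n → VV p d) × (Fin 3 ⊕ Fin n → VV p d) ≃ ((Fin n → VV p d) × (Fin n → VV p d)) × (VV p d × (VV p d × VV p d)) :=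
      { toFun := fun z => ((z.1, fun j => z.2 (Sum.inr j)), (z.2 (Sum.inl 0), (z.2 (Sum.inl 1), z.2 (Sum.inl 2))))
        invFun := fun z => (z.1.1, Sum.elim ![z.2.1, z.2.2.1, z.2.2.2] z.1.2)
        left_inv := by
          rintro ⟨x, w⟩
          refine Prod.ext rfl ?_
          funext k
          rcases k with k | k
          · fin_cases k <;> rfl
          · rfl
        right_inv := by rintro ⟨⟨x, y⟩, a, b, c⟩; rfl }
    rw [← dens_equiv e]
    refine dens_fibre_le fun x => ?_
    have := GenInd' (p := p) (d := d) (ι := Fin 3 ⊕ Fin n) ⊥ (by simpa using hn)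
    refine (dens_mono ?_).trans (this.trans_eq (by simp))
    intro w hw hI
    apply hw
    convert hI using 1
    funext k
    rcases k with k | k
    · fin_cases k <;> rfl
    · rfl
  have : ((2:ℝ) * n + 3) / p = n / p + (3 + n) / p := by ring
  rw [this]
  exact add_le_add b1 b2

lemma step2 (hA : Std p d s A) (ξ₁ ξ₃ P : VV p d → Pol p d)
    (h1 : ∀ a, (ξ₁ a).IsHomogeneous s) (h3 : ∀ a, (ξ₃ a).IsHomogeneous s) (hP : ∀ a, (P a).IsHomogeneous s)
    (G : VV p d → VV p d → Prop) (hG : ∀ a b, G a b → ξ₃ b - ξ₁ a - P (b - a) ∈ JJ A (sp {b - a} ⊔ sp {a}))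
    {ε : ℝ} (hε0 : 0 ≤ ε) (hε : ε ≤ dens (fun x : VV p d × VV p d => G x.1 x.2)) (L : ℝ) (hL : 0 ≤ L) :
    ∃ X : VV p d → Pol p d, (∀ a, (X a).IsHomogeneous s) ∧ ∃ (G' : VV p d → VV p d → Prop) (T : VV p d → VV p d → VV p d → Prop),
      (∀ a u, G' a u → G a u ∧ X a - ξ₁ a ∈ JJ A (sp {a})) ∧
      (∀ a a' u, G' a u → G' a' u → ¬ T a a' u → X a - X a' + P (u - a) - P (u - a') ∈ JJ A (sp {u - a} ⊔ sp {u - a'})) ∧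
      ε ^ ((s+2)*(s+2)) - (((s:ℝ)+2)^4 + 2 * (s+2)) / p - L * ((2 * (s+1) + 3) / p) ≤
        dens (fun x : VV p d × VV p d => G' x.1 x.2) - L * dens (fun x : VV p d × (VV p d × VV p d) => T x.1 x.2.1 x.2.2) := by
  have hd := hA.dim
  set Δ := ε ^ ((s+2)*(s+2)) - (((s:ℝ)+2)^4 + 2 * (s+2)) / p - L * ((2 * (s+1) + 3) / p) with hΔ
  rcases le_or_gt Δ 0 with hD0 | hD0
  · refine ⟨fun _ => 0, fun _ => isHomogeneous_zero _ _ _, fun _ _ => False, fun _ _ _ => False, by simp, by simp, ?_⟩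
    simpa [dens, ave, ind] using hD0
  let e : ((Fin (s+1) → VV p d) × (Fin (s+1) → VV p d)) × (VV p d × VV p d) ≃ (Fin (s+2) → VV p d) × (Fin (s+2) → VV p d) :=
    { toFun := fun z => (Fin.cons z.2.1 z.1.1, Fin.cons z.2.2 z.1.2)
      invFun := fun z => ((Fin.tail z.1, Fin.tail z.2), (z.1 0, z.2 0))
      left_inv := by rintro ⟨⟨x, y⟩, a, b⟩; simp
      right_inv := by rintro ⟨x, y⟩; simp }
  have f1 := FullT_dens hA P hP G (n := s+2) (by omega)
  have f2 := TT_dens hA P hP (n := s+1) (by omega)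
  have f1' : dens (fun z : (Fin (s+2) → VV p d) × (Fin (s+2) → VV p d) => FullT A P G z.1 z.2) =
      ave fun b : (Fin (s+1) → VV p d) × (Fin (s+1) → VV p d) => dens (fun y : VV p d × VV p d =>
        FullT A P G (Fin.cons y.1 b.1 : Fin (s+2) → VV p d) (Fin.cons y.2 b.2 : Fin (s+2) → VV p d)) := by
    rw [← dens_equiv e, dens_prod]; rfl
  rw [f1'] at f1
  rw [dens_prod] at f2
  obtain ⟨⟨α, β⟩, hb⟩ := exists_le_ave (fun b : (Fin (s+1) → VV p d) × (Fin (s+1) → VV p d) =>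
    dens (fun y : VV p d × VV p d => FullT A P G (Fin.cons y.1 b.1 : Fin (s+2) → VV p d) (Fin.cons y.2 b.2 : Fin (s+2) → VV p d)) -
      L * dens (fun y : VV p d × (VV p d × VV p d) => TT A P b.2 y.1 y.2.1 y.2.2))
  rw [ave_sub, ave_mul_left] at hb
  have f3 := pow_le_pow_left₀ hε0 hε ((s+2)*(s+2))
  have f4 := mul_le_mul_of_nonneg_left f2 hL
  push_cast at f1 f4
  have hb' : Δ ≤ _ := le_trans (by rw [hΔ]; linarith) hb
  clear hb f1 f2 f3 f4
  simp only at hb'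
  let G' : VV p d → VV p d → Prop := fun a u => FullT A P G (Fin.cons a α : Fin (s+2) → VV p d) (Fin.cons u β : Fin (s+2) → VV p d)
  obtain ⟨⟨a0, u0⟩, h0⟩ : ∃ x : VV p d × VV p d, G' x.1 x.2 := by
    apply dens_pos
    have := mul_nonneg hL (dens_nonneg (fun y : VV p d × (VV p d × VV p d) => TT A P β y.1 y.2.1 y.2.2))
    have := hb'.trans (sub_le_self _ this)
    exact hD0.trans_le this
  have hIab : Ind ⊥ (Sum.elim α β) := by
    have := h0.2.2.comp (Sum.map Fin.succ Fin.succ) (Sum.map_injective.2 ⟨Fin.succ_injective _, Fin.succ_injective _⟩)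
    convert this using 1
    funext k; rcases k with k | k <;> simp
  have hGab : ∀ i j, G (α i) (β j) := fun i j => by simpa using h0.1 i.succ j.succ
  obtain ⟨q, q1, q2, q3⟩ := lift_q hA ξ₁ ξ₃ P h3 hP α β (fun i j => hG _ _ (hGab i j))
    (fun i i' j j' => notBad hG (hGab _ _) (hGab _ _) (hGab _ _) (hGab _ _) (by simpa using h0.2.1 ((i.succ, i'.succ), (j.succ, j'.succ)))) hIab
  have hX : ∀ a, ∃ X : Pol p d, X.IsHomogeneous s ∧ ((∃ u, G' a u) → X - ξ₁ a ∈ JJ A (sp {a}) ∧ ∀ j, X - q j + P (β j - a) ∈ JJ A (sp {β j - a})) := by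
    intro a
    by_cases hu : ∃ u, G' a u
    · obtain ⟨u, hu⟩ := hu
      have g1 : ∀ j, G a (β j) := fun j => by simpa using hu.1 0 j.succ
      obtain ⟨X, x1, x2, x3⟩ := lift_X hA ξ₁ ξ₃ P h1 hP α β q q1 q2 q3 a (fun j => hG _ _ (g1 j))
        (fun i j j' => notBad hG (hGab _ _) (hGab _ _) (g1 _) (g1 _) (by simpa using hu.2.1 ((i.succ, 0), (j.succ, j'.succ)))) (by
          have := hu.2.2.comp (Sum.map id Fin.succ) (Sum.map_injective.2 ⟨Function.injective_id, Fin.succ_injective _⟩)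
          convert this using 1
          funext k; rcases k with k | k <;> simp)
      exact ⟨X, x1, fun _ => ⟨x2, x3⟩⟩
    · exact ⟨0, isHomogeneous_zero _ _ _, fun h => absurd h hu⟩
  choose X hX1 hX2 using hX
  refine ⟨X, hX1, G', fun a a' u => TT A P β a a' u, ?_, ?_, hb'⟩
  · intro a u hu
    exact ⟨by simpa using hu.1 0 0, (hX2 a ⟨u, hu⟩).1⟩
  · intro a a' u hu hu' hT
    simp only [TT] at hT
    push Not at hT
    have g : ∀ a u, G' a u → ∀ j, G a (β j) := fun a u hu j => by simpa using hu.1 0 j.succ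
    exact lift_pair hA P hP β q a a' u (X a) (X a') (hX1 a) (hX1 a') (hX2 a ⟨u, hu⟩).2 (hX2 a' ⟨u, hu'⟩).2
      (fun j => notBad hG (by simpa using hu.1 0 0) (g a u hu j) (by simpa using hu'.1 0 0) (g a' u hu' j) (hT.1 j)) hT.2
end ST2

section ST3
set_option synthInstance.maxHeartbeats 400000
set_option synthInstance.maxSize 1000
variable {p d s : ℕ} [Fact p.Prime] {A : Matrix (Fin d) (Fin d) (ZMod p)}

lemma dens_and_prod {α β : Type*} [Fintype α] [Fintype β] (P : α → Prop) (Q : β → Prop) :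
    dens (fun x : α × β => P x.1 ∧ Q x.2) = dens P * dens Q := by
  rw [dens_prod]
  simp only [dens_and_left]
  rw [ave_mul_right]; rfl

lemma dens_cs {α β : Type*} [Fintype α] [Fintype β] [Nonempty α] (E : α → β → Prop) :
    dens (fun x : α × β => E x.1 x.2) ^ 2 ≤ dens (fun x : α × (β × β) => E x.1 x.2.1 ∧ E x.1 x.2.2) := by
  rw [dens_prod, dens_prod]
  refine (ave_pow_le (fun x => dens_nonneg _) 2).trans_eq ?_
  congr 1; ext a
  rw [sq, ← dens_and_prod]

def FF (G : VV p d → VV p d → Prop) (r l u a : VV p d) : Prop :=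
  (G a (a + l) ∧ G a u) ∧ (G (a + r) (a + l) ∧ G (a + r) (u + r))

lemma FF_dens (G : VV p d → VV p d → Prop) :
    dens (fun x : VV p d × VV p d => G x.1 x.2) ^ 8 ≤
      dens (fun z : (VV p d × (VV p d × VV p d)) × (VV p d × VV p d) => FF G z.1.1 z.2.1 z.2.2 z.1.2.1 ∧ FF G z.1.1 z.2.1 z.2.2 z.1.2.2) := by
  have c1 := dens_cs (fun (w : VV p d × (VV p d × VV p d)) (a : VV p d) => FF G w.1 w.2.1 w.2.2 a)
  have c2 := dens_cs (fun (w : VV p d × VV p d) (a : VV p d) => G a w.1 ∧ G a (a + w.2))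
  have c3 := dens_cs G
  let e1 : (VV p d × (VV p d × VV p d)) × (VV p d × VV p d) ≃ (VV p d × (VV p d × VV p d)) × (VV p d × VV p d) :=
    { toFun := fun z => ((z.1.1, (z.2.1, z.2.2)), (z.1.2.1, z.1.2.2))
      invFun := fun z => ((z.1.1, (z.2.1, z.2.2)), (z.1.2.1, z.1.2.2))
      left_inv := fun _ => rfl
      right_inv := fun _ => rfl }
  have d1 := dens_equiv e1 (fun x => FF G x.1.1 x.1.2.1 x.1.2.2 x.2.1 ∧ FF G x.1.1 x.1.2.1 x.1.2.2 x.2.2)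
  let e2 : (VV p d × (VV p d × VV p d)) × VV p d ≃ (VV p d × VV p d) × (VV p d × VV p d) :=
    { toFun := fun z => ((z.2 + z.1.2.1, z.1.2.2 - z.2), (z.2, z.2 + z.1.1))
      invFun := fun z => ((z.2.2 - z.2.1, (z.1.1 - z.2.1, z.1.2 + z.2.1)), z.2.1)
      left_inv := fun _ => by simp
      right_inv := fun _ => by simp }
  have d2 := dens_equiv e2 (fun x => (G x.2.1 x.1.1 ∧ G x.2.1 (x.2.1 + x.1.2)) ∧ (G x.2.2 x.1.1 ∧ G x.2.2 (x.2.2 + x.1.2)))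
  have d2' : dens (fun x : (VV p d × (VV p d × VV p d)) × VV p d => FF G x.1.1 x.1.2.1 x.1.2.2 x.2) =
      dens fun x => (G (e2 x).2.1 (e2 x).1.1 ∧ G (e2 x).2.1 ((e2 x).2.1 + (e2 x).1.2)) ∧ (G (e2 x).2.2 (e2 x).1.1 ∧ G (e2 x).2.2 ((e2 x).2.2 + (e2 x).1.2)) := by
    congr 1
    ext ⟨⟨r, l, u⟩, a⟩
    have h1 : a + (u - a) = u := by abel
    have h2 : a + r + (u - a) = u + r := by abel
    simp only [FF, e2, Equiv.coe_fn_mk, h1, h2]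
  let e3 : (VV p d × VV p d) × VV p d ≃ VV p d × (VV p d × VV p d) :=
    { toFun := fun z => (z.2, (z.1.1, z.2 + z.1.2))
      invFun := fun z => ((z.2.1, z.2.2 - z.1), z.1)
      left_inv := fun _ => by simp
      right_inv := fun _ => by simp }
  have d3 := dens_equiv e3 (fun x => G x.1 x.2.1 ∧ G x.1 x.2.2)
  rw [← d1] at c1
  rw [d2', d2] at c1
  have d3' : dens (fun x : (VV p d × VV p d) × VV p d => G x.2 x.1.1 ∧ G x.2 (x.2 + x.1.2)) = _ := d3
  rw [d3'] at c2
  have h0 := dens_nonneg (fun x : VV p d × VV p d => G x.1 x.2)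
  calc dens (fun x : VV p d × VV p d => G x.1 x.2) ^ 8 = ((dens (fun x : VV p d × VV p d => G x.1 x.2) ^ 2) ^ 2) ^ 2 := by ring
    _ ≤ _ := pow_le_pow_left₀ (by positivity) ((pow_le_pow_left₀ (by positivity) c3 2).trans c2) 2
    _ ≤ _ := c1

lemma step3 (hA : Std p d s A) (X P : VV p d → Pol p d) (hX : ∀ a, (X a).IsHomogeneous s)
    (G : VV p d → VV p d → Prop) (T : VV p d → VV p d → VV p d → Prop)
    (hG : ∀ a a' u, G a u → G a' u → ¬ T a a' u → X a - X a' + P (u - a) - P (u - a') ∈ JJ A (sp {u - a} ⊔ sp {u - a'})) :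
    dens (fun x : VV p d × VV p d => G x.1 x.2) ^ 8 - 4 * dens (fun x : VV p d × (VV p d × VV p d) => T x.1 x.2.1 x.2.2) - 2 / p ≤
    dens (fun z : VV p d × (VV p d × VV p d) =>
      X z.2.1 - X z.2.2 - X (z.2.1 + z.1) + X (z.2.2 + z.1) ∈ JJ A (sp {z.2.1 - z.2.2}) ∧
      X z.2.1 - X z.2.2 - X (z.2.1 + z.1) + X (z.2.2 + z.1) ∈ JJ A (sp {z.1}) ∧
      (∃ u, G z.2.1 u) ∧ (∃ u, G z.2.2 u) ∧ (∃ u, G (z.2.1 + z.1) u) ∧ (∃ u, G (z.2.2 + z.1) u)) := by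
  set τ := dens (fun x : VV p d × (VV p d × VV p d) => T x.1 x.2.1 x.2.2) with hτ
  let D : VV p d × (VV p d × VV p d) → Pol p d := fun z => X z.2.1 - X z.2.2 - X (z.2.1 + z.1) + X (z.2.2 + z.1)
  have hD : ∀ z, (D z).IsHomogeneous s := fun z => (((hX _).sub (hX _)).sub (hX _)).add (hX _)
  let Ω := (VV p d × (VV p d × VV p d)) × (VV p d × VV p d)
  let B : Fin 6 → Ω → Prop := ![fun z => T z.1.2.1 (z.1.2.1 + z.1.1) (z.1.2.1 + z.2.1), fun z => T z.1.2.2 (z.1.2.2 + z.1.1) (z.1.2.2 + z.2.1),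
    fun z => T z.1.2.1 z.1.2.2 z.2.2, fun z => T (z.1.2.1 + z.1.1) (z.1.2.2 + z.1.1) (z.2.2 + z.1.1),
    fun z => D z.1 ∉ JJ A (sp {z.1.1}) ∧ D z.1 ∈ JJ A (sp {z.1.1} ⊔ sp {z.2.1}),
    fun z => D z.1 ∉ JJ A (sp {z.1.2.1 - z.1.2.2}) ∧ D z.1 ∈ JJ A (sp {z.1.2.1 - z.1.2.2} ⊔ sp {z.2.2 - z.1.2.1})]
  have hfst := dens_fst (α := VV p d × (VV p d × VV p d)) (β := VV p d × VV p d) (fun x => T x.1 x.2.1 x.2.2)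
  have t0 : dens (B 0) = τ := by
    let e : Ω ≃ Ω :=
      { toFun := fun z => ((z.1.2.1, (z.1.2.1 + z.1.1, z.1.2.1 + z.2.1)), (z.1.2.2, z.2.2))
        invFun := fun w => ((w.1.2.1 - w.1.1, (w.1.1, w.2.1)), (w.1.2.2 - w.1.1, w.2.2))
        left_inv := fun _ => by simp
        right_inv := fun _ => by simp }
    exact (dens_equiv e (fun x => T x.1.1 x.1.2.1 x.1.2.2)).trans hfst
  have t1 : dens (B 1) = τ := by
    let e : Ω ≃ Ω :=
      { toFun := fun z => ((z.1.2.2, (z.1.2.2 + z.1.1, z.1.2.2 + z.2.1)), (z.1.2.1, z.2.2))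
        invFun := fun w => ((w.1.2.1 - w.1.1, (w.2.1, w.1.1)), (w.1.2.2 - w.1.1, w.2.2))
        left_inv := fun _ => by simp
        right_inv := fun _ => by simp }
    exact (dens_equiv e (fun x => T x.1.1 x.1.2.1 x.1.2.2)).trans hfst
  have t2 : dens (B 2) = τ := by
    let e : Ω ≃ Ω :=
      { toFun := fun z => ((z.1.2.1, (z.1.2.2, z.2.2)), (z.1.1, z.2.1))
        invFun := fun w => ((w.2.1, (w.1.1, w.1.2.1)), (w.2.2, w.1.2.2))
        left_inv := fun _ => rfl
        right_inv := fun _ => rfl }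
    exact (dens_equiv e (fun x => T x.1.1 x.1.2.1 x.1.2.2)).trans hfst
  have t3 : dens (B 3) = τ := by
    let e : Ω ≃ Ω :=
      { toFun := fun z => ((z.1.2.1 + z.1.1, (z.1.2.2 + z.1.1, z.2.2 + z.1.1)), (z.1.1, z.2.1))
        invFun := fun w => ((w.2.1, (w.1.1 - w.2.1, w.1.2.1 - w.2.1)), (w.2.2, w.1.2.2 - w.2.1))
        left_inv := fun _ => by simp
        right_inv := fun _ => by simp }
    exact (dens_equiv e (fun x => T x.1.1 x.1.2.1 x.1.2.2)).trans hfst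
  have t4 : dens (B 4) ≤ 1 / p := by
    refine dens_fibre_le fun w => ?_
    have := dens_bad hA (D w) (hD w) (sp {w.1}) ((frk_sp _).trans (by norm_num))
    rw [← dens_fst (β := VV p d)] at this
    exact this
  have t5 : dens (B 5) ≤ 1 / p := by
    refine dens_fibre_le fun w => ?_
    have := dens_bad hA (D w) (hD w) (sp {w.2.1 - w.2.2}) ((frk_sp _).trans (by norm_num))
    rw [← dens_equiv (Equiv.subRight w.2.1)] at this
    refine dens_fibre_le fun l => ?_
    exact this
  have hB : dens (fun z => ∃ k, B k z) ≤ 4 * τ + 2 / p := by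
    refine (dens_exists_le B).trans ?_
    rw [Fin.sum_univ_six, t0, t1, t2, t3]
    have : (2:ℝ) / p = 1 / p + 1 / p := by ring
    linarith
  have hm := dens_diff (fun z : Ω => FF G z.1.1 z.2.1 z.2.2 z.1.2.1 ∧ FF G z.1.1 z.2.1 z.2.2 z.1.2.2) (fun z => ∃ k, B k z)
  have hF := FF_dens G
  refine le_trans (by linarith) (hm.trans (dens_le_fst (Q := fun z : VV p d × (VV p d × VV p d) => _) ?_))
  rintro ⟨⟨r, a, a'⟩, l, u⟩ ⟨⟨⟨⟨g1, g2⟩, g3, g4⟩, ⟨⟨k1, k2⟩, k3, k4⟩⟩, hn⟩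
  push Not at hn
  have n0 : ¬ T a (a + r) (a + l) := hn 0
  have n1 : ¬ T a' (a' + r) (a' + l) := hn 1
  have n2 : ¬ T a a' u := hn 2
  have n3 : ¬ T (a + r) (a' + r) (u + r) := hn 3
  have n4 : ¬ (D (r, a, a') ∉ JJ A (sp {r}) ∧ D (r, a, a') ∈ JJ A (sp {r} ⊔ sp {l})) := hn 4
  have n5 : ¬ (D (r, a, a') ∉ JJ A (sp {a - a'}) ∧ D (r, a, a') ∈ JJ A (sp {a - a'} ⊔ sp {u - a})) := hn 5
  simp only at g1 g2 g3 g4 k1 k2 k3 k4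
  refine ⟨?_, ?_, ⟨_, g1⟩, ⟨_, k1⟩, ⟨_, g3⟩, ⟨_, k3⟩⟩
  · by_contra hc
    refine n5 ⟨hc, ?_⟩
    have e1 := mv2 (hG _ _ _ g2 k2 n2) (W := sp {a - a'} ⊔ sp {u - a}) (mem2 0 1 (by module)) (mem2 1 1 (by module))
    have e2 := mv2 (hG _ _ _ g4 k4 n3) (W := sp {a - a'} ⊔ sp {u - a}) (mem2 0 1 (by module)) (mem2 1 1 (by module))
    have := sub_mem e1 e2
    simp only [add_sub_add_right_eq_sub] at this
    convert this using 1
    simp only [D]; ring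
  · by_contra hc
    refine n4 ⟨hc, ?_⟩
    have e1 := mv2 (hG _ _ _ g1 g3 n0) (W := sp {r} ⊔ sp {l}) (mem2 0 1 (by module)) (mem2 (-1) 1 (by module))
    have e2 := mv2 (hG _ _ _ k1 k3 n1) (W := sp {r} ⊔ sp {l}) (mem2 0 1 (by module)) (mem2 (-1) 1 (by module))
    have := sub_mem e1 e2
    simp only [add_sub_add_left_eq_sub, add_sub_cancel_left] at this
    convert this using 1
    simp only [D]; ring
end ST3

section ST4r
open Polynomial in
lemma gauge_ex {R : Type*} [CommRing R] (ρ : R) (n : ℕ) (hu : ∀ k : ℕ, 1 ≤ k → k ≤ n + 1 → IsUnit (k : R)) :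
    ∀ Γ : R[X], Γ.natDegree ≤ n → (∀ j, 1 ≤ j → ρ ∣ Γ.coeff j) →
      ∃ (G : R[X]) (c : R), G.natDegree ≤ n + 1 ∧ G.coeff 0 = 0 ∧ taylor ρ G - G = Γ - Polynomial.C c := by
  induction n with
  | zero =>
    intro Γ h _
    refine ⟨0, Γ.coeff 0, by simp, by simp, ?_⟩
    rw [Polynomial.eq_C_of_natDegree_le_zero h]; simp
  | succ m ih =>
    intro Γ h hd
    obtain ⟨κ, hκ⟩ := hd (m+1) (by omega)
    obtain ⟨u, hu'⟩ := (hu (m+2) (by omega) (by omega)).exists_right_inv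
    set M : R[X] := Polynomial.monomial (m+2) (κ * u) with hM
    have hc : ∀ k, (taylor ρ M).coeff k = (κ * u) * (ρ^(m+2-k) * ((m+2).choose k : R)) := by
      intro k
      rw [hM, Polynomial.taylor_monomial, Polynomial.coeff_C_mul, Polynomial.coeff_X_add_C_pow]
    have hMc : ∀ k, M.coeff k = if m + 2 = k then κ * u else 0 := fun k => by rw [hM, Polynomial.coeff_monomial]
    obtain ⟨G', c, g1, g2, g3⟩ := ih (fun k h1 h2 => hu k h1 (by omega)) (Γ - (taylor ρ M - M)) (by
      rw [natDegree_le_iff_coeff_eq_zero]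
      intro k hk
      rw [Polynomial.coeff_sub, Polynomial.coeff_sub, hc, hMc]
      rcases Nat.lt_or_ge k (m+2) with h1 | h1
      · have : k = m+1 := by omega
        subst this
        rw [hκ, if_neg (by omega), show m + 2 - (m+1) = 1 by omega, show ((m+2).choose (m+1) : ℕ) = m+2 by
          rw [Nat.choose_succ_self_right]]
        linear_combination (-(κ * ρ)) * hu'
      · rw [Polynomial.coeff_eq_zero_of_natDegree_lt (lt_of_le_of_lt h (by omega))]
        rcases Nat.eq_or_lt_of_le h1 with h2 | h2
        · subst h2; simp
        · rw [Nat.choose_eq_zero_of_lt h2, if_neg (by omega)]; simp) (by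
      intro j hj
      rw [Polynomial.coeff_sub, Polynomial.coeff_sub, hc, hMc]
      refine dvd_sub (hd j hj) ?_
      rcases Nat.lt_trichotomy j (m+2) with h1 | h1 | h1
      · rw [if_neg (by omega), sub_zero]
        exact Dvd.dvd.mul_left (Dvd.dvd.mul_right (dvd_pow_self _ (by omega)) _) _
      · subst h1; simp
      · rw [Nat.choose_eq_zero_of_lt h1, if_neg (by omega)]; simp)
    refine ⟨G' + M, c, ?_, ?_, ?_⟩
    · refine (Polynomial.natDegree_add_le _ _).trans (max_le (g1.trans (by omega)) ?_)
      rw [hM]; exact Polynomial.natDegree_monomial_le _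
    · rw [Polynomial.coeff_add, g2, hMc]; simp
    · rw [map_add]; linear_combination g3

open Polynomial in
lemma diff_const {R : Type*} [CommRing R] (ρ : R) (hρ : ∀ x, ρ * x = 0 → x = 0) (n : ℕ) (hu : ∀ k : ℕ, 1 ≤ k → k ≤ n → IsUnit (k : R))
    (F : R[X]) (hF : F.natDegree ≤ n) (h : taylor ρ F = F) : F = Polynomial.C (F.coeff 0) := by
  apply Polynomial.eq_C_of_natDegree_eq_zero
  by_contra hne
  obtain ⟨m, hm⟩ := Nat.exists_eq_succ_of_ne_zero hne
  have h1 := congrArg (fun q => Polynomial.coeff q m) h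
  simp only [taylor_coeff] at h1
  have hdeg : (hasseDeriv m F).natDegree < 2 := by
    have := natDegree_hasseDeriv_le F m; omega
  rw [eval_eq_sum_range' hdeg, Finset.sum_range_succ, Finset.sum_range_one, hasseDeriv_coeff, hasseDeriv_coeff] at h1
  have h2 : ((1 + m).choose m : ℕ) = m + 1 := by rw [add_comm, Nat.choose_succ_self_right]
  simp only [zero_add, Nat.choose_self, pow_zero, pow_one, h2] at h1
  have h3 : ρ * (((m+1 : ℕ) : R) * F.coeff (1 + m)) = 0 := by
    push_cast at h1 ⊢
    linear_combination h1
  have h4 := hρ _ h3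
  have h5 := (hu (m+1) (by omega) (by omega)).mul_right_eq_zero.1 h4
  have h6 : F.coeff F.natDegree = 0 := by rw [hm]; rwa [add_comm] at h5
  rw [coeff_natDegree, leadingCoeff_eq_zero] at h6
  simp [h6] at hne
end ST4r

section ST4a
lemma taylor_aux {R : Type*} [CommRing R] (ρ τ c : R) (Λ G Γ : Polynomial R)
    (g3 : Polynomial.taylor ρ G - G = Γ - Polynomial.C c)
    (key : Polynomial.taylor ρ Λ - Λ = Polynomial.taylor τ Γ - Γ) :
    Polynomial.taylor ρ (Λ - (Polynomial.taylor τ G - G)) = Λ - (Polynomial.taylor τ G - G) := by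
  have h5 : Polynomial.taylor ρ G = G + Γ - Polynomial.C c := by linear_combination g3
  rw [map_sub, map_sub, Polynomial.taylor_taylor, add_comm ρ, ← Polynomial.taylor_taylor, h5]
  rw [map_sub, map_add, Polynomial.taylor_C]
  linear_combination key
variable {p d s : ℕ} [Fact p.Prime] {A : Matrix (Fin d) (Fin d) (ZMod p)}

lemma gaugeP (hA : Std p d s A) (hp : s + 1 < p) {r0 : VV p d} (hr : r0 ≠ 0) (Γ : Polynomial (Pol p d))
    (hΓ : Γ.natDegree ≤ s) (hΓc : ∀ j, 1 ≤ j → Γ.coeff j ∈ JJ A (sp {r0})) :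
    ∃ Cf : VV p d → Pol p d, (∀ a, (Cf a).IsHomogeneous s) ∧ (∀ a, Cf a ∈ JJ A (sp {a})) ∧
      ∀ (t : VV p d) (Λ : Polynomial (Pol p d)), Λ.natDegree ≤ s → (∀ a, (Λ.eval (lin A a)).IsHomogeneous s) →
        ∀ z : Fin (s+1) → VV p d, Function.Injective z →
        (∀ i, Λ.eval (lin A (z i + r0)) - Λ.eval (lin A (z i)) - Γ.eval (lin A (z i + t)) + Γ.eval (lin A (z i)) ∈ JJ A ⊥) →
        ∃ c : Pol p d, c.IsHomogeneous s ∧ ∀ a, Λ.eval (lin A a) - (Cf (a + t) - Cf a) - c ∈ JJ A ⊥ := by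
  set q := Ideal.Quotient.mk (JJ A ⊥) with hq
  have hqs : Function.Surjective q := Ideal.Quotient.mk_surjective
  have hu : ∀ k : ℕ, 1 ≤ k → k ≤ s + 1 → IsUnit (k : Pol p d ⧸ JJ A ⊥) := by
    intro k h1 h2
    have : IsUnit ((k : ℕ) : ZMod p) := by
      rw [isUnit_iff_ne_zero, Ne, ZMod.natCast_eq_zero_iff]
      exact fun h => absurd (Nat.le_of_dvd h1 h) (by omega)
    have h3 := (this.map (MvPolynomial.C (σ := Fin d))).map q
    simpa using h3
  have hρ : ∀ x, q (lin A r0) * x = 0 → x = 0 := by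
    intro x hx
    obtain ⟨x, rfl⟩ := hqs x
    rw [← map_mul, hq, Ideal.Quotient.eq_zero_iff_mem] at hx
    rw [hq, Ideal.Quotient.eq_zero_iff_mem]
    exact J1 hA (by simp) (by simpa using hr) hx
  obtain ⟨G, c, g1, g2, g3⟩ := gauge_ex (q (lin A r0)) s hu (Γ.map q) (Polynomial.natDegree_map_le.trans hΓ) (by
    intro j hj
    obtain ⟨g, hg⟩ := J4 (A := A) (W := ⊥) (u := r0) (f := Γ.coeff j) (by rw [bot_sup_eq]; exact hΓc j hj)
    rw [Polynomial.coeff_map]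
    refine ⟨q g, ?_⟩
    rw [← map_mul, hq]; exact Ideal.Quotient.eq.2 hg)
  obtain ⟨Gt, rfl⟩ := Polynomial.map_surjective q hqs G
  have evq : ∀ (Φ : Polynomial (Pol p d)) x, q (Φ.eval x) = (Φ.map q).eval (q x) := fun Φ x => by
    rw [Polynomial.eval_map, Polynomial.eval₂_hom]
  refine ⟨fun a => homogeneousComponent s (Gt.eval (lin A a)), fun a => homogeneousComponent_isHomogeneous _ _, ?_, ?_⟩
  · intro a
    refine J2 A s ?_
    have h1 := eval_sub_mem (A := A) Gt a 0
    rw [sub_zero, map_zero, ← Polynomial.coeff_zero_eq_eval_zero] at h1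
    have h2 : Gt.coeff 0 ∈ JJ A ⊥ := by
      rw [Polynomial.coeff_map] at g2
      exact Ideal.Quotient.eq_zero_iff_mem.1 g2
    have := Ideal.add_mem _ h1 (JJ_mono A (bot_le : ⊥ ≤ sp {a}) h2)
    simpa using this
  · intro t Λ hΛ hΛh z hz hv
    have key : Polynomial.taylor (q (lin A r0)) (Λ.map q) - Λ.map q
        = Polynomial.taylor (q (lin A t)) (Γ.map q) - Γ.map q := by
      set Φ : Polynomial (Pol p d) := Polynomial.taylor (lin A r0) Λ - Λ - Polynomial.taylor (lin A t) Γ + Γ with hΦ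
      have hdeg : Φ.natDegree ≤ s := by
        refine (Polynomial.natDegree_add_le _ _).trans (max_le ((Polynomial.natDegree_sub_le _ _).trans (max_le ((Polynomial.natDegree_sub_le _ _).trans (max_le ?_ hΛ)) ?_)) hΓ)
        · rw [Polynomial.natDegree_taylor]; exact hΛ
        · rw [Polynomial.natDegree_taylor]; exact hΓ
      have hco := VL hA (W := ⊥) (by simp) Φ hdeg z
        (fun i j hij => by simpa [sub_eq_zero] using fun h => hij (hz h)) (fun i => by
          have := hv i
          simp only [map_add] at this
          simpa [hΦ, Polynomial.taylor_eval] using this)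
      have h0 : Φ.map q = 0 := by
        ext k; rw [Polynomial.coeff_map, Polynomial.coeff_zero]; exact Ideal.Quotient.eq_zero_iff_mem.2 (hco k)
      have mt : ∀ (r : Pol p d) (f : Polynomial (Pol p d)), (Polynomial.taylor r f).map q = Polynomial.taylor (q r) (f.map q) := by
        intro r f
        simp [Polynomial.taylor_apply, Polynomial.map_comp]
      rw [hΦ] at h0
      simp only [Polynomial.map_add, Polynomial.map_sub, mt] at h0
      linear_combination h0
    set F := Λ.map q - (Polynomial.taylor (q (lin A t)) (Gt.map q) - Gt.map q) with hF
    have hFd : F.natDegree ≤ s + 1 := by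
      refine (Polynomial.natDegree_sub_le _ _).trans (max_le (Polynomial.natDegree_map_le.trans (by omega)) ((Polynomial.natDegree_sub_le _ _).trans (max_le ?_ g1)))
      rw [Polynomial.natDegree_taylor]; exact g1
    have hFt : Polynomial.taylor (q (lin A r0)) F = F := by
      exact taylor_aux _ _ _ _ _ _ g3 key
    have hFC := diff_const (q (lin A r0)) hρ (s+1) hu F hFd hFt
    obtain ⟨c', hc'⟩ := hqs (F.coeff 0)
    refine ⟨homogeneousComponent s c', homogeneousComponent_isHomogeneous _ _, fun a => ?_⟩
    have h6 : Λ.eval (lin A a) - (Gt.eval (lin A (a+t)) - Gt.eval (lin A a)) - c' ∈ JJ A ⊥ := by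
      rw [← Ideal.Quotient.eq_zero_iff_mem, ← hq]
      have h7 := congrArg (Polynomial.eval (q (lin A a))) hFC
      rw [hF] at h7
      simp only [Polynomial.eval_sub, Polynomial.taylor_eval, Polynomial.eval_C] at h7
      rw [map_sub, map_sub, map_sub, evq, evq, evq, map_add (lin A), map_add q, hc', h7, sub_self]
    have h8 := J2 A s h6
    rw [map_sub, map_sub, map_sub, homogeneousComponent_of_mem (hΛh a), if_pos rfl] at h8
    exact h8


lemma dens_few (P : VV p d → Prop) (hd : 1 ≤ d) (n : ℕ) :
    dens (fun a => P a ∧ ¬ ∃ z : Fin (n+1) → VV p d, Function.Injective z ∧ ∀ i, P (z i)) ≤ (n : ℝ) / p := by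
  classical
  have hp := (Fact.out : p.Prime).pos
  by_cases h : ∃ z : Fin (n+1) → VV p d, Function.Injective z ∧ ∀ i, P (z i)
  · have : dens (fun a => P a ∧ ¬ ∃ z : Fin (n+1) → VV p d, Function.Injective z ∧ ∀ i, P (z i)) ≤ 0 := by
      refine ave_le (α := VV p d) fun x => ?_
      rw [ind_false (fun h1 => h1.2 h)]
    exact this.trans (by positivity)
  · refine (dens_mono (Q := P) fun x hx => hx.1).trans ?_
    rw [dens_eq]
    have hc : (Finset.univ.filter P).card ≤ n := by
      by_contra hn
      obtain ⟨F, hF, hFc⟩ := Finset.exists_subset_card_eq (show n + 1 ≤ (Finset.univ.filter P).card by omega)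
      let e := (F.equivFinOfCardEq hFc).symm
      exact h ⟨fun i => (e i : VV p d), fun i j hij => e.injective (Subtype.ext hij), fun i =>
        (Finset.mem_filter.1 (hF (e i).2)).2⟩
    have hcd : (p : ℝ) ≤ (Fintype.card (VV p d) : ℝ) := by
      rw [Fintype.card_pi]; simp only [ZMod.card, Finset.prod_const, Finset.card_univ, Fintype.card_fin]
      exact_mod_cast Nat.le_self_pow (by omega) p
    have : (0:ℝ) < p := by exact_mod_cast hp
    exact div_le_div₀ (by positivity) (by exact_mod_cast hc) this hcd

lemma sp_neg (x : VV p d) : sp {-x} = sp {x} := by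
  apply le_antisymm
  · exact sp_le (Submodule.neg_mem _ (mem_sp x))
  · exact sp_le (by simpa using Submodule.neg_mem _ (mem_sp (-x)))

lemma step4 (hA : Std p d s A) (hp : s + 1 < p) (X : VV p d → Pol p d) (hX : ∀ a, (X a).IsHomogeneous s)
    (E3 : VV p d → VV p d → VV p d → Prop)
    (hE : ∀ r a a', E3 r a a' → X a - X a' - X (a + r) + X (a' + r) ∈ JJ A (sp {a - a'}) ∧
      X a - X a' - X (a + r) + X (a' + r) ∈ JJ A (sp {r})) (ε : ℝ) (hε0 : 0 ≤ ε)
    (hε : ε ≤ dens (fun z : VV p d × (VV p d × VV p d) => E3 z.1 z.2.1 z.2.2))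
    (hε1 : 0 ≤ ε ^ (s+2) - ((s:ℝ)+3+(s+2)^2)/p) :
    ∃ Cf Tf : VV p d → Pol p d, (∀ a, (Cf a).IsHomogeneous s) ∧ (∀ a, Cf a ∈ JJ A (sp {a})) ∧
      (∀ a, (Tf a).IsHomogeneous s) ∧
      (ε ^ (s+2) - ((s:ℝ)+3+(s+2)^2)/p) ^ (s+2) - ((s:ℝ)+3+(s+2)^2)/p - (s + 1 : ℝ)/p ≤
      dens (fun z : VV p d × VV p d => (∃ r, E3 r z.2 (z.2 + z.1)) ∧
        (X (z.2 + z.1) - Cf (z.2 + z.1)) - (X z.2 - Cf z.2) - Tf z.1 ∈ JJ A ⊥) := by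
  have hd := hA.dim
  set C := ((s:ℝ)+3+(s+2)^2)/p with hC
  have h1 := fun r => CN hA (fun a => X (a + r) - X a) (fun a => (hX _).sub (hX _)) r (E3 r) (by
    intro a a' h
    obtain ⟨h1, h2⟩ := hE r a a' h
    rw [← Ideal.neg_mem_iff] at h1 h2
    have e : -(X a - X a' - X (a + r) + X (a' + r)) = X (a + r) - X a - (X (a' + r) - X a') := by ring
    rw [e] at h1 h2
    exact ⟨h1, h2⟩)
  choose Γ Γd Γh Γc ΓD using h1
  set E4 : VV p d → VV p d → VV p d → Prop := fun r a a' => E3 r a a' ∧ (X (a + r) - X a) - (Γ r).eval (lin A a) ∈ JJ A ⊥ ∧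
    (X (a' + r) - X a') - (Γ r).eval (lin A a') ∈ JJ A ⊥ with hE4
  have h4 : ε ^ (s+2) - C ≤ dens (fun z : VV p d × (VV p d × VV p d) => E4 z.1 z.2.1 z.2.2) := by
    rw [dens_prod] at hε
    rw [dens_prod]
    refine le_trans ?_ (ave_mono ΓD)
    rw [ave_sub, ave_const]
    have := ave_pow_le (f := fun r => dens fun z : VV p d × VV p d => E3 r z.1 z.2) (fun r => dens_nonneg _) (s+2)
    have h6 := pow_le_pow_left₀ hε0 hε (s+2)
    linarith
  have h1 := fun t => CN hA (fun a => X (a + t) - X a) (fun a => (hX _).sub (hX _)) t (fun a b => E4 (b - a) a (a + t)) (by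
    intro a b h
    obtain ⟨h1, h2⟩ := hE _ _ _ h.1
    have e : X a - X (a + t) - X (a + (b - a)) + X (a + t + (b - a)) = - (X (a + t) - X a - (X (b + t) - X b)) := by
      rw [add_sub_cancel, show a + t + (b - a) = b + t by abel]; ring
    rw [e, Ideal.neg_mem_iff] at h1 h2
    rw [show a - (a + t) = - t by abel, sp_neg] at h1
    rw [← neg_sub, sp_neg] at h2
    exact ⟨h2, h1⟩)
  choose Λ Λd Λh Λc ΛD using h1
  set E5 : VV p d → VV p d → VV p d → Prop := fun t a b => E4 (b - a) a (a + t) ∧ (X (a + t) - X a) - (Λ t).eval (lin A a) ∈ JJ A ⊥ ∧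
    (X (b + t) - X b) - (Λ t).eval (lin A b) ∈ JJ A ⊥ with hE5
  let e1 : VV p d × (VV p d × VV p d) ≃ VV p d × (VV p d × VV p d) :=
    { toFun := fun z => (z.2.2 - z.2.1, (z.2.1, z.2.1 + z.1))
      invFun := fun z => (z.2.2 - z.2.1, (z.2.1, z.2.1 + z.1))
      left_inv := fun z => by simp
      right_inv := fun z => by simp }
  have h5 : (ε ^ (s+2) - C) ^ (s+2) - C ≤ dens (fun z : VV p d × (VV p d × VV p d) => E5 z.1 z.2.1 z.2.2) := by
    rw [← dens_equiv e1, dens_prod] at h4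
    rw [dens_prod]
    refine le_trans ?_ (ave_mono ΛD)
    rw [ave_sub, ave_const]
    have := ave_pow_le (f := fun t => dens fun z : VV p d × VV p d => E4 (z.2 - z.1) z.1 (z.1 + t)) (fun r => dens_nonneg _) (s+2)
    have h6 := pow_le_pow_left₀ hε1 h4 (s+2)
    have h7 := h6.trans this
    linarith
  set D := (ε ^ (s+2) - C) ^ (s+2) - C - (s + 1 : ℝ)/p with hD
  rcases le_or_gt D 0 with hD0 | hD0
  · exact ⟨0, 0, fun a => isHomogeneous_zero _ _ _, fun a => Ideal.zero_mem _, fun a => isHomogeneous_zero _ _ _, hD0.trans (dens_nonneg _)⟩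
  have hp0 : (0:ℝ) < p := by exact_mod_cast (Fact.out : p.Prime).pos
  let e2 : VV p d × (VV p d × VV p d) ≃ VV p d × (VV p d × VV p d) :=
    { toFun := fun z => (z.2.1, (z.2.2, z.2.2 + z.1))
      invFun := fun z => (z.2.2 - z.2.1, (z.1, z.2.1))
      left_inv := fun z => by simp
      right_inv := fun z => by simp }
  have h6 : D + s / p ≤ dens (fun z : VV p d × (VV p d × VV p d) => E5 z.2.1 z.2.2 (z.2.2 + z.1) ∧ ¬ (z.1 = 0)) := by
    refine le_trans ?_ (dens_diff _ _)
    have h7 : dens (fun z : VV p d × (VV p d × VV p d) => E5 z.2.1 z.2.2 (z.2.2 + z.1)) =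
      dens (fun z : VV p d × (VV p d × VV p d) => E5 z.1 z.2.1 z.2.2) := dens_equiv e2 (fun z : VV p d × (VV p d × VV p d) => E5 z.1 z.2.1 z.2.2)
    have h8 : dens (fun z : VV p d × (VV p d × VV p d) => z.1 = 0) ≤ 1 / p := by
      rw [dens_fst (fun x : VV p d => x = 0)]
      have := dens_sub (⊥ : Submodule (ZMod p) (VV p d)) (by simp; omega)
      simpa using this
    rw [h7]
    have : D = (ε ^ (s+2) - C) ^ (s+2) - C - s / p - 1 / p := by rw [hD]; ring
    linarith
  have h6' := h6
  rw [dens_prod] at h6'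
  obtain ⟨r0, hr0⟩ := exists_le_ave (fun r : VV p d => dens fun z : VV p d × VV p d => E5 z.1 z.2 (z.2 + r) ∧ ¬ (r = 0))
  have h7 := h6'.trans hr0
  have hr : r0 ≠ 0 := by
    have : 0 < dens fun z : VV p d × VV p d => E5 z.1 z.2 (z.2 + r0) ∧ ¬ (r0 = 0) := lt_of_lt_of_le (by positivity) h7
    obtain ⟨_, h⟩ := dens_pos this
    exact h.2
  obtain ⟨Cf, c1, c2, c3⟩ := gaugeP hA hp hr (Γ r0) (Γd r0) (Γc r0)
  have key : ∀ t, ∃ c : Pol p d, c.IsHomogeneous s ∧ ((∃ z : Fin (s+1) → VV p d, Function.Injective z ∧ ∀ i, E5 t (z i) (z i + r0)) →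
      ∀ a, (Λ t).eval (lin A a) - (Cf (a + t) - Cf a) - c ∈ JJ A ⊥) := by
    intro t
    by_cases h : ∃ z : Fin (s+1) → VV p d, Function.Injective z ∧ ∀ i, E5 t (z i) (z i + r0)
    · obtain ⟨z, hz, hzE⟩ := h
      obtain ⟨c, hc, hc'⟩ := c3 t (Λ t) (Λd t) (Λh t) z hz (by
        intro i
        obtain ⟨⟨_, k1, k2⟩, k3, k4⟩ := hzE i
        rw [add_sub_cancel_left] at k1 k2
        have := Ideal.add_mem _ (Ideal.sub_mem _ k3 k4) (Ideal.sub_mem _ k2 k1)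
        convert this using 1
        rw [add_right_comm (z i) t r0]; ring)
      exact ⟨c, hc, fun _ => hc'⟩
    · exact ⟨0, isHomogeneous_zero _ _ _, fun h' => absurd h' h⟩
  choose Tf t1 t2 using key
  refine ⟨Cf, Tf, c1, c2, t1, ?_⟩
  have h8 : dens (fun z : VV p d × VV p d => E5 z.1 z.2 (z.2 + r0) ∧ ¬ ∃ y : Fin (s+1) → VV p d, Function.Injective y ∧ ∀ i, E5 z.1 (y i) (y i + r0)) ≤ s / p :=
    dens_fibre_le (α := VV p d) fun t => dens_few (fun a => E5 t a (a + r0)) (by omega) s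
  have h9 := dens_diff (fun z : VV p d × VV p d => E5 z.1 z.2 (z.2 + r0) ∧ ¬ (r0 = 0)) (fun z : VV p d × VV p d => E5 z.1 z.2 (z.2 + r0) ∧ ¬ ∃ y : Fin (s+1) → VV p d, Function.Injective y ∧ ∀ i, E5 z.1 (y i) (y i + r0))
  refine le_trans (by linarith) (h9.trans (dens_mono ?_))
  rintro ⟨t, a⟩ ⟨⟨k1, -⟩, k2⟩
  have k3 : ∃ y : Fin (s+1) → VV p d, Function.Injective y ∧ ∀ i, E5 t (y i) (y i + r0) := by
    by_contra hn; exact k2 ⟨k1, hn⟩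
  refine ⟨⟨_, k1.1.1⟩, ?_⟩
  have := Ideal.add_mem _ k1.2.1 (t2 t k3 a)
  convert this using 1
  ring
end ST4a

section BSG
variable {V : Type*} [AddCommGroup V] [Fintype V] {M : Type*} [AddCommGroup M]

lemma markov {α : Type*} [Fintype α] {f : α → ℝ} (hf : ∀ x, 0 ≤ f x) (t : ℝ) (ht : 0 ≤ t) :
    t * dens (fun x => t < f x) ≤ ave f := by
  unfold dens; rw [← ave_mul_left]
  refine ave_mono fun x => ?_
  by_cases h : t < f x
  · rw [ind_true h]; linarith
  · rw [ind_false h]; linarith [hf x]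

set_option maxHeartbeats 200000 in
lemma bsg (G : V → V → Prop) (ε : ℝ) (hε : 0 < ε) (hG : ε ≤ dens (fun z : V × V => G z.1 z.2)) :
    ∃ A' : V → Prop, ε / 4 ≤ dens A' ∧ (∀ a, A' a → ∃ b, G a b) ∧
      ∀ a a', A' a → A' a' → ε / 4 * (ε ^ 2 / 16) ^ 2 ≤
        dens (fun z : V × (V × V) => G a z.1 ∧ G z.2.1 z.1 ∧ G z.2.1 z.2.2 ∧ G a' z.2.2) := by
  set η := ε ^ 2 / 16 with hη
  let cod : V → V → ℝ := fun a a' => dens fun b => G a b ∧ G a' b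
  let nu : V → ℝ := fun b => dens fun a => G a b
  let pr : V → ℝ := fun b => dens fun z : V × V => (G z.1 b ∧ G z.2 b) ∧ cod z.1 z.2 < η
  have h1 : ε ^ 2 - 8 * η ≤ ave fun b => nu b ^ 2 - 8 * pr b := by
    rw [ave_sub, ave_mul_left]
    have e1 : ε ^ 2 ≤ ave fun b => nu b ^ 2 := by
      refine le_trans ?_ (ave_pow_le (fun b => dens_nonneg _) 2)
      rw [dens_prod'] at hG
      exact pow_le_pow_left₀ hε.le hG 2
    have e2 : ave pr ≤ η := by
      show ave (fun b => dens fun z : V × V => (G z.1 b ∧ G z.2 b) ∧ cod z.1 z.2 < η) ≤ η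
      have := dens_prod' (fun w : (V × V) × V => (G w.1.1 w.2 ∧ G w.1.2 w.2) ∧ cod w.1.1 w.1.2 < η)
      rw [← this]
      refine dens_fibre_le (α := V × V) fun z => ?_
      by_cases h : cod z.1 z.2 < η
      · refine (dens_mono fun b hb => hb.1).trans h.le
      · refine le_trans (ave_le (α := V) fun b => ?_) (show (0:ℝ) ≤ η by positivity)
        rw [ind_false fun hb => h hb.2]
    linarith
  obtain ⟨b, hb⟩ := exists_le_ave fun b => nu b ^ 2 - 8 * pr b
  have hb := h1.trans hb
  have hν0 : 0 ≤ nu b := dens_nonneg _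
  have hpr0 : 0 ≤ pr b := dens_nonneg _
  have hν : ε / 2 ≤ nu b := by
    by_contra h; push Not at h
    nlinarith
  have hpr : pr b ≤ nu b ^ 2 / 8 := by nlinarith
  set ν := nu b with hνd
  let pd : V → ℝ := fun a => dens fun a' => (G a b ∧ G a' b) ∧ cod a a' < η
  have hpd : ave pd = pr b := (dens_prod (fun z : V × V => (G z.1 b ∧ G z.2 b) ∧ cod z.1 z.2 < η)).symm
  have hm := markov (f := pd) (fun a => dens_nonneg _) (ν / 4) (by positivity)
  have hm2 : dens (fun a => ν / 4 < pd a) ≤ ν / 2 := by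
    rw [hpd] at hm
    have : 0 < ν := by linarith
    by_contra h; push Not at h
    nlinarith
  have hcs : ∀ a a', cod a a' = cod a' a := fun a a' => by
    show dens _ = dens _
    congr 1; ext b; exact and_comm
  refine ⟨fun a => G a b ∧ ¬ (ν / 4 < pd a), ?_, fun a h => ⟨b, h.1⟩, ?_⟩
  · refine le_trans ?_ (dens_diff _ _)
    have : dens (fun a => G a b) = ν := rfl
    linarith
  · intro a a' ha ha'
    have k1 : ν / 2 ≤ dens (fun a2 => (G a2 b ∧ ¬ ((G a b ∧ G a2 b) ∧ cod a a2 < η)) ∧ ¬ ((G a' b ∧ G a2 b) ∧ cod a' a2 < η)) := by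
      refine le_trans ?_ (dens_diff _ _)
      have := dens_diff (fun a2 => G a2 b) (fun a2 => (G a b ∧ G a2 b) ∧ cod a a2 < η)
      have q1 : dens (fun a2 => (G a b ∧ G a2 b) ∧ cod a a2 < η) ≤ ν / 4 := not_lt.1 ha.2
      have q2 : dens (fun a2 => (G a' b ∧ G a2 b) ∧ cod a' a2 < η) ≤ ν / 4 := not_lt.1 ha'.2
      have q3 : dens (fun a2 => G a2 b) = ν := rfl
      linarith
    let e : V × (V × V) ≃ V × (V × V) :=
      { toFun := fun z => (z.2.1, (z.1, z.2.2)), invFun := fun z => (z.2.1, (z.1, z.2.2)),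
        left_inv := fun z => rfl, right_inv := fun z => rfl }
    rw [← dens_equiv e, dens_prod]
    have k2 : ∀ a2, ind ((G a2 b ∧ ¬ ((G a b ∧ G a2 b) ∧ cod a a2 < η)) ∧ ¬ ((G a' b ∧ G a2 b) ∧ cod a' a2 < η)) * η ^ 2 ≤
        dens fun y : V × V => G a y.1 ∧ G a2 y.1 ∧ G a2 y.2 ∧ G a' y.2 := by
      intro a2
      by_cases h : ((G a2 b ∧ ¬ ((G a b ∧ G a2 b) ∧ cod a a2 < η)) ∧ ¬ ((G a' b ∧ G a2 b) ∧ cod a' a2 < η))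
      · rw [ind_true h, one_mul]
        have r1 : η ≤ cod a a2 := not_lt.1 fun h' => h.1.2 ⟨⟨ha.1, h.1.1⟩, h'⟩
        have r2 : η ≤ cod a' a2 := not_lt.1 fun h' => h.2 ⟨⟨ha'.1, h.1.1⟩, h'⟩
        have r3 : (dens fun y : V × V => G a y.1 ∧ G a2 y.1 ∧ G a2 y.2 ∧ G a' y.2) = cod a a2 * cod a' a2 := by
          rw [dens_prod]
          show _ = dens (fun b => G a b ∧ G a2 b) * dens (fun b => G a' b ∧ G a2 b)
          unfold dens
          rw [← ave_mul_right]
          congr 1; ext y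
          rw [← ave_mul_left]
          congr 1; ext y'
          rw [← ind_and]; congr 1; apply propext; tauto
        rw [r3, sq]
        exact mul_le_mul r1 r2 (by positivity) (r1.trans' (by positivity))
      · rw [ind_false h, zero_mul]; exact dens_nonneg _
    refine le_trans ?_ (ave_mono k2)
    rw [ave_mul_right]
    refine mul_le_mul_of_nonneg_right ?_ (by positivity)
    refine le_trans ?_ k1
    linarith

open scoped Pointwise in
lemma few_diff [DecidableEq V] [DecidableEq M] (x T : V → M) (A' : Finset V) (c : ℝ)
    (h : ∀ a a', a ∈ A' → a' ∈ A' → c ≤ dens (fun z : V × (V × V) =>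
      x z.1 - x a = T (z.1 - a) ∧ x z.1 - x z.2.1 = T (z.1 - z.2.1) ∧ x z.2.2 - x z.2.1 = T (z.2.2 - z.2.1) ∧
        x z.2.2 - x a' = T (z.2.2 - a'))) :
    let Γ := A'.image fun a => (a, x a)
    c * (Γ - Γ).card ≤ Fintype.card V := by
  intro Γ
  classical
  have k : ∀ δ ∈ Γ - Γ, c ≤ dens (fun t : V × (V × V) => δ.2 = T t.1 - T t.2.1 + T t.2.2 - T (t.1 - t.2.1 + t.2.2 - δ.1)) := by
    intro δ hδ
    obtain ⟨u, hu, w, hw, rfl⟩ := Finset.mem_sub.1 hδ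
    obtain ⟨a', ha', rfl⟩ := Finset.mem_image.1 hu
    obtain ⟨a, ha, rfl⟩ := Finset.mem_image.1 hw
    let e : V × (V × V) ≃ V × (V × V) :=
      { toFun := fun z => (z.1 - a, (z.1 - z.2.1, z.2.2 - z.2.1))
        invFun := fun z => (z.1 + a, (z.1 + a - z.2.1, z.1 + a - z.2.1 + z.2.2))
        left_inv := fun z => by ext <;> simp
        right_inv := fun z => by ext <;> simp }
    rw [← dens_equiv e]
    refine (h a a' ha ha').trans (dens_mono ?_)
    rintro ⟨b1, a2, b2⟩ ⟨h1, h2, h3, h4⟩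
    simp only at h1 h2 h3 h4
    show x a' - x a = T (b1 - a) - T (b1 - a2) + T (b2 - a2) - T (b1 - a - (b1 - a2) + (b2 - a2) - (a' - a))
    rw [show b1 - a - (b1 - a2) + (b2 - a2) - (a' - a) = b2 - a' by abel, ← h1, ← h2, ← h3, ← h4]
    abel
  have h2 : ∑ δ ∈ Γ - Γ, c ≤ ∑ δ ∈ Γ - Γ, dens (fun t : V × (V × V) => δ.2 = T t.1 - T t.2.1 + T t.2.2 - T (t.1 - t.2.1 + t.2.2 - δ.1)) :=
    Finset.sum_le_sum k
  rw [Finset.sum_const, nsmul_eq_mul, mul_comm] at h2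
  refine h2.trans ?_
  unfold dens
  rw [← ave_sum]
  refine ave_le (α := V × (V × V)) fun t => ?_
  have hcf : ∀ P : V × M → Prop, ∑ δ ∈ Γ - Γ, ind (P δ) = (((Γ - Γ).filter P).card : ℝ) := fun P => by
    rw [Finset.card_filter]; push_cast
    exact Finset.sum_congr rfl fun x _ => by unfold ind; congr
  rw [hcf]
  norm_cast
  rw [← Finset.card_univ]
  refine Finset.card_le_card_of_injOn (fun δ => δ.1) (fun _ _ => Finset.mem_univ _) ?_
  rintro ⟨v, w⟩ h1 ⟨v', w'⟩ h1' hv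
  simp only [Finset.coe_filter, Set.mem_setOf_eq] at h1 h1'
  simp only at hv
  subst hv
  rw [Prod.mk.injEq]
  exact ⟨rfl, h1.2.trans h1'.2.symm⟩

open scoped Pointwise in
lemma fibre_bdd [DecidableEq V] [DecidableEq M] (x : V → M) (A' : Finset V) (hne : A'.Nonempty) (K : ℝ)
    (h : let Γ := A'.image fun a => (a, x a); ((Γ - Γ).card : ℝ) ≤ K * Γ.card) :
    let Γ := A'.image fun a => (a, x a)
    (((6 • Γ - 6 • Γ).filter fun z => z.1 = 0).card : ℝ) ≤ K ^ 13 := by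
  intro Γ
  have hΓ : Γ.Nonempty := hne.image _
  have hΓ0 : (0:ℝ) < Γ.card := by exact_mod_cast hΓ.card_pos
  have := Finset.pluennecke_ruzsa_inequality_nsmul_sub_nsmul_sub hΓ Γ 7 6
  set S := (6 • Γ - 6 • Γ).filter fun z => z.1 = 0 with hS
  have hc : S.card * Γ.card ≤ (7 • Γ - 6 • Γ).card := by
    rw [← Finset.card_product]
    refine Finset.card_le_card_of_injOn (fun z => z.1 + z.2) ?_ ?_
    · rintro ⟨σ, γ⟩ hz
      obtain ⟨h1, h2⟩ := Finset.mem_product.1 hz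
      obtain ⟨y, hy, z, hz', he⟩ := Finset.mem_sub.1 (Finset.mem_filter.1 h1).1
      refine Finset.mem_sub.2 ⟨y + γ, ?_, z, hz', ?_⟩
      · rw [show (7:ℕ) = 6 + 1 from rfl, add_nsmul, one_nsmul]; exact Finset.add_mem_add hy h2
      · show y + γ - z = σ + γ
        have he : y - z = σ := he
        rw [← he]; abel
    · rintro ⟨σ, γ⟩ hz ⟨σ', γ'⟩ hz' he
      obtain ⟨h1, h2⟩ := Finset.mem_product.1 hz
      obtain ⟨h1', h2'⟩ := Finset.mem_product.1 hz'
      obtain ⟨a, ha, rfl⟩ := Finset.mem_image.1 h2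
      obtain ⟨a', ha', rfl⟩ := Finset.mem_image.1 h2'
      have e1 : σ.1 = 0 := (Finset.mem_filter.1 h1).2
      have e2 : σ'.1 = 0 := (Finset.mem_filter.1 h1').2
      simp only at he
      have e3 := congrArg Prod.fst he
      simp only [Prod.fst_add, e1, e2, zero_add] at e3
      subst e3
      rw [add_right_cancel he]
  have hK : ((Γ - Γ).card / Γ.card : ℝ) ≤ K := by rw [div_le_iff₀ hΓ0]; exact h
  have h3 : ((7 • Γ - 6 • Γ).card : ℝ) ≤ K ^ 13 * Γ.card := by
    have h4 : ((7 • Γ - 6 • Γ).card : ℝ) ≤ ((Γ - Γ).card / Γ.card : ℝ) ^ 13 * Γ.card := by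
      have h6 := (NNRat.cast_le (K := ℝ)).2 this
      push_cast at h6
      exact h6
    refine h4.trans (mul_le_mul_of_nonneg_right (pow_le_pow_left₀ (by positivity) hK 13) hΓ0.le)
  have h5 : (S.card : ℝ) * Γ.card ≤ K ^ 13 * Γ.card := le_trans (by exact_mod_cast hc) h3
  exact le_of_mul_le_mul_right h5 hΓ0
end BSG

section FUN
variable {p d N : ℕ} [Fact p.Prime]

lemma pigeon {α β : Type*} [Fintype α] [Fintype β] [Nonempty β] (P : α → Prop) (f : α → β) :
    ∃ j, dens P / Fintype.card β ≤ dens (fun x => P x ∧ f x = j) := by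
  have h1 : dens P ≤ ∑ j, dens (fun x => P x ∧ f x = j) := by
    refine le_trans (dens_mono ?_) (dens_exists_le (fun j x => P x ∧ f x = j))
    exact fun x hx => ⟨f x, hx, rfl⟩
  by_contra h
  push Not at h
  have := Finset.sum_lt_sum_of_nonempty (Finset.univ_nonempty (α := β)) fun j _ => h j
  have hc : (Fintype.card β : ℝ) ≠ 0 := by exact_mod_cast Fintype.card_ne_zero
  simp only [Finset.sum_const, Finset.card_univ, nsmul_eq_mul] at this
  rw [mul_div_cancel₀ _ hc] at this
  linarith

lemma dens_hyper {w : VV p N} (hw : w ≠ 0) (y : ZMod p) : dens (fun c : VV p N => c ⬝ᵥ w = y) ≤ 1 / p := by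
  let W : Submodule (ZMod p) (VV p N) := LinearMap.ker
    ({ toFun := fun c => c ⬝ᵥ w, map_add' := fun a b => add_dotProduct a b w,
       map_smul' := fun r a => by simp } : VV p N →ₗ[ZMod p] ZMod p)
  have hmem : ∀ c, c ∈ W ↔ c ⬝ᵥ w = 0 := fun c => by simp [W]
  have hlt : Module.finrank (ZMod p) W < N := by
    have h1 : W < ⊤ := by
      rw [lt_top_iff_ne_top]
      intro h
      apply hw
      ext j
      have := (hmem (Pi.single j 1)).1 (h ▸ Submodule.mem_top)
      simpa using this
    have := Submodule.finrank_lt_finrank_of_lt h1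
    simpa using this
  have hp0 : (0:ℝ) < p := by exact_mod_cast (Fact.out : p.Prime).pos
  by_cases h : ∃ c0 : VV p N, c0 ⬝ᵥ w = y
  · obtain ⟨c0, hc0⟩ := h
    refine le_trans (dens_mono (Q := fun c => c - c0 ∈ W) ?_) ?_
    · intro c hc
      rw [hmem, sub_dotProduct, hc, hc0, sub_self]
    · rw [dens_trans c0 (fun c => c ∈ W)]
      exact dens_sub W hlt
  · refine le_trans (ave_le (α := VV p N) (c := 0) fun c => ?_) (by positivity)
    rw [ind_false fun hc => h ⟨c, hc⟩]

lemma exists_func (S : Finset (VV p N)) (B : ℕ) (h : S.card * (2 * B + 1) < p) :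
    ∃ c : VV p N, ∀ w ∈ S, w ≠ 0 → ∀ k : ℤ, |k| ≤ B → c ⬝ᵥ w ≠ (k : ZMod p) := by
  have hp0 : (0:ℝ) < p := by exact_mod_cast (Fact.out : p.Prime).pos
  let ι := S × (Finset.Icc (-B : ℤ) B)
  have h1 : dens (fun c : VV p N => ∃ i : ι, (i.1 : VV p N) ≠ 0 ∧ c ⬝ᵥ (i.1 : VV p N) = ((i.2 : ℤ) : ZMod p)) < 1 := by
    refine lt_of_le_of_lt (dens_exists_le _) ?_
    have h2 : ∀ i : ι, dens (fun c : VV p N => (i.1 : VV p N) ≠ 0 ∧ c ⬝ᵥ (i.1 : VV p N) = ((i.2 : ℤ) : ZMod p)) ≤ 1 / p := by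
      intro i
      by_cases hi : (i.1 : VV p N) = 0
      · refine le_trans (ave_le (α := VV p N) (c := 0) fun c => ?_) (by positivity)
        rw [ind_false fun hc => hc.1 hi]
      · exact (dens_mono fun c hc => hc.2).trans (dens_hyper hi _)
    refine lt_of_le_of_lt (Finset.sum_le_sum fun i _ => h2 i) ?_
    have hc : Fintype.card ι = S.card * (2 * B + 1) := by
      simp only [ι, Fintype.card_prod, Fintype.card_coe, Int.card_Icc]
      congr 1; omega
    rw [Finset.sum_const, Finset.card_univ, hc, nsmul_eq_mul, mul_one_div, div_lt_one hp0]
    exact_mod_cast h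
  have h3 := dens_diff (fun _ : VV p N => True) (fun c : VV p N => ∃ i : ι, (i.1 : VV p N) ≠ 0 ∧ c ⬝ᵥ (i.1 : VV p N) = ((i.2 : ℤ) : ZMod p))
  have h4 : dens (fun _ : VV p N => True) = 1 := by
    unfold dens; simp only [ind_true trivial]; exact ave_const 1
  obtain ⟨c, -, hc⟩ := dens_pos (lt_of_lt_of_le (by linarith) h3)
  refine ⟨c, fun w hw hw0 k hk he => hc ⟨(⟨w, hw⟩, ⟨k, ?_⟩), hw0, he⟩⟩
  rw [Finset.mem_Icc]; exact abs_le.1 hk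

def cell (m p : ℕ) [NeZero m] (y : ZMod p) : Fin m := Fin.ofNat m (y.val * m / p)

lemma cell_eq {m : ℕ} [NeZero m] {y y' : ZMod p} (h : cell m p y = cell m p y') :
    |(y.val : ℤ) - y'.val| * m ≤ p := by
  have hp0 : 0 < p := (Fact.out : p.Prime).pos
  have hm : 0 < m := Nat.pos_of_ne_zero (NeZero.ne m)
  have hlt : ∀ y : ZMod p, y.val * m / p < m := fun y => by
    rw [Nat.div_lt_iff_lt_mul hp0, mul_comm]
    exact Nat.mul_lt_mul_of_pos_left (ZMod.val_lt y) hm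
  have h1 : y.val * m / p = y'.val * m / p := by
    have := congrArg Fin.val h
    simpa [cell, Nat.mod_eq_of_lt (hlt _)] using this
  have a1 := Nat.div_add_mod (y.val * m) p
  have a2 := Nat.div_add_mod (y'.val * m) p
  have b1 := Nat.mod_lt (y.val * m) hp0
  have b2 := Nat.mod_lt (y'.val * m) hp0
  rw [h1] at a1
  rw [← Nat.abs_cast m, ← abs_mul, abs_le]
  have c1 := Nat.zero_le (y.val * m % p)
  have c2 := Nat.zero_le (y'.val * m % p)
  zify at a1 a2 b1 b2 c1 c2
  rw [sub_mul]
  constructor <;> linarith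

open scoped Pointwise in
lemma freiman12 (x : VV p d → VV p N) (A' : Finset (VV p d)) (Sb : ℕ) (hSb : 1 ≤ Sb) (hp : 2 * Sb < p)
    (hS : let Γ := A'.image fun a => (a, x a)
      ((6 • Γ - 6 • Γ).filter fun z => z.1 = 0).card ≤ Sb) :
    ∃ H : VV p d → Prop, (∀ a, H a → a ∈ A') ∧ dens (fun a => a ∈ A') / (24 * Sb : ℕ) ≤ dens H ∧
      ∀ a a' : Fin 6 → VV p d, (∀ i, H (a i)) → (∀ i, H (a' i)) → ∑ i, a i = ∑ i, a' i →
        ∑ i, x (a i) = ∑ i, x (a' i) := by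
  have hp0 : 0 < p := (Fact.out : p.Prime).pos
  set Γ := A'.image fun a => (a, x a) with hΓ
  set S := ((6 • Γ - 6 • Γ).filter fun z => z.1 = 0).image Prod.snd with hSd
  set m := 24 * Sb with hm
  haveI : NeZero m := ⟨by omega⟩
  have hSc : S.card ≤ Sb := Finset.card_image_le.trans hS
  set B := 6 * p / m with hB
  have hBm : B * m ≤ 6 * p := Nat.div_mul_le_self _ _
  obtain ⟨c, hc⟩ := exists_func S B (by
    have h1 : 2 * (S.card * (2 * B + 1)) < 2 * p := by
      have : S.card * (2 * B + 1) ≤ Sb * (2 * B + 1) := Nat.mul_le_mul_right _ hSc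
      have h2 : 24 * (Sb * B) ≤ 6 * p := by rw [hm] at hBm; linarith
      nlinarith
    omega)
  obtain ⟨j, hj⟩ := pigeon (fun a => a ∈ A') (fun a => cell m p (c ⬝ᵥ x a))
  rw [Fintype.card_fin] at hj
  refine ⟨_, fun a h => h.1, hj, ?_⟩
  intro a a' ha ha' hs
  have hsum : ∀ (n : ℕ) (f : Fin n → VV p d), (∀ i, f i ∈ A') → ((∑ i, f i, ∑ i, x (f i)) : VV p d × VV p N) ∈ n • Γ := by
    intro n
    induction n with
    | zero => intro f _; simp
    | succ n ih =>
      intro f hf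
      rw [Fin.sum_univ_castSucc, Fin.sum_univ_castSucc, succ_nsmul]
      exact Finset.add_mem_add (ih (fun i => f i.castSucc) fun i => hf _) (Finset.mem_image.2 ⟨f (Fin.last n), hf _, rfl⟩)
  by_contra hne
  have hw : ∑ i, x (a i) - ∑ i, x (a' i) ∈ S := by
    refine Finset.mem_image.2 ⟨(∑ i, a i - ∑ i, a' i, ∑ i, x (a i) - ∑ i, x (a' i)), Finset.mem_filter.2 ⟨?_, by simp [hs]⟩, rfl⟩
    exact Finset.mem_sub.2 ⟨_, hsum 6 a fun i => (ha i).1, _, hsum 6 a' fun i => (ha' i).1, rfl⟩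
  refine hc _ hw (sub_ne_zero.2 hne) (∑ i, (((c ⬝ᵥ x (a i)).val : ℤ) - ((c ⬝ᵥ x (a' i)).val : ℤ))) ?_ ?_
  · have h1 : |∑ i, (((c ⬝ᵥ x (a i)).val : ℤ) - ((c ⬝ᵥ x (a' i)).val : ℤ))| * m ≤ 6 * p := by
      refine (mul_le_mul_of_nonneg_right (Finset.abs_sum_le_sum_abs _ _) (by positivity)).trans ?_
      rw [Finset.sum_mul]
      refine (Finset.sum_le_sum fun i _ => cell_eq ((ha i).2.trans (ha' i).2.symm)).trans ?_
      simp
    rw [hB]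
    push_cast
    rw [Int.le_ediv_iff_mul_le (by positivity)]
    exact h1
  · push_cast
    simp only [ZMod.natCast_val, ZMod.cast_id', id, dotProduct_sub, dotProduct_sum, Finset.sum_sub_distrib]
end FUN

section BOG
variable {p d : ℕ} [Fact p.Prime]

lemma char_orth (w : VV p d) : ∑ r : VV p d, (ZMod.stdAddChar (N := p) (r ⬝ᵥ w) : ℂ) = if w = 0 then ((p : ℂ) ^ d) else 0 := by
  have h1 : ∀ r : VV p d, (ZMod.stdAddChar (N := p) (r ⬝ᵥ w) : ℂ) = ∏ j, ZMod.stdAddChar (N := p) (r j * w j) := by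
    intro r; rw [dotProduct]
    have := map_prod (AddChar.toMonoidHom (ZMod.stdAddChar (N := p))) (fun j => Multiplicative.ofAdd (r j * w j)) Finset.univ
    rw [← ofAdd_sum] at this
    exact this
  simp only [h1]
  have h2 := Finset.prod_univ_sum (fun _ : Fin d => (Finset.univ : Finset (ZMod p))) (fun j y => (ZMod.stdAddChar (N := p) (y * w j) : ℂ))
  rw [Fintype.piFinset_univ] at h2
  rw [← h2]
  simp only [AddChar.sum_mulShift _ (ZMod.isPrimitive_stdAddChar p), ZMod.card]
  by_cases hw : w = 0
  · subst hw; simp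
  · rw [if_neg hw]
    obtain ⟨j, hj⟩ := Function.ne_iff.1 hw
    exact Finset.prod_eq_zero (Finset.mem_univ j) (by rw [if_neg (show ¬ w j = 0 from hj)]; simp)

lemma char_conj (y : ZMod p) : (starRingEnd ℂ) (ZMod.stdAddChar y) = ZMod.stdAddChar (-y) := by
  rw [AddChar.map_neg_eq_conj]

def FS (H : Finset (VV p d)) (r : VV p d) : ℂ := ∑ a ∈ H, ZMod.stdAddChar (r ⬝ᵥ a)

lemma FS_sq (H : Finset (VV p d)) (r : VV p d) :
    (((‖FS H r‖ ^ 2 : ℝ)) : ℂ) = ∑ z ∈ H ×ˢ H, ZMod.stdAddChar (r ⬝ᵥ (z.1 - z.2)) := by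
  push_cast
  rw [← Complex.mul_conj', FS, map_sum, Finset.sum_mul_sum, Finset.sum_product]
  refine Finset.sum_congr rfl fun a _ => Finset.sum_congr rfl fun b _ => ?_
  rw [char_conj, ← AddChar.map_add_eq_mul, dotProduct_sub, sub_eq_add_neg]

lemma FS_parseval (H : Finset (VV p d)) : ∑ r, ‖FS H r‖ ^ 2 = (p : ℝ) ^ d * H.card := by
  have : ((∑ r, ‖FS H r‖ ^ 2 : ℝ) : ℂ) = (((p : ℝ) ^ d * H.card : ℝ) : ℂ) := by
    rw [Complex.ofReal_sum]
    simp only [FS_sq]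
    rw [Finset.sum_comm]
    simp only [char_orth, sub_eq_zero]
    rw [Finset.sum_product]
    have : ∀ a ∈ H, (∑ y ∈ H, if a = y then ((p:ℂ) ^ d) else 0) = (p:ℂ) ^ d := by
      intro a ha
      rw [Finset.sum_ite_eq, if_pos ha]
    rw [Finset.sum_congr rfl this]
    simp [mul_comm]
  exact_mod_cast this

lemma FS_four (H : Finset (VV p d)) (v : VV p d) (hv : ∀ a ∈ H, ∀ b ∈ H, ∀ c ∈ H, ∀ e ∈ H, v ≠ a + b - c - e) :
    ∑ r, ‖FS H r‖ ^ 4 * (ZMod.stdAddChar (r ⬝ᵥ v) : ℂ).re = 0 := by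
  have h1 : ∑ r, (((‖FS H r‖ ^ 2 : ℝ)) : ℂ) * (((‖FS H r‖ ^ 2 : ℝ)) : ℂ) * (ZMod.stdAddChar (-(r ⬝ᵥ v)) : ℂ) = 0 := by
    have h0 : ∀ r, (((‖FS H r‖ ^ 2 : ℝ)) : ℂ) * (((‖FS H r‖ ^ 2 : ℝ)) : ℂ) * (ZMod.stdAddChar (-(r ⬝ᵥ v)) : ℂ) =
        ∑ z ∈ H ×ˢ H, ∑ z' ∈ H ×ˢ H, (ZMod.stdAddChar (r ⬝ᵥ (z.1 - z.2)) : ℂ) * ZMod.stdAddChar (r ⬝ᵥ (z'.1 - z'.2)) * ZMod.stdAddChar (-(r ⬝ᵥ v)) := by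
      intro r
      rw [FS_sq, Finset.sum_mul_sum, Finset.sum_mul]
      exact Finset.sum_congr rfl fun z _ => Finset.sum_mul _ _ _
    rw [Finset.sum_congr rfl fun r _ => h0 r]
    rw [Finset.sum_comm]
    refine Finset.sum_eq_zero fun z hz => ?_
    rw [Finset.sum_comm]
    refine Finset.sum_eq_zero fun z' hz' => ?_
    have : ∀ r : VV p d, (ZMod.stdAddChar (r ⬝ᵥ (z.1 - z.2)) : ℂ) * ZMod.stdAddChar (r ⬝ᵥ (z'.1 - z'.2)) * ZMod.stdAddChar (-(r ⬝ᵥ v))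
        = ZMod.stdAddChar (r ⬝ᵥ (z.1 + z'.1 - z.2 - z'.2 - v)) := by
      intro r
      rw [← AddChar.map_add_eq_mul, ← AddChar.map_add_eq_mul]
      congr 1
      simp only [dotProduct_sub, dotProduct_add]; ring
    simp only [this]
    rw [char_orth, if_neg]
    rw [Finset.mem_product] at hz hz'
    intro h
    exact hv _ hz.1 _ hz'.1 _ hz.2 _ hz'.2 (sub_eq_zero.1 h).symm
  have h2 := congrArg Complex.re h1
  rw [Complex.re_sum, Complex.zero_re] at h2
  rw [← h2]
  refine Finset.sum_congr rfl fun r _ => ?_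
  rw [← Complex.ofReal_mul, Complex.re_ofReal_mul, ← char_conj, Complex.conj_re]
  ring

lemma char_re {y : ℤ} {z : ZMod p} (h : (y : ZMod p) = z) (hy : 4 * |y| ≤ p) : 0 ≤ (ZMod.stdAddChar z : ℂ).re := by
  have hp0 : (0:ℝ) < p := by exact_mod_cast (Fact.out : p.Prime).pos
  rw [← h, ZMod.stdAddChar_coe]
  have : (2 * Real.pi * Complex.I * y / p : ℂ) = ((2 * Real.pi * y / p : ℝ) : ℂ) * Complex.I := by push_cast; ring
  rw [this, Complex.exp_ofReal_mul_I_re]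
  have hy' : (4 * |(y:ℝ)|) ≤ p := by exact_mod_cast hy
  have hpi := Real.pi_pos
  have h1 := abs_le.1 (show |(y:ℝ)| ≤ p / 4 by linarith)
  apply Real.cos_nonneg_of_neg_pi_div_two_le_of_le
  · rw [le_div_iff₀ hp0]; nlinarith
  · rw [div_le_iff₀ hp0]; nlinarith

lemma bogol (H : Finset (VV p d)) (δ : ℝ) (hδ : 0 < δ) (hδ1 : δ ≤ 1) (hH : δ * (p : ℝ) ^ d ≤ H.card) :
    ∃ Λ : Finset (VV p d), (Λ.card : ℝ) ≤ 2 / δ ^ 3 ∧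
      ∀ v, (∀ r ∈ Λ, ∃ y : ℤ, (y : ZMod p) = r ⬝ᵥ v ∧ 4 * |y| ≤ p) →
        ∃ a ∈ H, ∃ b ∈ H, ∃ c ∈ H, ∃ e ∈ H, v = a + b - c - e := by
  classical
  have hp0 : (0:ℝ) < p := by exact_mod_cast (Fact.out : p.Prime).pos
  set q : ℝ := (p : ℝ) ^ d with hq
  have hq0 : 0 < q := by positivity
  have hHq : (H.card : ℝ) ≤ q := by
    have := Finset.card_le_univ H
    rw [Fintype.card_pi] at this
    simp only [ZMod.card, Finset.prod_const, Finset.card_univ, Fintype.card_fin] at this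
    rw [hq]; exact_mod_cast this
  have hpar := FS_parseval H
  rw [← hq] at hpar
  refine ⟨Finset.univ.filter fun r => δ ^ 3 / 2 * q ^ 2 < ‖FS H r‖ ^ 2, ?_, ?_⟩
  · set Λ := Finset.univ.filter fun r => δ ^ 3 / 2 * q ^ 2 < ‖FS H r‖ ^ 2 with hΛ
    have h1 : ∑ r ∈ Λ, δ ^ 3 / 2 * q ^ 2 ≤ ∑ r ∈ Λ, ‖FS H r‖ ^ 2 := Finset.sum_le_sum fun r hr => (Finset.mem_filter.1 hr).2.le
    have h2 : ∑ r ∈ Λ, ‖FS H r‖ ^ 2 ≤ ∑ r, ‖FS H r‖ ^ 2 := Finset.sum_le_univ_sum_of_nonneg fun r => by positivity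
    rw [Finset.sum_const, nsmul_eq_mul] at h1
    rw [le_div_iff₀ (by positivity)]
    have h3 : (Λ.card * δ ^ 3) * q ^ 2 ≤ 2 * q ^ 2 := by nlinarith
    exact le_of_mul_le_mul_right h3 (by positivity)
  · intro v hv
    by_contra hn
    have h4 := FS_four H v (by
      intro a ha b hb c hc e he h
      exact hn ⟨a, ha, b, hb, c, hc, e, he, h⟩)
    have hF0 : ‖FS H 0‖ = H.card := by simp [FS]
    have hlow : ∀ r, (if r = 0 then (H.card : ℝ) ^ 4 else 0) - δ ^ 3 / 2 * q ^ 2 * ‖FS H r‖ ^ 2 ≤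
        ‖FS H r‖ ^ 4 * (ZMod.stdAddChar (r ⬝ᵥ v) : ℂ).re := by
      intro r
      by_cases hr : r = 0
      · subst hr
        rw [if_pos rfl, hF0]
        simp only [zero_dotProduct, AddChar.map_zero_eq_one, Complex.one_re, mul_one]
        have : 0 ≤ δ ^ 3 / 2 * q ^ 2 * (H.card : ℝ) ^ 2 := by positivity
        linarith
      · rw [if_neg hr, zero_sub]
        by_cases hr2 : δ ^ 3 / 2 * q ^ 2 < ‖FS H r‖ ^ 2
        · obtain ⟨y, hy, hy4⟩ := hv r (Finset.mem_filter.2 ⟨Finset.mem_univ _, hr2⟩)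
          have := char_re hy hy4
          have h5 : 0 ≤ δ ^ 3 / 2 * q ^ 2 * ‖FS H r‖ ^ 2 := by positivity
          have h6 := mul_nonneg (pow_nonneg (norm_nonneg (FS H r)) 4) this
          linarith
        · push Not at hr2
          have h5 : -1 ≤ (ZMod.stdAddChar (r ⬝ᵥ v) : ℂ).re := by
            have := Complex.abs_re_le_norm (ZMod.stdAddChar (r ⬝ᵥ v) : ℂ)
            rw [AddChar.norm_apply] at this
            exact (abs_le.1 this).1
          have h6 : 0 ≤ ‖FS H r‖ ^ 2 := by positivity
          have h7 : ‖FS H r‖ ^ 4 ≤ δ ^ 3 / 2 * q ^ 2 * ‖FS H r‖ ^ 2 := by nlinarith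
          have h8 : 0 ≤ ‖FS H r‖ ^ 4 := by positivity
          nlinarith
    have h9 := Finset.sum_le_sum fun r (_ : r ∈ Finset.univ) => hlow r
    rw [h4, Finset.sum_sub_distrib, ← Finset.mul_sum, hpar, Finset.sum_ite_eq' , if_pos (Finset.mem_univ _)] at h9
    set h : ℝ := (H.card : ℝ) with hh
    have hpos : 0 < h := lt_of_lt_of_le (by positivity) hH
    have h10 : h ^ 3 ≤ δ ^ 3 / 2 * q ^ 3 := by
      have : h ^ 3 * h ≤ δ ^ 3 / 2 * q ^ 3 * h := by linarith
      exact le_of_mul_le_mul_right this hpos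
    have h11 := pow_le_pow_left₀ (by positivity) hH 3
    have : 0 < δ ^ 3 * q ^ 3 := by positivity
    rw [mul_pow] at h11
    linarith
end BOG

lemma spanner {E : Type*} [AddCommGroup E] [Module ℚ E] [FiniteDimensional ℚ E] (Z : Set E) (hZ : Z.Finite) :
    ∃ (k : ℕ) (v : Fin k → E) (φ : Fin k → (E →ₗ[ℚ] ℚ)), k ≤ Module.finrank ℚ E ∧ (∀ i, v i ∈ Z) ∧
      (∀ i j, φ i (v j) = if i = j then 1 else 0) ∧ (∀ z ∈ Z, (∀ i, |φ i z| ≤ 1) ∧ z = ∑ i, φ i z • v i) := by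
  classical
  obtain ⟨t, htZ, htspan, hti⟩ := exists_linearIndependent ℚ Z
  haveI : Finite t := (hZ.subset htZ).to_subtype
  haveI := Fintype.ofFinite t
  let W := Submodule.span ℚ Z
  have hW : ∀ z ∈ Z, z ∈ W := fun z hz => Submodule.subset_span hz
  let u : t → W := fun i => ⟨i.1, hW _ (htZ i.2)⟩
  have hu : LinearIndependent ℚ u := LinearIndependent.of_comp W.subtype hti
  have hus : ⊤ ≤ Submodule.span ℚ (Set.range u) := by
    intro x _
    have hx : x.1 ∈ Submodule.span ℚ t := by rw [htspan]; exact x.2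
    have : Submodule.map W.subtype (Submodule.span ℚ (Set.range u)) = Submodule.span ℚ t := by
      rw [Submodule.map_span, ← Set.range_comp]
      congr 1
      ext y; simp [u]
    rw [← this] at hx
    obtain ⟨y, hy, hyx⟩ := hx
    have : y = x := Subtype.ext hyx
    rw [← this]; exact hy
  let e0 := Module.Basis.mk hu hus
  haveI : Finite Z := hZ.to_subtype
  let cf : Z → W := fun z => ⟨z.1, hW _ z.2⟩
  haveI : Nonempty (t → Z) := ⟨fun i => ⟨i.1, htZ i.2⟩⟩
  obtain ⟨w, hw⟩ := Finite.exists_max (fun w : t → Z => |e0.det (fun i => cf (w i))|)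
  have h1 : (1:ℚ) ≤ |e0.det (fun i => cf (w i))| := by
    have := hw (fun i => ⟨i.1, htZ i.2⟩)
    have h2 : (fun i : t => cf ⟨i.1, htZ i.2⟩) = e0 := by
      ext i; simp [cf, e0, u]
    rw [h2, e0.det_self, abs_one] at this
    exact this
  set vw : t → W := fun i => cf (w i) with hvw
  have hne : e0.det vw ≠ 0 := by
    intro h; rw [h, abs_zero] at h1; linarith
  obtain ⟨hli, hsp⟩ := (Module.Basis.is_basis_iff_det e0).2 (isUnit_iff_ne_zero.2 hne)
  let b := Module.Basis.mk hli hsp.ge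
  let en := (Fintype.equivFin t).symm
  have hext : ∀ i, ∃ g : E →ₗ[ℚ] ℚ, g ∘ₗ W.subtype = b.coord i := fun i => LinearMap.exists_extend _
  choose g hg using hext
  have hg' : ∀ i (x : W), g i x.1 = b.coord i x := fun i x => by rw [← hg]; rfl
  refine ⟨Fintype.card t, fun i => (w (en i)).1, fun i => g (en i), ?_, fun i => (w (en i)).2, ?_, ?_⟩
  · exact hti.fintype_card_le_finrank
  · intro i j
    have h3 := hg' (en i) (vw (en j))
    have : b (en j) = vw (en j) := by simp [b]
    rw [← this] at h3
    rw [Module.Basis.coord_apply, Module.Basis.repr_self, Finsupp.single_apply, this] at h3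
    simp only [hvw, cf] at h3
    rw [h3]
    simp [eq_comm]
  · intro z hz
    constructor
    · intro i
      have h3 := hg' (en i) (cf ⟨z, hz⟩)
      have h3' : (g (en i)) z = (b.coord (en i)) (cf ⟨z, hz⟩) := h3
      rw [h3']
      have h4 := LinearMap.congr_fun (Module.Basis.det_smul_mk_coord_eq_det_update (e := e0) hli hsp.ge (en i)) (cf ⟨z, hz⟩)
      have h5 := hw (Function.update w (en i) ⟨z, hz⟩)
      have h6 : (fun j => cf (Function.update w (en i) ⟨z, hz⟩ j)) = Function.update vw (en i) (cf ⟨z, hz⟩) := by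
        ext j
        by_cases hj : j = en i
        · subst hj; simp
        · simp [hj, hvw]
      simp only [h6] at h5
      have h7 : e0.det vw * (b.coord (en i)) (cf ⟨z, hz⟩) = e0.det (Function.update vw (en i) (cf ⟨z, hz⟩)) := h4
      rw [← h7, abs_mul] at h5
      have h8 : 0 < |e0.det vw| := by linarith
      exact le_of_mul_le_mul_left (by rw [mul_one]; exact h5) h8
    · have h3 := b.sum_repr (cf ⟨z, hz⟩)
      have h4 := congrArg W.subtype h3
      rw [map_sum] at h4
      rw [Equiv.sum_comp en (fun i => g i z • (w i).1)]
      refine h4.symm.trans (Finset.sum_congr rfl fun i _ => ?_)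
      have h3 : g i z = (b.coord i) (cf ⟨z, hz⟩) := hg' i (cf ⟨z, hz⟩)
      rw [h3, map_smul]
      simp [b, hvw, cf]

section EXT
variable {ι M : Type*} [Fintype ι] [AddCommGroup M]

def castQ : (ι → ℤ) →ₗ[ℤ] (ι → ℚ) where
  toFun y := fun i => (y i : ℚ)
  map_add' y z := by ext i; simp
  map_smul' c y := by ext i; simp

lemma ext_helper (L : Submodule ℤ (ι → ℤ)) (f : (ι → ℤ) → M) (b B : ℚ) (hb : 0 ≤ b) (hB : 0 ≤ B)
    (hf : ∀ y ∈ L, ∀ y' ∈ L, (∀ i, |(y i : ℚ)| ≤ b) → (∀ i, |(y' i : ℚ)| ≤ b) → (∀ i, |((y + y') i : ℚ)| ≤ b) → f (y + y') = f y + f y')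
    {k : ℕ} (V : Fin k → ι → ℤ) (hV : ∀ i, V i ∈ L) (hVB : ∀ i j, |(V i j : ℚ)| ≤ B) (hkB : B ≤ b)
    (e : Fin k → ℤ) (he : ∀ i, |e i| ≤ 1) (r : ι → ℤ) (hr : r ∈ L) (R : ℚ) (hR : ∀ j, |(r j : ℚ)| ≤ R)
    (s : Finset (Fin k)) (hs : R + s.card * B ≤ b) :
    f (r + ∑ i ∈ s, e i • V i) = f r + ∑ i ∈ s, e i • f (V i) ∧ (r + ∑ i ∈ s, e i • V i) ∈ L ∧
      ∀ j, |((r + ∑ i ∈ s, e i • V i) j : ℚ)| ≤ R + s.card * B := by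
  classical
  have hf0 : f 0 = 0 := by
    have := hf 0 L.zero_mem 0 L.zero_mem (by simpa using fun _ => hb) (by simpa using fun _ => hb) (by simpa using fun _ => hb)
    rw [add_zero] at this
    exact left_eq_add.1 this
  have hneg : ∀ i, f (-V i) = - f (V i) := by
    intro i
    have := hf (V i) (hV i) (-V i) (L.neg_mem (hV i)) (fun j => (hVB i j).trans hkB)
      (fun j => by simpa using (hVB i j).trans hkB) (by simpa using fun _ => hb)
    rw [add_neg_cancel, hf0] at this
    exact (neg_eq_of_add_eq_zero_right this.symm).symm
  have hsm : ∀ i, f (e i • V i) = e i • f (V i) := by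
    intro i
    have := abs_le.1 (he i)
    have h3 : e i = -1 ∨ e i = 0 ∨ e i = 1 := by omega
    rcases h3 with h | h | h <;> rw [h] <;> simp [hf0, hneg]
  have hsB : ∀ i j, |((e i • V i) j : ℚ)| ≤ B := by
    intro i j
    rw [Pi.smul_apply, smul_eq_mul]; push_cast; rw [abs_mul]
    have h1 : |(e i : ℚ)| ≤ 1 := by exact_mod_cast he i
    calc _ ≤ 1 * |(V i j : ℚ)| := by gcongr
      _ ≤ B := by rw [one_mul]; exact hVB i j
  induction s using Finset.induction_on with
  | empty => simpa using ⟨hr, hR⟩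
  | insert a s ha ih =>
    rw [Finset.card_insert_of_notMem ha] at hs ⊢
    push_cast at hs ⊢
    obtain ⟨i1, i2, i3⟩ := ih (by linarith)
    rw [Finset.sum_insert ha, Finset.sum_insert ha]
    have h0 : r + (e a • V a + ∑ x ∈ s, e x • V x) = (r + ∑ x ∈ s, e x • V x) + e a • V a := by abel
    have h3 : ∀ j, |(((r + ∑ x ∈ s, e x • V x) + e a • V a) j : ℚ)| ≤ R + ((s.card : ℚ) + 1) * B := by
      intro j
      rw [Pi.add_apply]; push_cast
      have h4 := abs_add_le ((((r + ∑ x ∈ s, e x • V x) j : ℤ)) : ℚ) ((e a • V a) j : ℤ)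
      have h5 := i3 j
      have h6 := hsB a j
      linarith
    have h2 : e a • V a ∈ L := L.smul_mem _ (hV a)
    rw [h0]
    refine ⟨?_, L.add_mem i2 h2, h3⟩
    rw [hf _ i2 _ h2 (fun j => (i3 j).trans (by linarith)) (fun j => (hsB a j).trans hkB) (fun j => (h3 j).trans hs), i1, hsm]
    abel

lemma ext_lemma (L : Submodule ℤ (ι → ℤ)) (f : (ι → ℤ) → M) (b : ℚ) (hb : 0 ≤ b)
    (hf : ∀ y ∈ L, ∀ y' ∈ L, (∀ i, |(y i : ℚ)| ≤ b) → (∀ i, |(y' i : ℚ)| ≤ b) → (∀ i, |((y + y') i : ℚ)| ≤ b) → f (y + y') = f y + f y') :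
    ∃ F : L →+ M, ∀ y : L, (∀ i, |(y.1 i : ℚ)| * (2 * Fintype.card ι + 2) ≤ b) → F y = f y := by
  classical
  set n := Fintype.card ι with hn
  set B : ℚ := b / (2 * n + 2) with hBdef
  have hn2 : (0:ℚ) < 2 * n + 2 := by positivity
  have hB : 0 ≤ B := by positivity
  have hBb : (2 * n + 2) * B = b := by rw [hBdef]; field_simp
  have hBb' : B ≤ b := by nlinarith [mul_nonneg (Nat.cast_nonneg (α := ℚ) n) hB]
  let Z : Set (ι → ℤ) := {y | y ∈ L ∧ ∀ i, |(y i : ℚ)| ≤ B}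
  have hZfin : Z.Finite := by
    refine (Set.finite_Icc (fun _ : ι => -⌈B⌉) (fun _ => ⌈B⌉)).subset ?_
    rintro y ⟨-, hy⟩
    refine ⟨fun i => ?_, fun i => ?_⟩
    · have h1 := (abs_le.1 (hy i)).1
      have h2 := Int.le_ceil B
      have h3 : (-(⌈B⌉ : ℚ)) ≤ y i := by linarith
      exact_mod_cast h3
    · have h1 := (abs_le.1 (hy i)).2
      have h2 := Int.le_ceil B
      have h3 : (y i : ℚ) ≤ ⌈B⌉ := by linarith
      exact_mod_cast h3
  obtain ⟨k, v, φ, hk, hvZ, hφv, hφZ⟩ := spanner (castQ '' Z) (hZfin.image castQ)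
  rw [Module.finrank_fintype_fun_eq_card, ← hn] at hk
  choose V hVZ hVv using hvZ
  have hkq : (k : ℚ) ≤ n := by exact_mod_cast hk
  let C : Fin k → (ι → ℤ) → ℚ := fun i y => φ i (castQ y)
  have hCadd : ∀ i y y', C i (y + y') = C i y + C i y' := by
    intro i y y'; simp [C]
  let rem : (ι → ℤ) → (ι → ℤ) := fun y => y - ∑ i, ⌊C i y⌋ • V i
  let Q : (ι → ℤ) →ₗ[ℤ] (ι → ℚ) := castQ - (∑ i, (LinearMap.toSpanSingleton ℚ (ι → ℚ) (v i)).comp (φ i)).restrictScalars ℤ ∘ₗ castQ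
  have hQ : ∀ y, Q y = castQ y - ∑ i, C i y • v i := by
    intro y
    simp [Q, C]
  have hremL : ∀ y ∈ L, rem y ∈ L := fun y hy => L.sub_mem hy (L.sum_mem fun i _ => L.smul_mem _ (hVZ i).1)
  have hremB : ∀ y, Q y = 0 → ∀ j, |(rem y j : ℚ)| ≤ k * B := by
    intro y hy j
    rw [hQ, sub_eq_zero] at hy
    have h1 : (y j : ℚ) = ∑ i, C i y * (V i j : ℚ) := by
      have := congrFun hy j
      rw [Finset.sum_apply] at this
      rw [show (y j : ℚ) = castQ y j from rfl, this]
      refine Finset.sum_congr rfl fun i _ => ?_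
      rw [Pi.smul_apply, smul_eq_mul, ← hVv]; rfl
    have h2 : (rem y j : ℚ) = ∑ i, Int.fract (C i y) * (V i j : ℚ) := by
      simp only [rem, Pi.sub_apply, Finset.sum_apply, Pi.smul_apply, smul_eq_mul]
      push_cast
      rw [h1, ← Finset.sum_sub_distrib]
      refine Finset.sum_congr rfl fun i _ => ?_
      rw [Int.fract]; ring
    rw [h2]
    calc _ ≤ ∑ i, |Int.fract (C i y) * (V i j : ℚ)| := Finset.abs_sum_le_sum_abs _ _
      _ ≤ ∑ i : Fin k, B := by
        refine Finset.sum_le_sum fun i _ => ?_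
        rw [abs_mul, abs_of_nonneg (Int.fract_nonneg _)]
        calc _ ≤ 1 * |(V i j : ℚ)| := by gcongr; exact (Int.fract_lt_one _).le
          _ ≤ B := by rw [one_mul]; exact (hVZ i).2 j
      _ = k * B := by simp
  have help := fun (e : Fin k → ℤ) (he : ∀ i, |e i| ≤ 1) (r : ι → ℤ) (hr : r ∈ L) (hR : ∀ j, |(r j : ℚ)| ≤ k * B) =>
    ext_helper L f b B hb hB hf V (fun i => (hVZ i).1) (fun i => (hVZ i).2) hBb' e he r hr (k * B) hR Finset.univ
      (by simp only [Finset.card_univ, Fintype.card_fin]; nlinarith)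
  let F' : (ι → ℤ) → M := fun y => ∑ i, ⌊C i y⌋ • f (V i) + f (rem y)
  have hF'add : ∀ y ∈ L, ∀ y' ∈ L, Q y = 0 → Q y' = 0 → F' (y + y') = F' y + F' y' := by
    intro y hy y' hy' hQy hQy'
    have hQs : Q (y + y') = 0 := by rw [map_add, hQy, hQy', add_zero]
    let e : Fin k → ℤ := fun i => ⌊C i (y + y')⌋ - ⌊C i y⌋ - ⌊C i y'⌋
    have he : ∀ i, |e i| ≤ 1 := by
      intro i
      have h1 := Int.le_floor_add (C i y) (C i y')
      have h2 := Int.le_floor_add_floor (C i y) (C i y')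
      rw [← hCadd] at h1 h2
      rw [abs_le]; simp only [e]; constructor <;> omega
    obtain ⟨h1, h2, h3⟩ := help e he (rem (y + y')) (hremL _ (L.add_mem hy hy')) (hremB _ hQs)
    have h4 : rem (y + y') + ∑ i, e i • V i = rem y + rem y' := by
      simp only [rem, e, sub_smul, Finset.sum_sub_distrib]; abel
    rw [h4] at h1 h3
    have h5 : ∀ z, Q z = 0 → ∀ j, |(rem z j : ℚ)| ≤ b := fun z hz j => (hremB z hz j).trans (by nlinarith)
    rw [hf _ (hremL y hy) _ (hremL y' hy') (h5 y hQy) (h5 y' hQy') (fun j => (h3 j).trans (by simp only [Finset.card_univ, Fintype.card_fin]; nlinarith))] at h1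
    have h6 : ∑ i, e i • f (V i) = ∑ i, ⌊C i (y + y')⌋ • f (V i) - ∑ i, ⌊C i y⌋ • f (V i) - ∑ i, ⌊C i y'⌋ • f (V i) := by
      simp only [e, sub_smul, Finset.sum_sub_distrib]
    rw [h6] at h1
    simp only [F']
    have h7 : f (rem (y + y')) = f (rem y) + f (rem y') - (∑ i, ⌊C i (y + y')⌋ • f (V i) - ∑ i, ⌊C i y⌋ • f (V i) - ∑ i, ⌊C i y'⌋ • f (V i)) := by
      rw [h1]; abel
    rw [h7]; abel
  have hF'Z : ∀ y ∈ Z, Q y = 0 ∧ F' y = f y := by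
    intro y hy
    obtain ⟨h1, h2⟩ := hφZ (castQ y) ⟨y, hy, rfl⟩
    have hQy : Q y = 0 := by rw [hQ, sub_eq_zero]; exact h2
    refine ⟨hQy, ?_⟩
    have he : ∀ i, |⌊C i y⌋| ≤ 1 := by
      intro i
      have h3 := abs_le.1 (h1 i)
      rw [abs_le]
      constructor
      · rw [Int.le_floor]; push_cast; exact h3.1
      · have : ⌊C i y⌋ ≤ ⌊(1:ℚ)⌋ := Int.floor_le_floor h3.2
        simpa using this
    obtain ⟨h4, -, -⟩ := help (fun i => ⌊C i y⌋) he (rem y) (hremL y hy.1) (hremB y hQy)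
    have h5 : rem y + ∑ i, ⌊C i y⌋ • V i = y := by simp [rem]
    rw [h5] at h4
    rw [h4]; simp only [F']; rw [add_comm]
  let QL : L →ₗ[ℤ] (ι → ℚ) := Q ∘ₗ L.subtype
  haveI : Module.Finite ℤ (LinearMap.range QL) := inferInstance
  haveI : Module.Free ℤ (LinearMap.range QL) := Module.free_of_finite_type_torsion_free'
  obtain ⟨σ, hσ⟩ := Module.projective_lifting_property QL.rangeRestrict LinearMap.id QL.surjective_rangeRestrict
  have hσ' : ∀ y : L, Q (y - σ (QL.rangeRestrict y) : L).1 = 0 := by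
    intro y
    have h1 := LinearMap.congr_fun hσ (QL.rangeRestrict y)
    have h2 := congrArg Subtype.val h1
    have h3 : Q (σ (QL.rangeRestrict y)).1 = Q y.1 := h2
    rw [Submodule.coe_sub, map_sub, h3, sub_self]
  refine ⟨AddMonoidHom.mk' (fun y => F' (y - σ (QL.rangeRestrict y) : L).1) ?_, ?_⟩
  · intro y y'
    rw [← hF'add _ (Subtype.mem _) _ (Subtype.mem _) (hσ' y) (hσ' y')]
    congr 1
    rw [map_add, map_add, ← Submodule.coe_add]
    congr 1; abel
  · intro y hy
    have hyZ : y.1 ∈ Z := ⟨y.2, fun i => by rw [hBdef, le_div_iff₀ hn2]; exact hy i⟩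
    obtain ⟨h1, h2⟩ := hF'Z _ hyZ
    have h3 : QL.rangeRestrict y = 0 := Subtype.ext h1
    show F' (y - σ (QL.rangeRestrict y) : L).1 = _
    rw [h3, map_zero, sub_zero, h2]
end EXT

section ORD
variable {p d N : ℕ} [Fact p.Prime]

lemma card_VV : Fintype.card (VV p d) = p ^ d := by
  rw [Fintype.card_pi]; simp [ZMod.card]

lemma dens_card (H : Finset (VV p d)) : dens (fun a => a ∈ H) = (H.card : ℝ) / (p : ℝ) ^ d := by
  classical
  rw [dens_eq, card_VV, Finset.filter_univ_mem]; push_cast; rfl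

lemma fract_val (r h : VV p d) :
    Int.fract (∑ j : Fin d, ((((r j).val : ℤ) : ℝ) / (p : ℝ)) * (((h j).val : ℕ) : ℝ)) = ((r ⬝ᵥ h).val : ℝ) / p := by
  have hp0 : (0:ℝ) < p := by exact_mod_cast (Fact.out : p.Prime).pos
  set Z : ℤ := ∑ j, ((r j).val : ℤ) * ((h j).val : ℤ) with hZ
  have h1 : (∑ j : Fin d, ((((r j).val : ℤ) : ℝ) / (p : ℝ)) * (((h j).val : ℕ) : ℝ)) = (Z : ℝ) / p := by
    rw [hZ]; push_cast; rw [Finset.sum_div]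
    exact Finset.sum_congr rfl fun j _ => by ring
  have h2 : ((Z : ℤ) : ZMod p) = r ⬝ᵥ h := by
    rw [hZ, dotProduct]; push_cast
    exact Finset.sum_congr rfl fun j _ => by rw [ZMod.natCast_zmod_val, ZMod.natCast_zmod_val]
  have h3 : ((r ⬝ᵥ h).val : ℤ) = Z % p := by rw [← h2, ZMod.val_intCast]
  rw [h1, Int.fract_eq_iff]
  refine ⟨by positivity, ?_, Z / p, ?_⟩
  · rw [div_lt_one hp0]; exact_mod_cast ZMod.val_lt _
  · have h4 : (Z : ℝ) = p * ((Z / p : ℤ) : ℝ) + ((r ⬝ᵥ h).val : ℝ) := by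
      have : Z = p * (Z / p) + ((r ⬝ᵥ h).val : ℤ) := by rw [h3]; exact (Int.mul_ediv_add_emod Z p).symm
      exact_mod_cast this
    field_simp; linarith

lemma alf_build {ι : Type*} [Fintype ι] (rr : ι → VV p d) (K : ℕ) (hK : Fintype.card ι ≤ K) (β : ι → ℤ) :
    ∃ (α : Fin K → Fin d → ℤ) (β' : Fin K → ℤ), ∀ h : VV p d,
      alfAux p d K α β' h = (∑ i, ((rr i ⬝ᵥ h).val : ℝ) * β i) / p / p := by
  classical
  let em : ι → Fin K := fun i => Fin.castLE hK (Fintype.equivFin ι i)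
  have hem : Function.Injective em := fun i j h => (Fintype.equivFin ι).injective (Fin.castLE_injective hK h)
  refine ⟨Function.extend em (fun i j => ((rr i j).val : ℤ)) 0, Function.extend em β 0, fun h => ?_⟩
  unfold alfAux
  rw [Finset.sum_div, Finset.sum_div]
  symm
  refine Fintype.sum_of_injective em hem _ _ ?_ ?_
  · intro i hi
    rw [Function.extend_apply' _ _ _ (by simpa using hi)]
    simp
  · intro i
    rw [hem.extend_apply, hem.extend_apply, fract_val]
    ring

lemma ord1 (ε : ℝ) (hε : 0 < ε) (hε1 : ε ≤ 1) : ∃ (c : ℝ) (p0 : ℕ), 0 < c ∧ c ≤ 1 ∧ ∀ (p d N : ℕ) [Fact p.Prime], p0 ≤ p →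
    ∀ (x : VV p d → VV p N) (T : VV p d → VV p N) (E : VV p d → VV p d → Prop),
      (∀ a t, E a t → x (a + t) - x a = T t) → ε ≤ dens (fun z : VV p d × VV p d => E z.1 z.2) →
      ∃ H : VV p d → Prop, c ≤ dens H ∧ (∀ a, H a → ∃ t, E a t) ∧
        ∀ a a' : Fin 6 → VV p d, (∀ i, H (a i)) → (∀ i, H (a' i)) → ∑ i, a i = ∑ i, a' i →
          ∑ i, x (a i) = ∑ i, x (a' i) := by
  classical
  set c0 : ℝ := ε / 4 * (ε ^ 2 / 16) ^ 2 with hc0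
  have hc0' : 0 < c0 := by positivity
  set K : ℕ := ⌈4 / (ε * c0)⌉₊ with hK
  have hKr : 4 / (ε * c0) ≤ K := Nat.le_ceil _
  have hKpos : 1 ≤ K := by
    have : (0:ℝ) < K := lt_of_lt_of_le (by positivity) hKr
    exact_mod_cast this
  have hSb : 1 ≤ K ^ 13 := Nat.one_le_pow _ _ hKpos
  have hSbr : (1:ℝ) ≤ (24 * K ^ 13 : ℕ) := by exact_mod_cast (by omega : 1 ≤ 24 * K ^ 13)
  refine ⟨ε / 4 / (24 * K ^ 13 : ℕ), 2 * K ^ 13 + 1, by positivity, ?_, ?_⟩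
  · rw [div_le_one (by positivity)]; linarith
  intro p d N _ hp x T E hE hεE
  have hp0 : (0:ℝ) < p := by exact_mod_cast (Fact.out : p.Prime).pos
  have hG : ε ≤ dens (fun z : VV p d × VV p d => (fun a b => E a (b - a)) z.1 z.2) := by
    refine hεE.trans (le_of_eq ?_)
    exact (dens_equiv (Equiv.prodShear (Equiv.refl (VV p d)) (fun a => Equiv.subRight a)) (fun z : VV p d × VV p d => E z.1 z.2)).symm
  have hEG : ∀ a b, E a (b - a) → x b - x a = T (b - a) := by
    intro a b h
    have := hE _ _ h
    rwa [add_sub_cancel] at this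
  obtain ⟨A', hA', hAE, hA4⟩ := bsg (fun a b => E a (b - a)) ε hε hG
  let Af : Finset (VV p d) := Finset.univ.filter A'
  have hmem : ∀ a, a ∈ Af ↔ A' a := fun a => by simp [Af]
  have hdA : ε / 4 ≤ dens (fun a => a ∈ Af) := hA'.trans (dens_mono fun a h => (hmem a).2 h)
  have hcardA : ε / 4 * (p : ℝ) ^ d ≤ Af.card := by
    rw [dens_card, le_div_iff₀ (by positivity)] at hdA; exact hdA
  have hne : Af.Nonempty := by
    rw [← Finset.card_pos]
    have : (0:ℝ) < Af.card := lt_of_lt_of_le (by positivity) hcardA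
    exact_mod_cast this
  have hfd := few_diff x T Af c0 (by
    intro a a' ha ha'
    refine (hA4 a a' ((hmem a).1 ha) ((hmem a').1 ha')).trans (dens_mono fun z hz => ?_)
    exact ⟨hEG _ _ hz.1, hEG _ _ hz.2.1, hEG _ _ hz.2.2.1, hEG _ _ hz.2.2.2⟩)
  rw [card_VV] at hfd
  have hΓ : (Af.image fun a => (a, x a)).card = Af.card :=
    Finset.card_image_of_injective _ fun a b h => congrArg Prod.fst h
  have hfb := fibre_bdd x Af hne K (by
    simp only
    rw [hΓ]
    push_cast at hfd
    have h1 : (4 / (ε * c0)) * (ε / 4 * (p : ℝ) ^ d) ≤ K * Af.card := by gcongr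
    have h2 : (4 / (ε * c0)) * (ε / 4 * (p : ℝ) ^ d) = (p : ℝ) ^ d / c0 := by field_simp
    rw [h2] at h1
    refine le_trans ?_ h1
    rw [le_div_iff₀ hc0', mul_comm]; exact hfd)
  obtain ⟨H, hH1, hH2, hH3⟩ := freiman12 x Af (K ^ 13) hSb (by omega) (by exact_mod_cast hfb)
  refine ⟨H, le_trans ?_ hH2, fun a ha => ?_, hH3⟩
  · gcongr
  · obtain ⟨b, hb⟩ := hAE a ((hmem a).1 (hH1 a ha))
    exact ⟨_, hb⟩
end ORD

section ORD2
variable {p d N : ℕ} [Fact p.Prime]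

def IsRep (H : VV p d → Prop) (x : VV p d → VV p N) (v : VV p d) (w : VV p N) : Prop :=
  ∃ a b c e, H a ∧ H b ∧ H c ∧ H e ∧ v = a + b - c - e ∧ w = x a + x b - x c - x e

lemma rep_add {H : VV p d → Prop} {x : VV p d → VV p N}
    (hF : ∀ a a' : Fin 6 → VV p d, (∀ i, H (a i)) → (∀ i, H (a' i)) → ∑ i, a i = ∑ i, a' i → ∑ i, x (a i) = ∑ i, x (a' i))
    {v v' : VV p d} {w w' w'' : VV p N} (h : IsRep H x v w) (h' : IsRep H x v' w') (h'' : IsRep H x (v + v') w'') :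
    w'' = w + w' := by
  obtain ⟨a, b, c, e, ha, hb, hc, he, hv, hw⟩ := h
  obtain ⟨a', b', c', e', ha', hb', hc', he', hv', hw'⟩ := h'
  obtain ⟨a'', b'', c'', e'', ha'', hb'', hc'', he'', hv'', hw''⟩ := h''
  have := hF ![a, b, a', b', c'', e''] ![c, e, c', e', a'', b'']
    (by intro i; fin_cases i <;> assumption) (by intro i; fin_cases i <;> assumption)
    (by
      rw [hv, hv'] at hv''
      simp only [Fin.sum_univ_six, Matrix.cons_val]
      have h1 : a + b + a' + b' + c'' + e'' = (a + b - c - e + (a' + b' - c' - e')) + c'' + e'' + c + e + c' + e' := by abel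
      rw [h1, hv'']; abel)
  simp only [Fin.sum_univ_six, Matrix.cons_val] at this
  rw [hw, hw', hw'']
  have h2 : x a'' + x b'' - x c'' - x e'' = (x c + x e + x c' + x e' + x a'' + x b'') - x c - x e - x c' - x e' - x c'' - x e'' := by abel
  rw [h2, ← this]; abel

lemma rep_unique {H : VV p d → Prop} {x : VV p d → VV p N}
    (hF : ∀ a a' : Fin 6 → VV p d, (∀ i, H (a i)) → (∀ i, H (a' i)) → ∑ i, a i = ∑ i, a' i → ∑ i, x (a i) = ∑ i, x (a' i))
    {v : VV p d} {w w' : VV p N} (h : IsRep H x v w) (h' : IsRep H x v w') : w' = w := by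
  obtain ⟨a, b, c, e, ha, hb, hc, he, hv, hw⟩ := id h
  have h0 : IsRep H x 0 0 := ⟨a, a, a, a, ha, ha, ha, ha, by abel, by abel⟩
  have := rep_add hF h h0 (w'' := w') (by rw [add_zero]; exact h')
  rwa [add_zero] at this

def rrf (Λ : Finset (VV p d)) : Λ ⊕ Fin d → VV p d := Sum.elim (fun r => r.1) (fun j => Pi.single j 1)

def vvf (Λ : Finset (VV p d)) (y : Λ ⊕ Fin d → ℤ) : VV p d := fun j => (y (Sum.inr j) : ZMod p)

def LatS (Λ : Finset (VV p d)) : Submodule ℤ (Λ ⊕ Fin d → ℤ) where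
  carrier := {y | ∀ i, (y i : ZMod p) = rrf Λ i ⬝ᵥ vvf Λ y}
  add_mem' {y z} hy hz i := by
    have : vvf Λ (y + z) = vvf Λ y + vvf Λ z := by ext j; simp [vvf]
    rw [this, dotProduct_add, ← hy, ← hz]; simp
  zero_mem' i := by
    have : vvf Λ 0 = 0 := by ext j; simp [vvf]
    rw [this]; simp
  smul_mem' c y hy i := by
    have : vvf Λ (c • y) = (c : ZMod p) • vvf Λ y := by ext j; simp [vvf]
    rw [this, dotProduct_smul, ← hy]; simp

def ypl (Λ : Finset (VV p d)) (h : VV p d) : Λ ⊕ Fin d → ℤ := fun i => ((rrf Λ i ⬝ᵥ h).val : ℤ)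

lemma vvf_ypl (Λ : Finset (VV p d)) (h : VV p d) : vvf Λ (ypl Λ h) = h := by
  ext j
  simp [vvf, ypl, rrf]

lemma ypl_mem (Λ : Finset (VV p d)) (h : VV p d) : ypl Λ h ∈ LatS Λ := by
  intro i
  rw [vvf_ypl]
  simp [ypl]

lemma vvf_sub (Λ : Finset (VV p d)) (y z : Λ ⊕ Fin d → ℤ) : vvf Λ (y - z) = vvf Λ y - vvf Λ z := by
  ext j; simp [vvf]
lemma vvf_add (Λ : Finset (VV p d)) (y z : Λ ⊕ Fin d → ℤ) : vvf Λ (y + z) = vvf Λ y + vvf Λ z := by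
  ext j; simp [vvf]

open Classical in
lemma pe_mem (Λ : Finset (VV p d)) (i : Λ ⊕ Fin d) : (Pi.single i (p : ℤ) : Λ ⊕ Fin d → ℤ) ∈ LatS Λ := by
  intro k
  have : vvf Λ (Pi.single i (p : ℤ)) = 0 := by
    ext j
    simp only [vvf, Pi.single_apply]
    split_ifs <;> simp
  rw [this, dotProduct_zero, Pi.single_apply]
  split_ifs <;> simp

/-- coordinate functions of a homomorphism on the lattice are almost linear -/
lemma lat_alf (Λ : Finset (VV p d)) (F : LatS Λ →+ VV p N) (K m : ℕ) (hm : 2 < m)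
    (hK : Fintype.card (Λ ⊕ Fin d) ≤ K) (H' : Finset (VV p d))
    (hcell : ∀ h ∈ H', ∀ h' ∈ H', ∀ i, |ypl Λ h i - ypl Λ h' i| * m ≤ p) (j : Fin N) :
    IsALFHom p d K (H' : Set (VV p d)) (fun h => F ⟨ypl Λ h, ypl_mem Λ h⟩ j) := by
  classical
  have hp0 : 0 < p := (Fact.out : p.Prime).pos
  have hpr : (p : ℝ) ≠ 0 := by positivity
  haveI : Module.Free ℤ (LatS Λ) := inferInstance
  obtain ⟨Ψ, hΨ⟩ := Module.projective_lifting_property (Int.castAddHom (ZMod p)).toIntLinearMap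
    ((Pi.evalAddMonoidHom (fun _ : Fin N => ZMod p) j).comp F).toIntLinearMap (ZMod.intCast_surjective)
  have hΨ' : ∀ y, ((Ψ y : ℤ) : ZMod p) = F y j := fun y => LinearMap.congr_fun hΨ y
  obtain ⟨α, β', hab⟩ := alf_build (rrf Λ) K hK (fun i => Ψ ⟨_, pe_mem Λ i⟩)
  have key : ∀ h, (p : ℝ) * alfAux p d K α β' h = (Ψ ⟨ypl Λ h, ypl_mem Λ h⟩ : ℝ) := by
    intro h
    have h1 : (p : ℤ) • (⟨ypl Λ h, ypl_mem Λ h⟩ : LatS Λ) = ∑ i, ypl Λ h i • (⟨_, pe_mem Λ i⟩ : LatS Λ) := by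
      apply Subtype.ext
      rw [Submodule.coe_smul, Submodule.coe_sum]
      ext k
      simp only [Submodule.coe_smul, Finset.sum_apply, Pi.smul_apply, smul_eq_mul, Pi.single_apply]
      simp [mul_comm]
    have h2 := congrArg Ψ h1
    rw [map_smul, map_sum] at h2
    simp only [map_smul, smul_eq_mul] at h2
    have h3 : (p : ℝ) * (Ψ ⟨ypl Λ h, ypl_mem Λ h⟩ : ℝ) = ∑ i, ((rrf Λ i ⬝ᵥ h).val : ℝ) * (Ψ ⟨_, pe_mem Λ i⟩ : ℝ) := by
      have := congrArg (fun z : ℤ => (z : ℝ)) h2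
      push_cast at this
      rw [this]
      simp [ypl]
    rw [hab, ← h3]; field_simp
  refine ⟨α, β', fun h _ => ⟨_, key h, (hΨ' _).symm⟩, ?_⟩
  intro h₁ hh₁ h₂ hh₂ h₃ hh₃ h₄ hh₄ hsum
  refine ⟨0, ?_⟩
  have hz : ypl Λ h₁ + ypl Λ h₂ - ypl Λ h₃ - ypl Λ h₄ = 0 := by
    ext i
    have hdvd : (p : ℤ) ∣ (ypl Λ h₁ + ypl Λ h₂ - ypl Λ h₃ - ypl Λ h₄) i := by
      rw [← ZMod.intCast_zmod_eq_zero_iff_dvd]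
      simp only [Pi.sub_apply, Pi.add_apply, ypl]
      push_cast
      simp only [ZMod.natCast_zmod_val]
      rw [← dotProduct_add, hsum, dotProduct_add]; abel
    refine Int.eq_zero_of_abs_lt_dvd hdvd ?_
    have h1 := hcell _ hh₁ _ hh₃ i
    have h2 := hcell _ hh₂ _ hh₄ i
    have h3 : (ypl Λ h₁ + ypl Λ h₂ - ypl Λ h₃ - ypl Λ h₄) i = (ypl Λ h₁ i - ypl Λ h₃ i) + (ypl Λ h₂ i - ypl Λ h₄ i) := by
      simp only [Pi.sub_apply, Pi.add_apply]; ring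
    rw [h3]
    have h4 := abs_add_le (ypl Λ h₁ i - ypl Λ h₃ i) (ypl Λ h₂ i - ypl Λ h₄ i)
    have hm' : (3:ℤ) ≤ m := by exact_mod_cast hm
    have hpz : (0:ℤ) < p := by exact_mod_cast hp0
    have a1 := abs_nonneg (ypl Λ h₁ i - ypl Λ h₃ i)
    have a2 := abs_nonneg (ypl Λ h₂ i - ypl Λ h₄ i)
    nlinarith
  have hz' : Ψ ⟨ypl Λ h₁, ypl_mem Λ h₁⟩ + Ψ ⟨ypl Λ h₂, ypl_mem Λ h₂⟩ - Ψ ⟨ypl Λ h₃, ypl_mem Λ h₃⟩ - Ψ ⟨ypl Λ h₄, ypl_mem Λ h₄⟩ = 0 := by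
    rw [← map_add, ← map_sub, ← map_sub, ← map_zero Ψ]
    congr 1
    exact Subtype.ext hz
  have hz2 := congrArg (fun z : ℤ => (z : ℝ)) hz'
  push_cast at hz2
  rw [← key, ← key, ← key, ← key] at hz2
  have : (p : ℝ) * (alfAux p d K α β' h₁ + alfAux p d K α β' h₂ - alfAux p d K α β' h₃ - alfAux p d K α β' h₄) = 0 := by linarith
  rcases mul_eq_zero.1 this with h | h
  · exact absurd h hpr
  · rw [h]; simp

end ORD2

lemma ord2 (δ : ℝ) (hδ : 0 < δ) (hδ1 : δ ≤ 1) (d : ℕ) : ∃ (K : ℕ) (c : ℝ), 0 < c ∧ ∀ (p N : ℕ) [Fact p.Prime]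
    (x : VV p d → VV p N) (H : VV p d → Prop), δ ≤ dens H →
    (∀ a a' : Fin 6 → VV p d, (∀ i, H (a i)) → (∀ i, H (a' i)) → ∑ i, a i = ∑ i, a' i → ∑ i, x (a i) = ∑ i, x (a' i)) →
    ∃ H' : Finset (VV p d), c * (p : ℝ) ^ d ≤ H'.card ∧ (∀ h ∈ H', H h) ∧ ∃ (Tt : VV p d → VV p N) (g : VV p N),
      (∀ h ∈ H', x h = Tt h + g) ∧ ∀ j, IsALFHom p d K (H' : Set (VV p d)) (fun h => Tt h j) := by
  classical
  set K : ℕ := ⌈2 / δ ^ 3⌉₊ + d with hK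
  set m : ℕ := 4 * (2 * K + 2) with hm
  haveI : NeZero m := ⟨by omega⟩
  have hmpos : (1:ℝ) ≤ m := by exact_mod_cast (by omega : 1 ≤ m)
  refine ⟨K, δ / (m : ℝ) ^ K, by positivity, ?_⟩
  intro p N _ x H hH hF
  have hp0 : 0 < p := (Fact.out : p.Prime).pos
  have hpr : (0:ℝ) < p := by exact_mod_cast hp0
  let Hf : Finset (VV p d) := Finset.univ.filter H
  have hmem : ∀ a, a ∈ Hf ↔ H a := fun a => by simp [Hf]
  have hHf : δ * (p : ℝ) ^ d ≤ Hf.card := by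
    have : δ ≤ dens (fun a => a ∈ Hf) := hH.trans (dens_mono fun a h => (hmem a).2 h)
    rwa [dens_card, le_div_iff₀ (by positivity)] at this
  obtain ⟨Λ, hΛ, hB⟩ := bogol Hf δ hδ hδ1 hHf
  have hcard : Fintype.card (Λ ⊕ Fin d) ≤ K := by
    rw [Fintype.card_sum, Fintype.card_coe, Fintype.card_fin, hK]
    have : Λ.card ≤ ⌈2 / δ ^ 3⌉₊ := by
      have := hΛ.trans (Nat.le_ceil _); exact_mod_cast this
    omega
  have hrep : ∀ v, (∀ r ∈ Λ, ∃ y : ℤ, (y : ZMod p) = r ⬝ᵥ v ∧ 4 * |y| ≤ p) → ∃ w, IsRep H x v w := by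
    intro v hv
    obtain ⟨a, ha, b, hb, c, hc, e, he, h⟩ := hB v hv
    exact ⟨_, a, b, c, e, (hmem _).1 ha, (hmem _).1 hb, (hmem _).1 hc, (hmem _).1 he, h, rfl⟩
  let ψ : VV p d → VV p N := fun v => if h : ∃ w, IsRep H x v w then h.choose else 0
  have hψ : ∀ v, (∃ w, IsRep H x v w) → IsRep H x v (ψ v) := by
    intro v h
    simp only [ψ, dif_pos h]; exact h.choose_spec
  have hsmall : ∀ y ∈ LatS Λ, (∀ i, |(y i : ℚ)| ≤ (p : ℚ) / 4) → IsRep H x (vvf Λ y) (ψ (vvf Λ y)) := by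
    intro y hy hyb
    refine hψ _ (hrep _ fun r hr => ⟨y (Sum.inl ⟨r, hr⟩), hy (Sum.inl ⟨r, hr⟩), ?_⟩)
    have := hyb (Sum.inl ⟨r, hr⟩)
    have h2 : 4 * |(y (Sum.inl ⟨r, hr⟩) : ℚ)| ≤ p := by linarith
    exact_mod_cast h2
  obtain ⟨F, hFf⟩ := ext_lemma (LatS Λ) (fun y => ψ (vvf Λ y)) ((p : ℚ) / 4) (by positivity) (by
    intro y hy y' hy' hb hb' hbb
    have h3 := hsmall _ ((LatS Λ).add_mem hy hy') hbb
    show ψ (vvf Λ (y + y')) = ψ (vvf Λ y) + ψ (vvf Λ y')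
    rw [vvf_add] at h3 ⊢
    exact rep_add hF (hsmall y hy hb) (hsmall y' hy' hb') h3)
  obtain ⟨j, hj⟩ := pigeon H (fun h => fun i : Λ ⊕ Fin d => cell m p (rrf Λ i ⬝ᵥ h))
  let H' : Finset (VV p d) := Finset.univ.filter fun h => H h ∧ (fun i : Λ ⊕ Fin d => cell m p (rrf Λ i ⬝ᵥ h)) = j
  have hmem' : ∀ a, a ∈ H' ↔ (H a ∧ (fun i : Λ ⊕ Fin d => cell m p (rrf Λ i ⬝ᵥ a)) = j) := fun a => by simp [H']
  have hcell : ∀ h ∈ H', ∀ h' ∈ H', ∀ i, |ypl Λ h i - ypl Λ h' i| * m ≤ p := by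
    intro h hh h' hh' i
    exact cell_eq (congrFun (((hmem' _).1 hh).2.trans ((hmem' _).1 hh').2.symm) i)
  have hH'card : δ / (m : ℝ) ^ K * (p : ℝ) ^ d ≤ H'.card := by
    have h1 : δ / (m : ℝ) ^ K ≤ dens (fun a => a ∈ H') := by
      refine le_trans ?_ (hj.trans (dens_mono fun a h => (hmem' a).2 h))
      rw [Fintype.card_fun, Fintype.card_fin]
      push_cast
      calc δ / (m : ℝ) ^ K ≤ δ / (m : ℝ) ^ (Fintype.card (Λ ⊕ Fin d)) :=
            div_le_div_of_nonneg_left hδ.le (by positivity) (pow_le_pow_right₀ hmpos hcard)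
        _ ≤ _ := by gcongr
    rwa [dens_card, le_div_iff₀ (by positivity)] at h1
  have hne : H'.Nonempty := by
    rw [← Finset.card_pos]
    have : (0:ℝ) < H'.card := lt_of_lt_of_le (by positivity) hH'card
    exact_mod_cast this
  obtain ⟨h0, hh0⟩ := hne
  refine ⟨H', hH'card, fun h hh => ((hmem' h).1 hh).1, fun h => F ⟨ypl Λ h, ypl_mem Λ h⟩, x h0 - F ⟨ypl Λ h0, ypl_mem Λ h0⟩, ?_, ?_⟩
  · intro h hh
    have hb : ∀ i, |((ypl Λ h - ypl Λ h0) i : ℚ)| * (2 * Fintype.card (Λ ⊕ Fin d) + 2) ≤ (p : ℚ) / 4 := by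
      intro i
      have h1 := hcell h hh h0 hh0 i
      have h2 : |((ypl Λ h - ypl Λ h0) i : ℚ)| * (m : ℚ) ≤ p := by
        rw [Pi.sub_apply]; exact_mod_cast h1
      have h3 : (4:ℚ) * (2 * Fintype.card (Λ ⊕ Fin d) + 2) ≤ m := by
        have h3n : 4 * (2 * Fintype.card (Λ ⊕ Fin d) + 2) ≤ m := hm ▸ Nat.mul_le_mul_left 4 (by omega)
        calc (4:ℚ) * (2 * Fintype.card (Λ ⊕ Fin d) + 2) = ((4 * (2 * Fintype.card (Λ ⊕ Fin d) + 2) : ℕ) : ℚ) := by push_cast; ring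
          _ ≤ m := Nat.cast_le.2 h3n
      have h4 := abs_nonneg ((ypl Λ h - ypl Λ h0) i : ℚ)
      nlinarith
    have h5 := hFf ⟨ypl Λ h - ypl Λ h0, (LatS Λ).sub_mem (ypl_mem Λ h) (ypl_mem Λ h0)⟩ hb
    have h5s : (⟨ypl Λ h - ypl Λ h0, (LatS Λ).sub_mem (ypl_mem Λ h) (ypl_mem Λ h0)⟩ : LatS Λ) =
      ⟨ypl Λ h, ypl_mem Λ h⟩ - ⟨ypl Λ h0, ypl_mem Λ h0⟩ := rfl
    rw [h5s] at h5
    have h6 := hsmall _ ((LatS Λ).sub_mem (ypl_mem Λ h) (ypl_mem Λ h0)) (fun i => by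
      have h1 := hb i
      have h4 := abs_nonneg ((ypl Λ h - ypl Λ h0) i : ℚ)
      have h7 : (0:ℚ) ≤ Fintype.card (Λ ⊕ Fin d) := by positivity
      nlinarith)
    rw [map_sub] at h5
    have h5' : F ⟨ypl Λ h, ypl_mem Λ h⟩ - F ⟨ypl Λ h0, ypl_mem Λ h0⟩ = ψ (vvf Λ (ypl Λ h - ypl Λ h0)) := h5
    rw [vvf_sub, vvf_ypl, vvf_ypl] at h6 h5'
    have hHh := ((hmem' h).1 hh).1
    have hHh0 := ((hmem' h0).1 hh0).1
    have h8 : IsRep H x (h - h0) (x h - x h0) := ⟨h, h, h0, h, hHh, hHh, hHh0, hHh, by abel, by abel⟩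
    have h9 := rep_unique hF h6 h8
    rw [← h5'] at h9
    have : x h = x h - x h0 + x h0 := by abel
    rw [this, h9]; abel
  · exact fun j => lat_alf Λ F K m (by omega) hcard H' hcell j

lemma big (C η : ℝ) (hη : 0 < η) : ∃ p0 : ℕ, ∀ p : ℕ, p0 ≤ p → C / p ≤ η := by
  refine ⟨⌈C / η⌉₊ + 1, fun p hp => ?_⟩
  have h1 : C / η ≤ p := by
    have h2 := Nat.le_ceil (C / η)
    have h3 : ((⌈C / η⌉₊ + 1 : ℕ) : ℝ) ≤ p := by exact_mod_cast hp
    push_cast at h3; linarith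
  have hp0 : (0:ℝ) < p := by exact_mod_cast (by omega : 0 < p)
  rw [div_le_iff₀ hη] at h1
  rw [div_le_iff₀ hp0]; linarith

lemma core (s : ℕ) (ε0 : ℝ) (hε0 : 0 < ε0) (hε01 : ε0 ≤ 1) : ∃ (ε5 : ℝ) (p0 : ℕ), 0 < ε5 ∧ ε5 ≤ 1 ∧
    ∀ (p d : ℕ) [Fact p.Prime] (A : Matrix (Fin d) (Fin d) (ZMod p)), p0 ≤ p → Std p d s A →
    ∀ (ξ₁ ξ₂ ξ₃ ξ₄ : VV p d → Pol p d), (∀ a, (ξ₁ a).IsHomogeneous s) → (∀ a, (ξ₃ a).IsHomogeneous s) →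
    ∀ (UU : VV p d → VV p d → VV p d → Prop),
      (∀ k c a, UU k c a → ξ₁ a + ξ₂ c - ξ₃ (a + k) - ξ₄ (c - k) ∈ JJ A (sp {k} ⊔ sp {a} ⊔ sp {c})) →
      ε0 ≤ dens (fun x : VV p d × (VV p d × VV p d) => UU x.1 x.2.1 x.2.2) →
    ∃ X Tf : VV p d → Pol p d, (∀ a, (X a).IsHomogeneous s) ∧ (∀ a, (Tf a).IsHomogeneous s) ∧
      ε5 ≤ dens (fun z : VV p d × VV p d => ((∃ k c, UU k c z.1) ∧ X z.1 - ξ₁ z.1 ∈ JJ A (sp {z.1})) ∧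
        X (z.1 + z.2) - X z.1 - Tf z.2 ∈ JJ A ⊥) := by
  set ε1 := ε0 ^ (s+2) / 2 with hε1
  have pε1 : 0 < ε1 := by positivity
  have lε1 : ε1 ≤ 1 := by have := pow_le_one₀ hε0.le hε01 (n := s+2); linarith
  set ε2 := ε1 ^ ((s+2)*(s+2)) / 2 with hε2
  have pε2 : 0 < ε2 := by positivity
  have lε2 : ε2 ≤ 1 := by have := pow_le_one₀ pε1.le lε1 (n := (s+2)*(s+2)); linarith
  set L : ℝ := 8 / ε2 ^ 8 with hL
  have pL : 0 < L := by positivity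
  set ε3 := ε2 ^ 8 / 4 with hε3
  have pε3 : 0 < ε3 := by positivity
  have lε3 : ε3 ≤ 1 := by have := pow_le_one₀ pε2.le lε2 (n := 8); linarith
  set ε4 := ε3 ^ (s+2) / 2 with hε4
  have pε4 : 0 < ε4 := by positivity
  have lε4 : ε4 ≤ 1 := by have := pow_le_one₀ pε3.le lε3 (n := s+2); linarith
  set ε5 := ε4 ^ (s+2) / 2 with hε5
  have pε5 : 0 < ε5 := by positivity
  have lε5 : ε5 ≤ 1 := by have := pow_le_one₀ pε4.le lε4 (n := s+2); linarith
  obtain ⟨q1, hq1⟩ := big ((s:ℝ)+2+(s+2)^2) ε1 pε1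
  obtain ⟨q2, hq2⟩ := big (((s:ℝ)+2)^4 + 2 * (s+2) + L * (2 * (s+1) + 3)) ε2 pε2
  obtain ⟨q3, hq3⟩ := big 2 ε3 pε3
  obtain ⟨q4, hq4⟩ := big ((s:ℝ)+3+(s+2)^2) ε4 pε4
  obtain ⟨q5, hq5⟩ := big ((s:ℝ)+3+(s+2)^2 + (s+1)) ε5 pε5
  refine ⟨ε5, q1 + q2 + q3 + q4 + q5 + s + 2, pε5, lε5, ?_⟩
  intro p d _ A hp hA ξ₁ ξ₂ ξ₃ ξ₄ h1 h3 UU hU hUd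
  have b1 := hq1 p (by omega)
  have b2 := hq2 p (by omega)
  have b3 := hq3 p (by omega)
  have b4 := hq4 p (by omega)
  have b5 := hq5 p (by omega)
  obtain ⟨P, hP, hPd⟩ := step1 hA ξ₁ ξ₂ ξ₃ ξ₄ h1 h3 UU hU hε0.le hUd
  obtain ⟨X, hX, G', T, hG1, hG2, hG3⟩ := step2 hA ξ₁ ξ₃ P h1 h3 hP
    (fun a b => (∃ c, UU (b - a) c a) ∧ ξ₃ b - ξ₁ a - P (b - a) ∈ JJ A (sp {b - a} ⊔ sp {a})) (fun a b h => h.2)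
    pε1.le (le_trans (by linarith) hPd) L pL.le
  have hS3 := step3 hA X P hX G' T hG2
  set dG := dens (fun x : VV p d × VV p d => G' x.1 x.2) with hdG
  set dT := dens (fun x : VV p d × (VV p d × VV p d) => T x.1 x.2.1 x.2.2) with hdT
  have hdT0 : 0 ≤ dT := dens_nonneg _
  have hdG1 : dG ≤ 1 := dens_le_one _
  have e2 : ε2 ≤ dG - L * dT := by
    refine le_trans ?_ hG3
    have : (((s:ℝ)+2)^4 + 2 * (s+2) + L * (2 * (s+1) + 3)) / p = (((s:ℝ)+2)^4 + 2 * (s+2)) / p + L * ((2 * (s+1) + 3) / p) := by ring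
    linarith
  have hLT : L * dT ≤ 1 := by linarith
  have hGe : ε2 ≤ dG := by nlinarith [mul_nonneg pL.le hdT0]
  have hG8 : ε2 ^ 8 ≤ dG ^ 8 := pow_le_pow_left₀ pε2.le hGe 8
  have hT4 : 4 * dT ≤ ε2 ^ 8 / 2 := by
    rw [hL, div_mul_eq_mul_div, div_le_one (by positivity)] at hLT
    linarith
  have e3 : ε3 ≤ _ := le_trans (by linarith) hS3
  have e4 : ε4 ≤ ε3 ^ (s+2) - ((s:ℝ)+3+(s+2)^2)/p := by linarith
  obtain ⟨Cf, Tf, hC1, hC2, hTf, hfin⟩ := step4 hA (by omega) X hX (fun r a a' =>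
      X a - X a' - X (a + r) + X (a' + r) ∈ JJ A (sp {a - a'}) ∧
      X a - X a' - X (a + r) + X (a' + r) ∈ JJ A (sp {r}) ∧
      (∃ u, G' a u) ∧ (∃ u, G' a' u) ∧ (∃ u, G' (a + r) u) ∧ (∃ u, G' (a' + r) u))
    (fun r a a' h => ⟨h.1, h.2.1⟩) ε3 pε3.le e3 (pε4.le.trans e4)
  refine ⟨fun a => X a - Cf a, Tf, fun a => (hX a).sub (hC1 a), hTf, ?_⟩
  have e5 : ε5 ≤ (ε3 ^ (s+2) - ((s:ℝ)+3+(s+2)^2)/p) ^ (s+2) - ((s:ℝ)+3+(s+2)^2)/p - (s + 1 : ℝ)/p := by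
    have := pow_le_pow_left₀ pε4.le e4 (s+2)
    rw [add_div] at b5
    linarith
  refine (e5.trans hfin).trans ?_
  rw [← dens_equiv (Equiv.prodComm (VV p d) (VV p d))]
  refine dens_mono fun z hz => ?_
  obtain ⟨⟨r, h⟩, h'⟩ := hz
  obtain ⟨-, -, ⟨u, hu⟩, -⟩ := h
  obtain ⟨⟨⟨c, hc⟩, -⟩, hXx⟩ := hG1 _ _ hu
  refine ⟨⟨⟨_, c, hc⟩, ?_⟩, h'⟩
  have hXx' : X z.1 - ξ₁ z.1 ∈ JJ A (sp {z.1}) := hXx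
  have := sub_mem hXx' (hC2 z.1)
  convert this using 1
  ring

lemma ord_poly (s d : ℕ) (ε : ℝ) (hε : 0 < ε) (hε1 : ε ≤ 1) : ∃ (p0 K : ℕ) (c : ℝ), 0 < c ∧
    ∀ (p : ℕ) [Fact p.Prime] (A : Matrix (Fin d) (Fin d) (ZMod p)), p0 ≤ p →
    ∀ (X Tf : VV p d → Pol p d) (Q : VV p d → Prop), (∀ a, (X a).IsHomogeneous s) → (∀ a, (Tf a).IsHomogeneous s) →
      ε ≤ dens (fun z : VV p d × VV p d => Q z.1 ∧ X (z.1 + z.2) - X z.1 - Tf z.2 ∈ JJ A ⊥) →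
      ∃ H' : Finset (VV p d), c * (p : ℝ) ^ d ≤ H'.card ∧ (∀ h ∈ H', Q h) ∧
        ∃ g : Pol p d, g.IsHomogeneous s ∧ ∃ T : VV p d → Pol p d, (∀ h, (T h).IsHomogeneous s) ∧
          IsALFHomPoly p d s K (H' : Set (VV p d)) T ∧ ∀ h ∈ H', X h - T h - g ∈ JJ A ⊥ := by
  classical
  obtain ⟨c1, p0, hc1, hc1', h1⟩ := ord1 ε hε hε1
  obtain ⟨K, c, hc, h2⟩ := ord2 c1 hc1 hc1' d
  refine ⟨p0, K, c, hc, ?_⟩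
  intro p _ A hp X Tf Q hX hTf hd
  let S : Finset (Fin d →₀ ℕ) := Finset.finsuppAntidiag Finset.univ s
  have hS : ∀ m : Fin d →₀ ℕ, m ∈ S ↔ m.degree = s := by
    intro m
    simp only [S, Finset.mem_finsuppAntidiag, Finset.subset_univ, and_true]
    rw [Finsupp.degree_eq_sum]
  let en := S.equivFin
  let N := S.card
  let rc : VV p N →ₗ[ZMod p] Pol p d := ∑ j, (monomial (en.symm j).1).comp (LinearMap.proj j)
  have hrc : ∀ w, rc w = ∑ j, monomial (en.symm j).1 (w j) := by intro w; simp [rc]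
  let co : Pol p d →ₗ[ZMod p] VV p N := LinearMap.pi fun j => lcoeff (ZMod p) (en.symm j).1
  have hco : ∀ f j, co f j = coeff (en.symm j).1 f := fun f j => rfl
  have hrch : ∀ w, (rc w).IsHomogeneous s := by
    intro w; rw [hrc]
    exact IsHomogeneous.sum _ _ _ fun j _ => isHomogeneous_monomial _ ((hS _).1 (en.symm j).2)
  have hrcc : ∀ w (m : S), coeff m.1 (rc w) = w (en m) := by
    intro w m
    rw [hrc, coeff_sum]
    simp only [coeff_monomial]
    rw [Finset.sum_eq_single (en m)]
    · simp
    · intro j _ hj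
      rw [if_neg]
      intro h
      apply hj
      rw [← Subtype.ext h, Equiv.apply_symm_apply]
    · simp
  have hrcco : ∀ f : Pol p d, f.IsHomogeneous s → rc (co f) = f := by
    intro f hf
    ext m
    by_cases hm : m.degree = s
    · have := hrcc (co f) ⟨m, (hS m).2 hm⟩
      rw [this, hco]; simp
    · rw [(hrch _).coeff_eq_zero hm, hf.coeff_eq_zero hm]
  let R : Submodule (ZMod p) (VV p N) := Submodule.comap rc ((JJ A ⊥).restrictScalars (ZMod p))
  have hR : ∀ w, w ∈ R ↔ rc w ∈ JJ A ⊥ := fun w => Iff.rfl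
  obtain ⟨σ, hσ⟩ := LinearMap.exists_rightInverse_of_surjective R.mkQ (by rw [LinearMap.range_eq_top]; exact R.mkQ_surjective)
  let q : VV p N →ₗ[ZMod p] VV p N := σ ∘ₗ R.mkQ
  have hq0 : ∀ w ∈ R, q w = 0 := by
    intro w hw
    have : R.mkQ w = 0 := by simpa using hw
    simp only [q, LinearMap.comp_apply, this, map_zero]
  have hq1 : ∀ w, w - q w ∈ R := by
    intro w
    have h3 := LinearMap.congr_fun hσ (R.mkQ w)
    have h4 : R.mkQ (q w) = R.mkQ w := h3
    have h5 : R.mkQ (w - q w) = 0 := by rw [map_sub, h4, sub_self]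
    exact (Submodule.Quotient.mk_eq_zero R).1 h5
  obtain ⟨H, hH1, hH2, hH3⟩ := h1 p d N hp (fun a => q (co (X a))) (fun t => q (co (Tf t)))
    (fun a t => Q a ∧ X (a + t) - X a - Tf t ∈ JJ A ⊥) (by
      intro a t h
      have h3 : co (X (a + t) - X a - Tf t) ∈ R := by
        rw [hR, hrcco _ (((hX _).sub (hX _)).sub (hTf _))]; exact h.2
      have h4 := hq0 _ h3
      rw [map_sub, map_sub, map_sub, map_sub, sub_eq_zero] at h4
      exact h4) hd
  obtain ⟨H', hc', hHH, Tt, g, hTg, half⟩ := h2 p N (fun a => q (co (X a))) H hH1 hH3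
  refine ⟨H', hc', fun h hh => ?_, rc g, hrch g, fun h => rc (Tt h), fun h => hrch _, ?_, ?_⟩
  · obtain ⟨t, ht⟩ := hH2 h (hHH h hh)
    exact ht.1
  · intro m hm
    have hmS : m ∈ S := (hS m).2 hm
    have h3 := half (en ⟨m, hmS⟩)
    have h4 : (fun h => coeff m (rc (Tt h))) = fun h => Tt h (en ⟨m, hmS⟩) := by
      ext h; exact hrcc (Tt h) ⟨m, hmS⟩
    rw [h4]; exact h3
  · intro h hh
    have h3 : q (co (X h)) = Tt h + g := hTg h hh
    have h4 := (hR _).1 (hq1 (co (X h)))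
    rw [h3, map_sub, hrcco _ (hX h), map_add] at h4
    rw [sub_sub]; exact h4

/-- **Linearization result for shifted ideals** (main theorem). -/
theorem stmt0 (s d : ℕ) (hs : 1 ≤ s) (hd : (2 * s + 16) * (15 * s + 453) ≤ d)
    (δ : ℝ) (hδ : 0 < δ) :
    ∃ (p0 K : ℕ) (c : ℝ), 0 < c ∧
    ∀ p : ℕ, p.Prime → p0 ≤ p →
    ∀ (M : (Fin d → ZMod p) → ZMod p) (A : Matrix (Fin d) (Fin d) (ZMod p))
      (u : Fin d → ZMod p) (v : ZMod p),
      IsQuadFormWith p d M A u v → A.det ≠ 0 →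
    ∀ H : Finset (Fin d → ZMod p), δ * (p : ℝ) ^ d < (H.card : ℝ) →
    ∀ ξ₁ ξ₂ ξ₃ ξ₄ : (Fin d → ZMod p) → MvPolynomial (Fin d) (ZMod p),
      (∀ h ∈ H, (ξ₁ h).IsHomogeneous s) → (∀ h ∈ H, (ξ₂ h).IsHomogeneous s) →
      (∀ h ∈ H, (ξ₃ h).IsHomogeneous s) → (∀ h ∈ H, (ξ₄ h).IsHomogeneous s) →
    ∀ U : Finset ((Fin d → ZMod p) × (Fin d → ZMod p) × (Fin d → ZMod p) ×
        (Fin d → ZMod p)),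
      (∀ q ∈ U, q.1 ∈ H ∧ q.2.1 ∈ H ∧ q.2.2.1 ∈ H ∧ q.2.2.2 ∈ H ∧
        q.1 + q.2.1 = q.2.2.1 + q.2.2.2) →
      δ * (H.card : ℝ) ^ 3 < (U.card : ℝ) →
      (∀ q ∈ U, ξ₁ q.1 + ξ₂ q.2.1 - ξ₃ q.2.2.1 - ξ₄ q.2.2.2 ∈
        JM p d A (Submodule.span (ZMod p) {q.1, q.2.1, q.2.2.1} :
          Set (Fin d → ZMod p))) →
      ∃ H' : Finset (Fin d → ZMod p), H' ⊆ H ∧ c * (p : ℝ) ^ d ≤ (H'.card : ℝ) ∧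
        ∃ g : MvPolynomial (Fin d) (ZMod p), g.IsHomogeneous s ∧
          ∃ T : (Fin d → ZMod p) → MvPolynomial (Fin d) (ZMod p),
            (∀ h ∈ H', (T h).IsHomogeneous s) ∧
            IsALFHomPoly p d s K (↑H' : Set (Fin d → ZMod p)) T ∧
            ∀ h ∈ H', ξ₁ h - T h - g ∈
              JM p d A (Submodule.span (ZMod p) {h} : Set (Fin d → ZMod p)) := by
  classical
  set δ' := min δ 1 with hδ'
  have pδ' : 0 < δ' := lt_min hδ one_pos
  have lδ' : δ' ≤ δ := min_le_left _ _
  obtain ⟨ε5, q1, pε5, lε5, hcore⟩ := core s (δ' ^ 4) (by positivity) (pow_le_one₀ pδ'.le (min_le_right _ _))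
  obtain ⟨q2, K, c, hc, hord⟩ := ord_poly s d ε5 pε5 lε5
  refine ⟨q1 + q2 + 3, K, c, hc, ?_⟩
  intro p hpp hp M A u v hM hdet H hH ξ₁ ξ₂ ξ₃ ξ₄ hξ1 hξ2 hξ3 hξ4 U hUH hUc hUJ
  haveI : Fact p.Prime := ⟨hpp⟩
  have hp0 : (0:ℝ) < p := by exact_mod_cast hpp.pos
  have hA : Std p d s A := by
    refine ⟨hpp, hM.1, hdet, ?_, by nlinarith⟩
    intro h
    have h2 : ((2 : ℕ) : ZMod p) = 0 := by exact_mod_cast h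
    rw [ZMod.natCast_eq_zero_iff] at h2
    have := Nat.le_of_dvd (by norm_num) h2
    omega
  let z₁ : VV p d → Pol p d := fun a => if a ∈ H then ξ₁ a else 0
  let z₃ : VV p d → Pol p d := fun a => if a ∈ H then ξ₃ a else 0
  let UU : VV p d → VV p d → VV p d → Prop := fun k c a => (a, c, a + k, c - k) ∈ U
  have hz1 : ∀ a ∈ H, z₁ a = ξ₁ a := fun a ha => if_pos ha
  have hz3 : ∀ a ∈ H, z₃ a = ξ₃ a := fun a ha => if_pos ha
  have hUd : δ' ^ 4 ≤ dens (fun x : VV p d × (VV p d × VV p d) => UU x.1 x.2.1 x.2.2) := by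
    rw [dens_eq]
    have h1 : U.card ≤ (Finset.univ.filter fun x : VV p d × (VV p d × VV p d) => UU x.1 x.2.1 x.2.2).card := by
      refine Finset.card_le_card_of_injOn (fun q => (q.2.2.1 - q.1, (q.2.1, q.1))) ?_ ?_
      · intro q hq
        have h5 := (hUH q hq).2.2.2.2
        simp only [Finset.coe_filter, Finset.mem_univ, true_and, Set.mem_setOf_eq, UU]
        have h6 : q = (q.1, q.2.1, q.1 + (q.2.2.1 - q.1), q.2.1 - (q.2.2.1 - q.1)) := by
          refine Prod.ext rfl (Prod.ext rfl (Prod.ext ?_ ?_))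
          · simp
          · show q.2.2.2 = q.2.1 - (q.2.2.1 - q.1)
            have : q.2.2.2 = q.2.2.1 + q.2.2.2 - q.2.2.1 := by abel
            rw [this, ← h5]; abel
        rw [← h6]; exact hq
      · intro q hq q' hq' h
        have h5 := (hUH q hq).2.2.2.2
        have h5' := (hUH q' hq').2.2.2.2
        simp only [Prod.mk.injEq] at h
        obtain ⟨a1, a2, a3⟩ := h
        have a4 : q.2.2.1 = q'.2.2.1 := by rw [a3] at a1; exact sub_left_injective a1
        have a5 : q.2.2.2 = q'.2.2.2 := by
          rw [a3, a2, h5', a4] at h5; exact (add_left_cancel h5).symm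
        exact Prod.ext a3 (Prod.ext a2 (Prod.ext a4 a5))
    have h2 : (Fintype.card (VV p d × (VV p d × VV p d)) : ℝ) = ((p : ℝ) ^ d) ^ 3 := by
      rw [Fintype.card_prod, Fintype.card_prod, card_VV]; push_cast; ring
    rw [h2, le_div_iff₀ (by positivity)]
    have h3 : (U.card : ℝ) ≤ _ := Nat.cast_le.2 h1
    refine le_trans ?_ h3
    have h4 : δ' * (p : ℝ) ^ d ≤ H.card := by
      have : δ' * (p : ℝ) ^ d ≤ δ * (p : ℝ) ^ d := by gcongr
      linarith
    have h5 := pow_le_pow_left₀ (by positivity) h4 3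
    have h6 : δ' * (δ' * (p : ℝ) ^ d) ^ 3 ≤ δ * (H.card : ℝ) ^ 3 := by gcongr
    calc δ' ^ 4 * ((p : ℝ) ^ d) ^ 3 = δ' * (δ' * (p : ℝ) ^ d) ^ 3 := by ring
      _ ≤ _ := h6.trans hUc.le
  obtain ⟨X, Tf, hX, hTf, hden⟩ := hcore p d A (by omega) hA z₁ ξ₂ z₃ ξ₄
    (fun a => by
      by_cases ha : a ∈ H
      · rw [hz1 a ha]; exact hξ1 a ha
      · simp only [z₁, if_neg ha]; exact isHomogeneous_zero _ _ _)
    (fun a => by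
      by_cases ha : a ∈ H
      · rw [hz3 a ha]; exact hξ3 a ha
      · simp only [z₃, if_neg ha]; exact isHomogeneous_zero _ _ _)
    UU (by
      intro k c a h
      have h1 := hUH _ h
      have h2 := hUJ _ h
      simp only at h1 h2
      rw [hz1 a h1.1, hz3 _ h1.2.2.1]
      refine JJ_mono A ?_ h2
      rw [Submodule.span_le]
      have m1 : k ∈ sp {k} ⊔ sp {a} ⊔ sp {c} := le_sup_left (a := sp {k} ⊔ sp {a}) (le_sup_left (a := sp {k}) (Submodule.mem_span_singleton_self k))
      have m2 : a ∈ sp {k} ⊔ sp {a} ⊔ sp {c} := le_sup_left (a := sp {k} ⊔ sp {a}) (le_sup_right (a := sp {k}) (Submodule.mem_span_singleton_self a))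
      have m3 : c ∈ sp {k} ⊔ sp {a} ⊔ sp {c} := le_sup_right (a := sp {k} ⊔ sp {a}) (Submodule.mem_span_singleton_self c)
      rintro w (rfl | rfl | rfl)
      · exact m2
      · exact m3
      · exact add_mem m2 m1) hUd
  obtain ⟨H', hc', hQ, g, hg, T, hT, half, hfin⟩ := hord p A (by omega) X Tf
    (fun a => (∃ k c, UU k c a) ∧ X a - z₁ a ∈ JJ A (sp {a})) hX hTf hden
  have hsub : H' ⊆ H := by
    intro h hh
    obtain ⟨⟨k, c, hk⟩, -⟩ := hQ h hh
    exact (hUH _ hk).1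
  refine ⟨H', hsub, hc', g, hg, T, fun h _ => hT h, half, fun h hh => ?_⟩
  have h1 := (hQ h hh).2
  rw [hz1 h (hsub hh)] at h1
  have h2 := JJ_mono A (bot_le : ⊥ ≤ sp {h}) (hfin h hh)
  have h3 := sub_mem h2 h1
  have h4 : X h - T h - g - (X h - ξ₁ h) = ξ₁ h - T h - g := by ring
  rw [h4] at h3
  exact h3
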